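/- For every positive integer k there is a constant C_k depending only on k with the following property. Let g be a smooth time-dependent metric on ℝ^n with n = 3 over [0,T] solving the Ricci flow, let x₀ ∈ ℝ³, r₀ > 0, A ≥ 2, K_k > 0, and assume: (a) for every t ∈ [0,T] the closure of the ball B_t(x₀, A r₀) is compact; (b) Ric ≤ 2 r₀^{−2} at (x,t) for every x ∈ B_t(x₀, r₀) and every t ∈ [0,T]; (c) λ + μ + k ν ≥ −K_k at (x,0) for every x ∈ B_0(x₀, A r₀). Then λ + μ + k ν ≥ min{ −C_k/(t + 1/K_k), −C_k/(A r₀²) } at (x,t) for every t ∈ [0,T] and every x ∈ B_t(x₀, (A/2) r₀). -/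

import Mathlib

open Set MeasureTheory
open scoped BigOperators Matrix

noncomputable section

variable {n : ℕ}

/-- Partial derivative of `f` at `x` in the `i`-th coordinate direction. -/
def pd (f : (Fin n → ℝ) → ℝ) (i : Fin n) (x : Fin n → ℝ) : ℝ :=
  fderiv ℝ f x (Pi.single i 1)

/-- Christoffel symbols `Γ^k_{ij}` of a (time-independent) metric `G`. -/
def christoffel (G : (Fin n → ℝ) → Matrix (Fin n) (Fin n) ℝ)
    (x : Fin n → ℝ) (k i j : Fin n) : ℝ :=
  (1/2) * ∑ l, (G x)⁻¹ k l *
    (pd (fun y => G y j l) i x + pd (fun y => G y i l) j x - pd (fun y => G y i j) l x)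

/-- Ricci tensor `R_{jk}`. -/
def ricci (G : (Fin n → ℝ) → Matrix (Fin n) (Fin n) ℝ)
    (x : Fin n → ℝ) (j k : Fin n) : ℝ :=
  ∑ i, (pd (fun y => christoffel G y i j k) i x
      - pd (fun y => christoffel G y i i k) j x
      + ∑ p, (christoffel G x i i p * christoffel G x p j k
            - christoffel G x i j p * christoffel G x p i k))

/-- Scalar curvature. -/
def scalarCurv (G : (Fin n → ℝ) → Matrix (Fin n) (Fin n) ℝ) (x : Fin n → ℝ) : ℝ :=
  ∑ j, ∑ k, (G x)⁻¹ j k * ricci G x j k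

/-- Riemann tensor `R_{ijkl}`. -/
def riemann (G : (Fin n → ℝ) → Matrix (Fin n) (Fin n) ℝ)
    (x : Fin n → ℝ) (i j k l : Fin n) : ℝ :=
  ∑ m, G x l m *
    (pd (fun y => christoffel G y m j k) i x - pd (fun y => christoffel G y m i k) j x
      + ∑ p, (christoffel G x m i p * christoffel G x p j k
            - christoffel G x m j p * christoffel G x p i k))

/-- Norm of the Riemann tensor. -/
def riemNorm (G : (Fin n → ℝ) → Matrix (Fin n) (Fin n) ℝ) (x : Fin n → ℝ) : ℝ :=
  Real.sqrt (∑ i, ∑ j, ∑ k, ∑ l, ∑ a, ∑ b, ∑ c, ∑ d,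
    (G x)⁻¹ i a * (G x)⁻¹ j b * (G x)⁻¹ k c * (G x)⁻¹ l d *
      riemann G x i j k l * riemann G x a b c d)

/-- Sectional curvature of the plane spanned by `u`, `v`. -/
def sectionalCurv (G : (Fin n → ℝ) → Matrix (Fin n) (Fin n) ℝ)
    (x : Fin n → ℝ) (u v : Fin n → ℝ) : ℝ :=
  (∑ i, ∑ j, ∑ k, ∑ l, riemann G x i j k l * u i * v j * v k * u l) /
    ((∑ i, ∑ j, G x i j * u i * u j) * (∑ i, ∑ j, G x i j * v i * v j)
      - (∑ i, ∑ j, G x i j * u i * v j) ^ 2)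

/-- Length of a path with respect to the metric `G`. -/
def pathLength (G : (Fin n → ℝ) → Matrix (Fin n) (Fin n) ℝ)
    (γ : ℝ → (Fin n → ℝ)) : ℝ :=
  ∫ s in (0:ℝ)..1, Real.sqrt (∑ i, ∑ j, G (γ s) i j * deriv γ s i * deriv γ s j)

/-- Riemannian distance: infimum of lengths of C¹ paths. -/
def riemDist (G : (Fin n → ℝ) → Matrix (Fin n) (Fin n) ℝ)
    (x y : Fin n → ℝ) : ℝ :=
  sInf {L : ℝ | ∃ γ : ℝ → (Fin n → ℝ),
    ContDiffOn ℝ 1 γ (Icc 0 1) ∧ γ 0 = x ∧ γ 1 = y ∧ L = pathLength G γ}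

/-- Metric ball. -/
def rBall (G : (Fin n → ℝ) → Matrix (Fin n) (Fin n) ℝ)
    (x₀ : Fin n → ℝ) (r : ℝ) : Set (Fin n → ℝ) :=
  {x | riemDist G x₀ x < r}

/-- Completeness of `(ℝⁿ, riemDist G)`. -/
def riemComplete (G : (Fin n → ℝ) → Matrix (Fin n) (Fin n) ℝ) : Prop :=
  ∀ u : ℕ → (Fin n → ℝ),
    (∀ ε > (0:ℝ), ∃ N, ∀ p ≥ N, ∀ q ≥ N, riemDist G (u p) (u q) < ε) →
    ∃ x, ∀ ε > (0:ℝ), ∃ N, ∀ p ≥ N, riemDist G (u p) x < ε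

/-- Riemannian volume of a set. -/
def riemVol (G : (Fin n → ℝ) → Matrix (Fin n) (Fin n) ℝ)
    (S : Set (Fin n → ℝ)) : ℝ :=
  ∫ x in S, Real.sqrt ((G x).det)

/-- A smooth (time-independent) Riemannian metric. -/
def SmoothMetric (G : (Fin n → ℝ) → Matrix (Fin n) (Fin n) ℝ) : Prop :=
  (∀ i j, ContDiff ℝ (⊤ : ℕ∞) (fun x => G x i j)) ∧ ∀ x, (G x).IsSymm ∧ (G x).PosDef

/-- A smooth time-dependent metric over the time interval `I`. -/
def SmoothMetricFamily (g : (Fin n → ℝ) → ℝ → Matrix (Fin n) (Fin n) ℝ)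
    (I : Set ℝ) : Prop :=
  (∀ i j, ContDiffOn ℝ (⊤ : ℕ∞) (fun p : (Fin n → ℝ) × ℝ => g p.1 p.2 i j) (univ ×ˢ I)) ∧
  ∀ x : Fin n → ℝ, ∀ t ∈ I, (g x t).IsSymm ∧ (g x t).PosDef

/-- The Ricci flow equation `∂ₜ g = -2 Ric` over the time interval `I`. -/
def IsRicciFlow (g : (Fin n → ℝ) → ℝ → Matrix (Fin n) (Fin n) ℝ)
    (I : Set ℝ) : Prop :=
  ∀ x : Fin n → ℝ, ∀ t ∈ I, ∀ j k,
    derivWithin (fun s => g x s j k) I t = -2 * ricci (fun y => g y t) x j k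

/-- `lam ≥ mu ≥ nu` are the eigenvalues of the 3×3 matrix `M`
(characterized via the characteristic polynomial). -/
def IsEigTriple (M : Matrix (Fin 3) (Fin 3) ℝ) (lam mu nu : ℝ) : Prop :=
  nu ≤ mu ∧ mu ≤ lam ∧
  ∀ z : ℝ, (z • (1 : Matrix (Fin 3) (Fin 3) ℝ) - M).det = (z - lam) * (z - mu) * (z - nu)

/-- Hamilton's curvature operator `g^{il}(R g_{lj} - 2 R_{lj})` in dimension 3. -/
def curvOp (G : (Fin 3 → ℝ) → Matrix (Fin 3) (Fin 3) ℝ) (x : Fin 3 → ℝ) :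
    Matrix (Fin 3) (Fin 3) ℝ :=
  Matrix.of fun i j => ∑ l, (G x)⁻¹ i l * (scalarCurv G x * G x l j - 2 * ricci G x l j)

/-! ### Curvature in a differential algebra -/

section CurvatureAlgebra

variable {A : Type*} [CommRing A] [Algebra ℝ A]

/-- The coefficients `R^m_{ijk}` of the curvature of a connection with coefficients `Γ`. -/
def algRm (D : Fin 3 → Derivation ℝ A A) (Γ : Fin 3 → Fin 3 → Fin 3 → A) (m i j k : Fin 3) : A :=
  D i (Γ m j k) - D j (Γ m i k) + ∑ p, (Γ m i p * Γ p j k - Γ m j p * Γ p i k)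

/-- The Ricci coefficients of a connection. -/
def algRic (D : Fin 3 → Derivation ℝ A A) (Γ : Fin 3 → Fin 3 → Fin 3 → A) (j k : Fin 3) : A :=
  ∑ i, algRm D Γ i i j k

/-- Covariant derivative of a covariant 2-tensor. -/
def cov (D : Fin 3 → Derivation ℝ A A) (Γ : Fin 3 → Fin 3 → Fin 3 → A)
    (S : Fin 3 → Fin 3 → A) (a j k : Fin 3) : A :=
  D a (S j k) - ∑ p, Γ p a j * S p k - ∑ p, Γ p a k * S j p

/-- Covariant derivative of a covariant 3-tensor. -/
def cov3 (D : Fin 3 → Derivation ℝ A A) (Γ : Fin 3 → Fin 3 → Fin 3 → A)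
    (S : Fin 3 → Fin 3 → Fin 3 → A) (a b j k : Fin 3) : A :=
  D a (S b j k) - ∑ p, Γ p a b * S p j k - ∑ p, Γ p a j * S b p k - ∑ p, Γ p a k * S b j p

/-- Covariant derivative of the curvature coefficients. -/
def covRm (D : Fin 3 → Derivation ℝ A A) (Γ : Fin 3 → Fin 3 → Fin 3 → A)
    (h m i j k : Fin 3) : A :=
  D h (algRm D Γ m i j k) + ∑ p, Γ m h p * algRm D Γ p i j k - ∑ p, Γ p h i * algRm D Γ m p j k
    - ∑ p, Γ p h j * algRm D Γ m i p k - ∑ p, Γ p h k * algRm D Γ m i j p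

/-- The algebraic relations between a metric, its inverse and its Levi-Civita coefficients. -/
structure IsLeviCivita (D : Fin 3 → Derivation ℝ A A) (g gi : Fin 3 → Fin 3 → A)
    (Γ : Fin 3 → Fin 3 → Fin 3 → A) : Prop where
  comm : ∀ i j f, D i (D j f) = D j (D i f)
  g_symm : ∀ i j, g i j = g j i
  gi_symm : ∀ i j, gi i j = gi j i
  inv : ∀ i j, ∑ l, gi i l * g l j = if i = j then 1 else 0
  torsion : ∀ k i j, Γ k i j = Γ k j i
  compat : ∀ a j k, D a (g j k) = ∑ p, Γ p a j * g p k + ∑ p, Γ p a k * g j p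

variable {D : Fin 3 → Derivation ℝ A A} {g gi : Fin 3 → Fin 3 → A} {Γ : Fin 3 → Fin 3 → Fin 3 → A}

lemma eq_of_two_mul_eq {x y : A} (h : 2 * x = 2 * y) : x = y := by
  have h2 : algebraMap ℝ A (1/2) * 2 = 1 := by
    rw [← map_ofNat (algebraMap ℝ A) 2, ← map_mul]; norm_num
  calc x = algebraMap ℝ A (1/2) * (2 * x) := by rw [← mul_assoc, h2, one_mul]
    _ = y := by rw [h, ← mul_assoc, h2, one_mul]

lemma algRm_swap (m i j k : Fin 3) : algRm D Γ m i j k = - algRm D Γ m j i k := by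
  simp only [algRm, Fin.sum_univ_three]; ring

/-- The Ricci identity for covariant 2-tensors. -/
lemma ricci_identity (H : IsLeviCivita D g gi Γ) (S : Fin 3 → Fin 3 → A) (a b j k : Fin 3) :
    cov3 D Γ (cov D Γ S) a b j k - cov3 D Γ (cov D Γ S) b a j k
      = - ∑ p, algRm D Γ p a b j * S p k - ∑ p, algRm D Γ p a b k * S j p := by
  simp only [cov3, cov, algRm, Fin.sum_univ_three, map_sub, map_add, Derivation.leibniz, smul_eq_mul]
  rw [H.comm a b, H.torsion 0 a b, H.torsion 1 a b, H.torsion 2 a b]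
  ring

lemma cov_metric (H : IsLeviCivita D g gi Γ) (a j k : Fin 3) : cov D Γ g a j k = 0 := by
  rw [cov, H.compat]; ring

lemma riem_lower_swap (H : IsLeviCivita D g gi Γ) (a b j k : Fin 3) :
    ∑ p, algRm D Γ p a b j * g p k = - ∑ p, algRm D Γ p a b k * g p j := by
  have h := ricci_identity H g a b j k
  have h0 : cov D Γ g = fun _ _ _ => 0 := by
    funext a j k; exact cov_metric H a j k
  rw [h0] at h
  simp only [cov3, map_zero, mul_zero, Finset.sum_const_zero, sub_zero] at h
  simp only [H.g_symm j] at h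
  linear_combination h

/-- The second Bianchi identity. -/
lemma second_bianchi (H : IsLeviCivita D g gi Γ) (h m i j k : Fin 3) :
    covRm D Γ h m i j k + covRm D Γ i m j h k + covRm D Γ j m h i k = 0 := by
  have e : D h (algRm D Γ m i j k) + ∑ p, Γ m h p * algRm D Γ p i j k
        - ∑ p, Γ p h k * algRm D Γ m i j p
      + (D i (algRm D Γ m j h k) + ∑ p, Γ m i p * algRm D Γ p j h k
        - ∑ p, Γ p i k * algRm D Γ m j h p)
      + (D j (algRm D Γ m h i k) + ∑ p, Γ m j p * algRm D Γ p h i k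
        - ∑ p, Γ p j k * algRm D Γ m h i p) = 0 := by
    simp only [algRm, Fin.sum_univ_three, map_sub, map_add, Derivation.leibniz, smul_eq_mul]
    rw [H.comm i h (Γ m j k), H.comm j h (Γ m i k), H.comm j i (Γ m h k)]
    ring
  simp only [covRm]
  have s1 := algRm_swap (D := D) (Γ := Γ) m
  simp only [Fin.sum_univ_three] at e ⊢
  simp only [H.torsion _ i h, H.torsion _ j h, H.torsion _ j i]
  rw [s1 0 j k, s1 1 j k, s1 2 j k, s1 0 h k, s1 1 h k, s1 2 h k, s1 0 i k, s1 1 i k, s1 2 i k]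
  linear_combination e

end CurvatureAlgebra

section CurvatureAlgebra

variable {A : Type*} [CommRing A] [Algebra ℝ A]
variable {D : Fin 3 → Derivation ℝ A A} {g gi : Fin 3 → Fin 3 → A} {Γ : Fin 3 → Fin 3 → Fin 3 → A}

lemma IsLeviCivita.inv' (H : IsLeviCivita D g gi Γ) (i j : Fin 3) :
    ∑ l, g i l * gi l j = if i = j then 1 else 0 := by
  have h : Matrix.of gi * Matrix.of g = 1 := by
    ext i j
    simpa [Matrix.mul_apply, Matrix.one_apply] using H.inv i j
  have h' := congrFun (congrFun (mul_eq_one_comm.mp h : Matrix.of g * Matrix.of gi = 1) i) j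
  simpa [Matrix.mul_apply, Matrix.one_apply] using h'

/-- Contracting with `g` is injective. -/
lemma IsLeviCivita.lower_inj (H : IsLeviCivita D g gi Γ) {u w : Fin 3 → A}
    (h : ∀ k, ∑ p, u p * g p k = ∑ p, w p * g p k) (m : Fin 3) : u m = w m := by
  have key : ∀ u : Fin 3 → A, u m = ∑ k, (∑ p, u p * g p k) * gi k m := by
    intro u
    calc u m = ∑ p, u p * (if p = m then 1 else 0) := by simp
      _ = _ := by
        simp_rw [← H.inv', Finset.mul_sum, Finset.sum_mul]
        rw [Finset.sum_comm]
        simp_rw [mul_assoc]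
  rw [key u, key w]; simp_rw [h]

lemma IsLeviCivita.deriv_inv (H : IsLeviCivita D g gi Γ) (a j k : Fin 3) :
    D a (gi j k) = - ∑ p, Γ j a p * gi p k - ∑ p, Γ k a p * gi j p := by
  refine H.lower_inj (u := fun k => D a (gi j k))
    (w := fun k => - ∑ p, Γ j a p * gi p k - ∑ p, Γ k a p * gi j p) (fun l => ?_) k
  have e : D a (∑ p, gi j p * g p l) = 0 := by
    rw [H.inv]; split_ifs
    · exact Derivation.map_one_eq_zero _
    · exact map_zero _
  simp only [Fin.sum_univ_three, map_add, Derivation.leibniz, smul_eq_mul, H.compat] at e ⊢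
  have i0 := H.inv 0 l
  have i1 := H.inv 1 l
  have i2 := H.inv 2 l
  have ij := H.inv j
  have j0 := ij 0
  have j1 := ij 1
  have j2 := ij 2
  have jl : ∑ q, Γ q a l * (if j = q then (1 : A) else 0) = Γ j a l := by simp
  have jl' : ∑ q, Γ j a q * (if q = l then (1 : A) else 0) = Γ j a l := by simp
  simp only [Fin.sum_univ_three] at i0 i1 i2 j0 j1 j2 jl jl'
  linear_combination e - Γ 0 a l * j0 - Γ 1 a l * j1 - Γ 2 a l * j2 + Γ j a 0 * i0
    + Γ j a 1 * i1 + Γ j a 2 * i2 - jl + jl'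

/-- The coefficients vanish in the covariant derivative of a contraction with the inverse metric. -/
lemma deriv_contract (H : IsLeviCivita D g gi Γ) (S : Fin 3 → Fin 3 → A) (a : Fin 3) :
    D a (∑ i, ∑ l, gi i l * S i l) = ∑ i, ∑ l, gi i l * cov D Γ S a i l := by
  simp only [cov, Fin.sum_univ_three, map_add, Derivation.leibniz, smul_eq_mul, H.deriv_inv]
  ring

lemma cov_contract (H : IsLeviCivita D g gi Γ) (S : Fin 3 → Fin 3 → Fin 3 → A) (a k : Fin 3) :
    D a (∑ i, ∑ l, gi i l * S i k l) - ∑ p, Γ p a k * ∑ i, ∑ l, gi i l * S i p l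
      = ∑ i, ∑ l, gi i l * cov3 D Γ S a i k l := by
  simp only [cov3, Fin.sum_univ_three, map_add, Derivation.leibniz, smul_eq_mul, H.deriv_inv]
  ring

lemma cov_contract' (H : IsLeviCivita D g gi Γ) (S : Fin 3 → Fin 3 → Fin 3 → A) (a k : Fin 3) :
    D a (∑ i, ∑ l, gi i l * S k i l) - ∑ p, Γ p a k * ∑ i, ∑ l, gi i l * S p i l
      = ∑ i, ∑ l, gi i l * cov3 D Γ S a k i l := by
  simp only [cov3, Fin.sum_univ_three, map_add, Derivation.leibniz, smul_eq_mul, H.deriv_inv]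
  ring

lemma trace_covRm (h j k : Fin 3) :
    ∑ i, covRm D Γ h i i j k = cov D Γ (algRic D Γ) h j k := by
  simp only [covRm, cov, algRic, Fin.sum_univ_three, map_add]
  ring

lemma covRm_swap (h m i j k : Fin 3) : covRm D Γ h m i j k = - covRm D Γ h m j i k := by
  simp only [covRm, Fin.sum_univ_three]
  rw [algRm_swap m i j k, map_neg]
  rw [algRm_swap 0 i j k, algRm_swap 1 i j k, algRm_swap 2 i j k, algRm_swap m 0 j k,
    algRm_swap m 1 j k, algRm_swap m 2 j k, algRm_swap m i 0 k, algRm_swap m i 1 k,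
    algRm_swap m i 2 k, algRm_swap m i j 0, algRm_swap m i j 1, algRm_swap m i j 2]
  ring

lemma contract_algRm (H : IsLeviCivita D g gi Γ) (m h : Fin 3) :
    ∑ j, ∑ k, gi j k * algRm D Γ m j h k = - ∑ l, gi m l * algRic D Γ h l := by
  refine H.lower_inj (u := fun m => ∑ j, ∑ k, gi j k * algRm D Γ m j h k)
    (w := fun m => - ∑ l, gi m l * algRic D Γ h l) (fun q => ?_) m
  have e1 : ∀ j k, ∑ p, algRm D Γ p j h k * g p q = - ∑ p, algRm D Γ p j h q * g p k :=
    fun j k => riem_lower_swap H j h k q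
  have e2 : ∑ p, (∑ j, ∑ k, gi j k * algRm D Γ p j h k) * g p q
      = ∑ j, ∑ k, gi j k * ∑ p, algRm D Γ p j h k * g p q := by
    simp only [Fin.sum_univ_three]; ring
  have e3 : ∑ j, ∑ k, gi j k * ∑ p, algRm D Γ p j h k * g p q
      = - ∑ j, ∑ p, algRm D Γ p j h q * ∑ k, gi j k * g k p := by
    simp only [e1]
    simp only [Fin.sum_univ_three, H.g_symm 2 0, H.g_symm 2 1, H.g_symm 1 0]; ring
  have e4 : ∑ p, (- ∑ l, gi p l * algRic D Γ h l) * g p q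
      = - ∑ l, algRic D Γ h l * ∑ p, gi l p * g p q := by
    simp only [Fin.sum_univ_three, H.gi_symm 2 0, H.gi_symm 2 1, H.gi_symm 1 0]; ring
  rw [e2, e3, e4]
  simp only [H.inv]
  simp [algRic]

/-- The contracted second Bianchi identity. -/
lemma contracted_bianchi (H : IsLeviCivita D g gi Γ) (h : Fin 3) :
    2 * ∑ i, ∑ l, gi i l * cov D Γ (algRic D Γ) i h l
      = ∑ i, ∑ l, gi i l * cov D Γ (algRic D Γ) h i l := by
  have b : ∀ j k, cov D Γ (algRic D Γ) h j k - cov D Γ (algRic D Γ) j h k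
      + ∑ i, covRm D Γ i i j h k = 0 := by
    intro j k
    have := fun i => second_bianchi H h i i j k
    rw [← trace_covRm h j k, ← trace_covRm j h k]
    have e := Finset.sum_eq_zero (s := Finset.univ) (fun i _ => this i)
    simp only [covRm_swap j _ h _ k] at e
    simp only [Fin.sum_univ_three] at e ⊢
    linear_combination e
  have d : ∑ j, ∑ k, gi j k * ∑ i, covRm D Γ i i j h k
      = - ∑ i, ∑ l, gi i l * cov D Γ (algRic D Γ) i h l := by
    have e1 : ∑ j, ∑ k, gi j k * ∑ i, covRm D Γ i i j h k
      = ∑ i, (D i (∑ j, ∑ k, gi j k * algRm D Γ i j h k)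
        + ∑ p, Γ i i p * (∑ j, ∑ k, gi j k * algRm D Γ p j h k)
        - ∑ p, Γ p i h * (∑ j, ∑ k, gi j k * algRm D Γ i j p k)) := by
      simp only [covRm, Fin.sum_univ_three, map_add, Derivation.leibniz, smul_eq_mul, H.deriv_inv]
      ring
    rw [e1]
    simp only [contract_algRm H]
    simp only [cov, Fin.sum_univ_three, map_add, map_neg, Derivation.leibniz, smul_eq_mul,
      H.deriv_inv]
    ring
  have t : ∑ j, ∑ k, gi j k * (cov D Γ (algRic D Γ) h j k - cov D Γ (algRic D Γ) j h k
      + ∑ i, covRm D Γ i i j h k) = 0 := by simp [b]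
  simp only [mul_add, mul_sub, Finset.sum_add_distrib, Finset.sum_sub_distrib, d] at t
  linear_combination -t

end CurvatureAlgebra

section CurvatureAlgebra

variable {A : Type*} [CommRing A] [Algebra ℝ A]
variable {D : Fin 3 → Derivation ℝ A A} {g gi : Fin 3 → Fin 3 → A} {Γ : Fin 3 → Fin 3 → Fin 3 → A}
  {Dt : Derivation ℝ A A}

/-- The Ricci flow in a differential algebra with time derivation `Dt`. -/
structure IsAlgRicciFlow (D : Fin 3 → Derivation ℝ A A) (Dt : Derivation ℝ A A)
    (g gi : Fin 3 → Fin 3 → A) (Γ : Fin 3 → Fin 3 → Fin 3 → A) : Prop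
    extends IsLeviCivita D g gi Γ where
  comm_t : ∀ i f, Dt (D i f) = D i (Dt f)
  flow : ∀ j k, Dt (g j k) = -2 * algRic D Γ j k

lemma IsAlgRicciFlow.ric_symm (H : IsAlgRicciFlow D Dt g gi Γ) (j k : Fin 3) :
    algRic D Γ j k = algRic D Γ k j := by
  apply eq_of_two_mul_eq
  have := H.flow j k
  rw [H.g_symm, H.flow] at this
  linear_combination this

/-- The time derivative of the connection with lowered index, up to sign. -/
def ricVar (D : Fin 3 → Derivation ℝ A A) (Γ : Fin 3 → Fin 3 → Fin 3 → A) (l j k : Fin 3) : A :=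
  cov D Γ (algRic D Γ) j k l + cov D Γ (algRic D Γ) k j l - cov D Γ (algRic D Γ) l j k

lemma IsAlgRicciFlow.dt_gamma_lower (H : IsAlgRicciFlow D Dt g gi Γ) (i j k : Fin 3) :
    ∑ p, Dt (Γ p i j) * g p k = - ricVar D Γ k i j := by
  have b : ∀ a j k, ∑ p, Dt (Γ p a j) * g p k + ∑ p, Dt (Γ p a k) * g p j
      = -2 * cov D Γ (algRic D Γ) a j k := by
    intro a j k
    have h := congrArg Dt (H.compat a j k)
    rw [H.comm_t, H.flow] at h
    have e : D a (-2 * algRic D Γ j k) = -2 * D a (algRic D Γ j k) := by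
      rw [neg_mul, map_neg, two_mul, map_add]; ring
    rw [e] at h
    simp only [Fin.sum_univ_three, map_add, Derivation.leibniz, smul_eq_mul, H.flow, cov,
      H.g_symm j] at h ⊢
    linear_combination -h - 2 * Γ 0 a k * H.ric_symm j 0 - 2 * Γ 1 a k * H.ric_symm j 1
      - 2 * Γ 2 a k * H.ric_symm j 2
  apply eq_of_two_mul_eq
  have b1 := b i j k
  have b2 := b j i k
  have b3 := b k i j
  have t1 : ∀ p, Dt (Γ p j i) = Dt (Γ p i j) := fun p => by rw [H.torsion]
  have t2 : ∀ p, Dt (Γ p k i) = Dt (Γ p i k) := fun p => by rw [H.torsion]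
  have t3 : ∀ p, Dt (Γ p k j) = Dt (Γ p j k) := fun p => by rw [H.torsion]
  simp only [t1, t2, t3] at b1 b2 b3
  rw [ricVar]
  linear_combination b1 + b2 - b3

lemma IsAlgRicciFlow.dt_gamma (H : IsAlgRicciFlow D Dt g gi Γ) (m i j : Fin 3) :
    Dt (Γ m i j) = - ∑ l, gi m l * ricVar D Γ l i j := by
  refine H.lower_inj (u := fun m => Dt (Γ m i j))
    (w := fun m => - ∑ l, gi m l * ricVar D Γ l i j) (fun q => ?_) m
  have e4 : ∑ p, (- ∑ l, gi p l * ricVar D Γ l i j) * g p q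
      = - ∑ l, ricVar D Γ l i j * ∑ p, gi l p * g p q := by
    simp only [Fin.sum_univ_three, H.gi_symm 2 0, H.gi_symm 2 1, H.gi_symm 1 0]; ring
  rw [H.dt_gamma_lower, e4]
  simp [H.inv]

lemma IsAlgRicciFlow.dt_ric_aux (H : IsAlgRicciFlow D Dt g gi Γ) (j k : Fin 3) :
    Dt (algRic D Γ j k) = - ∑ m, ∑ l, gi m l *
      (cov3 D Γ (ricVar D Γ) m l j k - cov3 D Γ (ricVar D Γ) j l m k) := by
  set U : Fin 3 → Fin 3 → Fin 3 → A := fun m i j => - ∑ l, gi m l * ricVar D Γ l i j with hU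
  have e1 : Dt (algRic D Γ j k) = ∑ m, ((D m (U m j k) + ∑ p, Γ m m p * U p j k
      - ∑ p, Γ p m j * U m p k - ∑ p, Γ p m k * U m j p)
      - (D j (U m m k) + ∑ p, Γ m j p * U p m k
      - ∑ p, Γ p j m * U m p k - ∑ p, Γ p j k * U m m p)) := by
    have hd : ∀ m i j, Dt (Γ m i j) = U m i j := H.dt_gamma
    simp only [algRic, algRm, Fin.sum_univ_three, map_add, map_sub, Derivation.leibniz,
      smul_eq_mul, H.comm_t, hd]
    simp only [H.torsion _ _ j]
    ring
  rw [e1, hU]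
  generalize ricVar D Γ = X
  simp only [cov3, Fin.sum_univ_three, map_add, map_neg, Derivation.leibniz,
      smul_eq_mul, H.deriv_inv]
  ring

lemma cov3_ricVar (i l j k : Fin 3) : cov3 D Γ (ricVar D Γ) i l j k
    = cov3 D Γ (cov D Γ (algRic D Γ)) i j k l + cov3 D Γ (cov D Γ (algRic D Γ)) i k j l
      - cov3 D Γ (cov D Γ (algRic D Γ)) i l j k := by
  have : ∀ l j k, ricVar D Γ l j k = cov D Γ (algRic D Γ) j k l + cov D Γ (algRic D Γ) k j l
    - cov D Γ (algRic D Γ) l j k := fun _ _ _ => rfl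
  generalize cov D Γ (algRic D Γ) = S at *
  simp only [cov3, this, map_add, map_sub, Fin.sum_univ_three]
  ring

lemma contracted_bianchi_cov (H : IsLeviCivita D g gi Γ) (j k : Fin 3) :
    2 * ∑ i, ∑ l, gi i l * cov3 D Γ (cov D Γ (algRic D Γ)) j i k l
      = ∑ i, ∑ l, gi i l * cov3 D Γ (cov D Γ (algRic D Γ)) j k i l := by
  rw [← cov_contract H, ← cov_contract' H]
  simp only [← contracted_bianchi H]
  simp only [two_mul, map_add, Fin.sum_univ_three]
  ring

lemma cov_symm {S : Fin 3 → Fin 3 → A} (hs : ∀ j k, S j k = S k j) (a j k : Fin 3) :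
    cov D Γ S a j k = cov D Γ S a k j := by
  simp only [cov, Fin.sum_univ_three]
  rw [hs j k, hs 0 k, hs 1 k, hs 2 k, hs j 0, hs j 1, hs j 2]
  ring

lemma cov3_symm {S : Fin 3 → Fin 3 → Fin 3 → A} (hs : ∀ i j k, S i j k = S i k j)
    (a i j k : Fin 3) : cov3 D Γ S a i j k = cov3 D Γ S a i k j := by
  simp only [cov3, Fin.sum_univ_three]
  rw [hs i j k, hs i 0 k, hs i 1 k, hs i 2 k, hs i j 0, hs i j 1, hs i j 2, hs 0 j k, hs 1 j k,
    hs 2 j k]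
  ring

/-- The Hessian of a contraction with the inverse metric is symmetric. -/
lemma hessian_contract_symm (H : IsLeviCivita D g gi Γ) (S : Fin 3 → Fin 3 → A) (j k : Fin 3) :
    ∑ i, ∑ l, gi i l * cov3 D Γ (cov D Γ S) j k i l
      = ∑ i, ∑ l, gi i l * cov3 D Γ (cov D Γ S) k j i l := by
  simp only [← cov_contract' H, ← deriv_contract H]
  rw [H.comm j k]
  simp only [H.torsion _ j k]

/-- The evolution of the Ricci tensor under the Ricci flow. -/
lemma IsAlgRicciFlow.dt_ric (H : IsAlgRicciFlow D Dt g gi Γ) (j k : Fin 3) :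
    Dt (algRic D Γ j k) = ∑ i, ∑ l, gi i l * cov3 D Γ (cov D Γ (algRic D Γ)) i l j k
      + ∑ i, ∑ l, gi i l * (∑ p, algRm D Γ p i j k * algRic D Γ p l
        + ∑ p, algRm D Γ p i j l * algRic D Γ k p
        + ∑ p, algRm D Γ p i k j * algRic D Γ p l
        + ∑ p, algRm D Γ p i k l * algRic D Γ j p) := by
  have H' := H.toIsLeviCivita
  rw [H.dt_ric_aux]
  simp only [cov3_ricVar]
  have hh := hessian_contract_symm H' (algRic D Γ) j k
  have b1 := contracted_bianchi_cov H' j k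
  have b2 := contracted_bianchi_cov H' k j
  have sS := cov3_symm (D := D) (Γ := Γ) (cov_symm (D := D) (Γ := Γ) H.ric_symm) j
  have r : ∀ a b j k, cov3 D Γ (cov D Γ (algRic D Γ)) a b j k
      = cov3 D Γ (cov D Γ (algRic D Γ)) b a j k - ∑ p, algRm D Γ p a b j * algRic D Γ p k
      - ∑ p, algRm D Γ p a b k * algRic D Γ j p := fun a b j k => by
    linear_combination ricci_identity H' (algRic D Γ) a b j k
  generalize cov3 D Γ (cov D Γ (algRic D Γ)) = S at *
  have e : ∑ i, ∑ l, gi i l * S j l i k = ∑ i, ∑ l, gi i l * S j i k l := by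
    rw [Finset.sum_comm]
    simp only [sS _ _ k, H.gi_symm]
  have r1 := fun m l => r m j k l
  have r2 := fun m l => r m k j l
  simp only [r1, r2]
  apply eq_of_two_mul_eq
  simp only [mul_add, mul_sub, Finset.sum_add_distrib, Finset.sum_sub_distrib] at *
  linear_combination -b1 - b2 + hh - 2 * e

end CurvatureAlgebra

section CurvatureAlgebra

variable {A : Type*} [CommRing A] [Algebra ℝ A]
variable {D : Fin 3 → Derivation ℝ A A} {g gi : Fin 3 → Fin 3 → A} {Γ : Fin 3 → Fin 3 → Fin 3 → A}
  {Dt : Derivation ℝ A A}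

/-- The derivations along a frame. -/
def frameD (e : Matrix (Fin 3) (Fin 3) A) (D : Fin 3 → Derivation ℝ A A) (a : Fin 3) :
    Derivation ℝ A A := ∑ i, e i a • D i

/-- The components of a covariant 2-tensor in a frame. -/
def frameS (e : Matrix (Fin 3) (Fin 3) A) (S : Fin 3 → Fin 3 → A) (a b : Fin 3) : A :=
  ∑ i, ∑ j, e i a * e j b * S i j

/-- The connection coefficients in a constant frame `e` with inverse `f`. -/
def frameΓ (e f : Matrix (Fin 3) (Fin 3) A) (Γ : Fin 3 → Fin 3 → Fin 3 → A) (c a b : Fin 3) : A :=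
  ∑ i, e i a * ∑ p, ∑ q, f c p * Γ p i q * e q b

lemma frameD_apply (e : Matrix (Fin 3) (Fin 3) A) (a : Fin 3) (x : A) :
    frameD e D a x = ∑ i, e i a * D i x := by
  simp [frameD, Fin.sum_univ_three]

/-- A constant frame together with its inverse. -/
structure IsConstFrame (D : Fin 3 → Derivation ℝ A A) (e f : Matrix (Fin 3) (Fin 3) A) : Prop where
  inv : f * e = 1
  const_e : ∀ i a b, D i (e a b) = 0
  const_f : ∀ i a b, D i (f a b) = 0

variable {e f : Matrix (Fin 3) (Fin 3) A}

lemma IsConstFrame.inv' (hE : IsConstFrame D e f) : e * f = 1 :=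
  (mul_eq_one_comm.mp hE.inv : e * f = 1)

lemma IsConstFrame.sum_e_f (hE : IsConstFrame D e f) (i j : Fin 3) :
    ∑ a, e i a * f a j = if i = j then 1 else 0 := by
  have := congrFun (congrFun hE.inv' i) j
  simpa [Matrix.mul_apply, Matrix.one_apply] using this

omit [Algebra ℝ A] in
lemma sum_delta_left (x : Fin 3 → A) (i : Fin 3) :
    ∑ j, (if i = j then (1 : A) else 0) * x j = x i := by simp

lemma frame_contract (hE : IsConstFrame D e f) (x y : Fin 3 → A) :
    ∑ a, (∑ i, e i a * x i) * (∑ j, f a j * y j) = ∑ i, x i * y i := by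
  have h := hE.sum_e_f
  calc ∑ a, (∑ i, e i a * x i) * (∑ j, f a j * y j)
      = ∑ i, x i * ∑ j, (∑ a, e i a * f a j) * y j := by
        simp only [Fin.sum_univ_three]; ring
    _ = _ := by simp [h]

lemma frameΓ_mul (hE : IsConstFrame D e f) (m a b k : Fin 3) :
    ∑ p, frameΓ e f Γ m a p * frameΓ e f Γ p b k
      = ∑ i, ∑ j, e i a * e j b * ∑ r, ∑ q, f m r * (∑ p, Γ r i p * Γ p j q) * e q k := by
  have h := frame_contract hE (fun q => ∑ i, e i a * ∑ p, f m p * Γ p i q)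
    (fun p => ∑ j, e j b * ∑ q, Γ p j q * e q k)
  calc _ = ∑ p, (∑ q, e q p * ∑ i, e i a * ∑ r, f m r * Γ r i q)
        * (∑ r, f p r * ∑ j, e j b * ∑ q, Γ r j q * e q k) := by
        refine Finset.sum_congr rfl fun p _ => ?_
        simp only [frameΓ]
        congr 1
        · simp only [Fin.sum_univ_three]; ring
        · simp only [Fin.sum_univ_three]; ring
    _ = _ := by
        rw [h]
        simp only [Finset.mul_sum, Finset.sum_mul]
        simp only [Fin.sum_univ_three]; ring

lemma frame_algRm (hE : IsConstFrame D e f) (m a b k : Fin 3) :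
    algRm (frameD e D) (frameΓ e f Γ) m a b k
      = ∑ i, ∑ j, e i a * e j b * ∑ r, ∑ q, f m r * algRm D Γ r i j q * e q k := by
  have hd : ∀ a b, frameD e D a (frameΓ e f Γ m b k)
      = ∑ i, ∑ j, e i a * e j b * ∑ r, ∑ q, f m r * D i (Γ r j q) * e q k := by
    intro a b
    rw [frameD_apply]
    refine Finset.sum_congr rfl fun i _ => ?_
    simp only [frameΓ, Fin.sum_univ_three, map_add, Derivation.leibniz, smul_eq_mul, hE.const_e,
      hE.const_f]
    ring
  rw [algRm, hd, hd, Finset.sum_sub_distrib, frameΓ_mul hE, frameΓ_mul hE]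
  have sw : ∀ X : Fin 3 → Fin 3 → A, ∑ i, ∑ j, e i b * e j a * X i j
      = ∑ i, ∑ j, e i a * e j b * X j i := by
    intro X; simp only [Fin.sum_univ_three]; ring
  rw [sw, sw, ← Finset.sum_sub_distrib, ← Finset.sum_sub_distrib, ← Finset.sum_add_distrib]
  refine Finset.sum_congr rfl fun i _ => ?_
  rw [← Finset.sum_sub_distrib, ← Finset.sum_sub_distrib, ← Finset.sum_add_distrib]
  refine Finset.sum_congr rfl fun j _ => ?_
  simp only [algRm]
  generalize hX : (fun r q => ∑ p, Γ r i p * Γ p j q) = X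
  generalize hY : (fun r q => ∑ p, Γ r j p * Γ p i q) = Y
  have hX' : ∀ r q, ∑ p, Γ r i p * Γ p j q = X r q := fun r q => by rw [← hX]
  have hY' : ∀ r q, ∑ p, Γ r j p * Γ p i q = Y r q := fun r q => by rw [← hY]
  simp only [Finset.sum_sub_distrib, hX', hY', Fin.sum_univ_three]
  ring

lemma frame_algRic (hE : IsConstFrame D e f) (b k : Fin 3) :
    algRic (frameD e D) (frameΓ e f Γ) b k = frameS e (algRic D Γ) b k := by
  simp only [algRic, frame_algRm hE, frameS]
  have h := fun j q => frame_contract hE (fun i => 1) (fun r => algRm D Γ r r j q)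
  calc _ = ∑ j, ∑ q, e j b * e q k * ∑ i, ∑ r, (∑ a, e i a * f a r) * algRm D Γ r i j q := by
        generalize algRm D Γ = R
        simp only [Fin.sum_univ_three]; ring
    _ = _ := by simp only [hE.sum_e_f, sum_delta_left]

lemma IsLeviCivita.frame (H : IsLeviCivita D g gi Γ) (hE : IsConstFrame D e f) :
    IsLeviCivita (frameD e D) (frameS e g) (frameS fᵀ gi) (frameΓ e f Γ) where
  comm := by
    intro a b x
    simp only [frameD_apply, Fin.sum_univ_three, map_add, Derivation.leibniz, hE.const_e,
      smul_eq_mul, H.comm 1 0, H.comm 2 0, H.comm 2 1]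
    ring
  g_symm := by
    intro a b
    simp only [frameS, Fin.sum_univ_three, H.g_symm 1 0, H.g_symm 2 0, H.g_symm 2 1]; ring
  gi_symm := by
    intro a b
    simp only [frameS, Fin.sum_univ_three, H.gi_symm 1 0, H.gi_symm 2 0, H.gi_symm 2 1]; ring
  inv := by
    intro a b
    have h := frame_contract hE (fun k => ∑ m, e m b * g k m) (fun j => ∑ i, f a i * gi i j)
    have h1 := congrFun (congrFun hE.inv a) b
    rw [Matrix.mul_apply, Matrix.one_apply] at h1
    calc _ = ∑ l, (∑ k, e k l * ∑ m, e m b * g k m) * (∑ j, f l j * ∑ i, f a i * gi i j) := by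
          simp only [frameS, Matrix.transpose_apply, Fin.sum_univ_three]; ring
      _ = ∑ i, f a i * ∑ m, (∑ k, gi i k * g k m) * e m b := by
          rw [h]
          simp only [Fin.sum_univ_three]; ring
      _ = _ := by simp only [H.inv, sum_delta_left, h1]
  torsion := by
    intro c a b
    simp only [frameΓ, Fin.sum_univ_three]
    simp only [H.torsion _ 1 0, H.torsion _ 2 0, H.torsion _ 2 1]; ring
  compat := by
    intro a b c
    have h1 : ∀ b c, ∑ p, frameΓ e f Γ p a b * frameS e g p c
        = ∑ i, e i a * ∑ j, ∑ k, e j b * e k c * ∑ p, Γ p i j * g p k := by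
      intro b c
      have h := frame_contract hE (fun l => ∑ k, e k c * g l k)
        (fun p => ∑ i, e i a * ∑ q, Γ p i q * e q b)
      calc _ = ∑ p, (∑ l, e l p * ∑ k, e k c * g l k)
            * (∑ r, f p r * ∑ i, e i a * ∑ q, Γ r i q * e q b) := by
            refine Finset.sum_congr rfl fun p _ => ?_
            simp only [frameΓ, frameS]
            rw [mul_comm]
            congr 1
            · simp only [Fin.sum_univ_three]; ring
            · simp only [Fin.sum_univ_three]; ring
        _ = _ := by
            rw [h]
            simp only [Fin.sum_univ_three]; ring
    have gs : ∀ p, frameS e g b p = frameS e g p b := by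
      intro p
      simp only [frameS, Fin.sum_univ_three, H.g_symm 1 0, H.g_symm 2 0, H.g_symm 2 1]; ring
    simp only [gs, h1, frameD_apply]
    simp only [frameS, Fin.sum_univ_three, map_add, Derivation.leibniz, hE.const_e, smul_eq_mul,
      H.compat, H.g_symm 1 0, H.g_symm 2 0, H.g_symm 2 1]
    ring

lemma IsAlgRicciFlow.frame (H : IsAlgRicciFlow D Dt g gi Γ) (hE : IsConstFrame D e f)
    (ht : ∀ a b, Dt (e a b) = 0) :
    IsAlgRicciFlow (frameD e D) Dt (frameS e g) (frameS fᵀ gi) (frameΓ e f Γ) where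
  toIsLeviCivita := H.toIsLeviCivita.frame hE
  comm_t := by
    intro a x
    simp only [frameD_apply, Fin.sum_univ_three, map_add, Derivation.leibniz, ht, smul_eq_mul,
      H.comm_t]
    ring
  flow := by
    intro a b
    rw [frame_algRic hE]
    simp only [frameS, Fin.sum_univ_three, map_add, Derivation.leibniz, ht, smul_eq_mul, H.flow]
    ring

end CurvatureAlgebra

/-! ### Smooth functions on a space-time slab -/

section Slab

/-- The closed space-time slab `ℝ³ × [0, T]`. -/
def slab (T : ℝ) : Set ((Fin 3 → ℝ) × ℝ) := univ ×ˢ Icc 0 T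

lemma mem_slab {T : ℝ} {p : (Fin 3 → ℝ) × ℝ} : p ∈ slab T ↔ p.2 ∈ Icc 0 T := by simp [slab]

lemma uniqueDiffOn_slab {T : ℝ} (hT : 0 < T) : UniqueDiffOn ℝ (slab T) :=
  uniqueDiffOn_univ.prod (uniqueDiffOn_Icc hT)

lemma isClosed_slab (T : ℝ) : IsClosed (slab T) := isClosed_univ.prod isClosed_Icc

lemma closure_interior_slab {T : ℝ} (hT : 0 < T) : closure (interior (slab T)) = slab T := by
  rw [slab, interior_prod_eq, closure_prod_eq, interior_univ, closure_univ, interior_Icc,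
    closure_Ioo hT.ne]

/-- The algebra of functions which are smooth on the slab. -/
def slabAlg (T : ℝ) : Subalgebra ℝ ((Fin 3 → ℝ) × ℝ → ℝ) where
  carrier := {f | ContDiffOn ℝ (⊤ : ℕ∞) f (slab T)}
  mul_mem' ha hb := ContDiffOn.mul ha hb
  add_mem' ha hb := ContDiffOn.add ha hb
  algebraMap_mem' _ := contDiffOn_const

variable {T : ℝ}

lemma slabAlg_contDiffOn (f : slabAlg T) : ContDiffOn ℝ (⊤ : ℕ∞) (f : (Fin 3 → ℝ) × ℝ → ℝ) (slab T) :=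
  f.2

lemma slabAlg_differentiableWithinAt (f : slabAlg T) {p : (Fin 3 → ℝ) × ℝ} (hp : p ∈ slab T) :
    DifferentiableWithinAt ℝ (f : (Fin 3 → ℝ) × ℝ → ℝ) (slab T) p :=
  f.2.differentiableOn (by simp) p hp

/-- The derivation of the slab algebra in the direction `v`. -/
def slabD (hT : 0 < T) (v : (Fin 3 → ℝ) × ℝ) : Derivation ℝ (slabAlg T) (slabAlg T) :=
  Derivation.mk'
    { toFun := fun f => ⟨fun p => fderivWithin ℝ (f : (Fin 3 → ℝ) × ℝ → ℝ) (slab T) p v,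
        show ContDiffOn ℝ (⊤ : ℕ∞) _ (slab T) from
        ((slabAlg_contDiffOn f).fderivWithin (uniqueDiffOn_slab hT) (m := (⊤ : ℕ∞))
          (by simp)).clm_apply contDiffOn_const⟩
      map_add' := by
        intro f g
        ext p
        by_cases hp : p ∈ slab T
        · have := fderivWithin_add (uniqueDiffOn_slab hT p hp) (slabAlg_differentiableWithinAt f hp)
            (slabAlg_differentiableWithinAt g hp)
          simp [this]
        · have : p ∉ closure (slab T) := by rwa [(isClosed_slab T).closure_eq]
          simp [fderivWithin_zero_of_notMem_closure this]
      map_smul' := by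
        intro c f
        ext p
        by_cases hp : p ∈ slab T
        · have := fderivWithin_const_smul (uniqueDiffOn_slab hT p hp)
            (slabAlg_differentiableWithinAt f hp) c
          simp [this]
        · have : p ∉ closure (slab T) := by rwa [(isClosed_slab T).closure_eq]
          simp [fderivWithin_zero_of_notMem_closure this] }
    (by
      intro f g
      ext p
      by_cases hp : p ∈ slab T
      · have := fderivWithin_mul (uniqueDiffOn_slab hT p hp) (slabAlg_differentiableWithinAt f hp)
          (slabAlg_differentiableWithinAt g hp)
        simp [this]
      · have : p ∉ closure (slab T) := by rwa [(isClosed_slab T).closure_eq]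
        simp [fderivWithin_zero_of_notMem_closure this])

lemma slabD_apply (hT : 0 < T) (v : (Fin 3 → ℝ) × ℝ) (f : slabAlg T) (p : (Fin 3 → ℝ) × ℝ) :
    (slabD hT v f : (Fin 3 → ℝ) × ℝ → ℝ) p = fderivWithin ℝ f (slab T) p v := rfl

lemma slabD_comm (hT : 0 < T) (v w : (Fin 3 → ℝ) × ℝ) (f : slabAlg T) :
    slabD hT v (slabD hT w f) = slabD hT w (slabD hT v f) := by
  ext p
  by_cases hp : p ∈ slab T
  · have hd : DifferentiableWithinAt ℝ (fderivWithin ℝ (f : (Fin 3 → ℝ) × ℝ → ℝ) (slab T))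
        (slab T) p :=
      (f.2.fderivWithin (uniqueDiffOn_slab hT) (m := (⊤ : ℕ∞)) (by simp)).differentiableOn
        (by simp) p hp
    have key : ∀ v w : (Fin 3 → ℝ) × ℝ, (slabD hT v (slabD hT w f) : (Fin 3 → ℝ) × ℝ → ℝ) p
        = fderivWithin ℝ (fderivWithin ℝ f (slab T)) (slab T) p v w := by
      intro v w
      have h := fderivWithin_clm_apply (uniqueDiffOn_slab hT p hp) hd
        (differentiableWithinAt_const w)
      have h2 := congrArg (fun L => L v) h
      simp only [add_apply, ContinuousLinearMap.comp_apply,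
        ContinuousLinearMap.flip_apply, fderivWithin_const_apply,
        zero_apply, map_zero, zero_add] at h2
      exact h2
    rw [key, key]
    refine (f.2 p hp).isSymmSndFDerivWithinAt ?_ (uniqueDiffOn_slab hT) ?_ hp v w
    · rw [minSmoothness_of_isRCLikeNormedField]; exact WithTop.coe_le_coe.2 le_top
    · rwa [closure_interior_slab hT]
  · have : p ∉ closure (slab T) := by rwa [(isClosed_slab T).closure_eq]
    simp [slabD_apply, fderivWithin_zero_of_notMem_closure this]

/-- The `i`-th coordinate derivation. -/
def slabDx (hT : 0 < T) (i : Fin 3) : Derivation ℝ (slabAlg T) (slabAlg T) :=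
  slabD hT (Pi.single i 1, 0)

/-- The time derivation. -/
def slabDt (hT : 0 < T) : Derivation ℝ (slabAlg T) (slabAlg T) := slabD hT (0, 1)

lemma hasFDerivAt_slab (f : slabAlg T) {x : Fin 3 → ℝ} {t : ℝ} (ht : t ∈ Icc 0 T) :
    HasFDerivAt (fun y => (f : (Fin 3 → ℝ) × ℝ → ℝ) (y, t))
      ((fderivWithin ℝ f (slab T) (x, t)).comp (ContinuousLinearMap.inl ℝ (Fin 3 → ℝ) ℝ)) x := by
  have h := (slabAlg_differentiableWithinAt f ((mem_slab (p := (x, t))).2 ht)).hasFDerivWithinAt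
  have hl : HasFDerivWithinAt (fun y : Fin 3 → ℝ => (y, t))
      (ContinuousLinearMap.inl ℝ (Fin 3 → ℝ) ℝ) univ x :=
    ((hasFDerivAt_id x).prodMk (hasFDerivAt_const t x)).hasFDerivWithinAt
  exact (h.comp x hl (fun y _ => mem_slab.2 ht)).hasFDerivAt_of_univ

lemma pd_slab (hT : 0 < T) (f : slabAlg T) {t : ℝ} (ht : t ∈ Icc 0 T) (i : Fin 3) (x : Fin 3 → ℝ) :
    pd (fun y => (f : (Fin 3 → ℝ) × ℝ → ℝ) (y, t)) i x
      = (slabDx hT i f : (Fin 3 → ℝ) × ℝ → ℝ) (x, t) := by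
  rw [pd, (hasFDerivAt_slab f ht).fderiv]
  simp [slabDx, slabD_apply]

lemma hasDerivWithinAt_slab (hT : 0 < T) (f : slabAlg T) {x : Fin 3 → ℝ} {t : ℝ} (ht : t ∈ Icc 0 T) :
    HasDerivWithinAt (fun s => (f : (Fin 3 → ℝ) × ℝ → ℝ) (x, s))
      ((slabDt hT f : (Fin 3 → ℝ) × ℝ → ℝ) (x, t)) (Icc 0 T) t := by
  have h := (slabAlg_differentiableWithinAt f ((mem_slab (p := (x, t))).2 ht)).hasFDerivWithinAt
  have hl : HasDerivWithinAt (fun s : ℝ => (x, s)) ((0, 1) : (Fin 3 → ℝ) × ℝ) (Icc 0 T) t :=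
    ((hasDerivAt_const t x).prodMk (hasDerivAt_id t)).hasDerivWithinAt
  exact h.comp_hasDerivWithinAt t hl (fun s hs => mem_slab.2 hs)

/-- Chain rule along a curve in a time slice. -/
lemma hasDerivAt_slab_comp (hT : 0 < T) (f : slabAlg T) {t : ℝ} (ht : t ∈ Icc 0 T)
    {c : ℝ → Fin 3 → ℝ} {c' : Fin 3 → ℝ} {s : ℝ} (hc : HasDerivAt c c' s) :
    HasDerivAt (fun s => (f : (Fin 3 → ℝ) × ℝ → ℝ) (c s, t))
      (∑ i, c' i * (slabDx hT i f : (Fin 3 → ℝ) × ℝ → ℝ) (c s, t)) s := by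
  have h := (hasFDerivAt_slab f (x := c s) ht).comp_hasDerivAt s hc
  have e : ∑ i, c' i * (slabDx hT i f : (Fin 3 → ℝ) × ℝ → ℝ) (c s, t)
      = ((fderivWithin ℝ f (slab T) (c s, t)).comp
        (ContinuousLinearMap.inl ℝ (Fin 3 → ℝ) ℝ)) c' := by
    have : c' = ∑ i, c' i • (Pi.single i 1 : Fin 3 → ℝ) := by
      ext j; simp [Finset.sum_apply, Pi.single_apply]
    conv_rhs => rw [this, map_sum]
    simp [slabDx, slabD_apply]
  rw [e]
  exact h

end Slab

section Flow

variable {T : ℝ} {g : (Fin 3 → ℝ) → ℝ → Matrix (Fin 3) (Fin 3) ℝ}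

open Classical in
/-- The metric on the slab, extended by the identity matrix. -/
def slabMetric (T : ℝ) (g : (Fin 3 → ℝ) → ℝ → Matrix (Fin 3) (Fin 3) ℝ) (p : (Fin 3 → ℝ) × ℝ) :
    Matrix (Fin 3) (Fin 3) ℝ := if p.2 ∈ Icc 0 T then g p.1 p.2 else 1

lemma slabMetric_of_mem {x : Fin 3 → ℝ} {t : ℝ} (ht : t ∈ Icc 0 T) : slabMetric T g (x, t) = g x t :=
  if_pos ht

lemma slabMetric_posDef (hg : SmoothMetricFamily g (Icc 0 T)) (p : (Fin 3 → ℝ) × ℝ) :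
    (slabMetric T g p).PosDef := by
  unfold slabMetric
  split_ifs with h
  · exact (hg.2 p.1 p.2 h).2
  · exact Matrix.PosDef.one

lemma slabMetric_symm (hg : SmoothMetricFamily g (Icc 0 T)) (p : (Fin 3 → ℝ) × ℝ) :
    (slabMetric T g p).IsSymm := by
  unfold slabMetric
  split_ifs with h
  · exact (hg.2 p.1 p.2 h).1
  · exact Matrix.isSymm_one

lemma slabMetric_contDiffOn (hg : SmoothMetricFamily g (Icc 0 T)) (i j : Fin 3) :
    ContDiffOn ℝ (⊤ : ℕ∞) (fun p => slabMetric T g p i j) (slab T) :=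
  (hg.1 i j).congr fun p hp => by
    rw [show slabMetric T g p = g p.1 p.2 from if_pos (mem_slab.1 hp)]

lemma slabMetric_inv_contDiffOn (hg : SmoothMetricFamily g (Icc 0 T)) (i j : Fin 3) :
    ContDiffOn ℝ (⊤ : ℕ∞) (fun p => (slabMetric T g p)⁻¹ i j) (slab T) := by
  have h := slabMetric_contDiffOn hg
  have hdet : ContDiffOn ℝ (⊤ : ℕ∞) (fun p => (slabMetric T g p).det) (slab T) := by
    simp only [Matrix.det_fin_three]
    fun_prop (disch := assumption)
  have hadj : ContDiffOn ℝ (⊤ : ℕ∞) (fun p => (slabMetric T g p).adjugate i j) (slab T) := by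
    simp only [Matrix.adjugate_fin_three]
    fin_cases i <;> fin_cases j <;> simp <;> fun_prop
  have e : (fun p => (slabMetric T g p)⁻¹ i j)
      = fun p => ((slabMetric T g p).det)⁻¹ * (slabMetric T g p).adjugate i j := by
    funext p
    simp [Matrix.inv_def]
  rw [e]
  exact (hdet.inv fun p _ => (slabMetric_posDef hg p).det_pos.ne').mul hadj

/-- Metric coefficients as elements of the slab algebra. -/
def slabG (hg : SmoothMetricFamily g (Icc 0 T)) (i j : Fin 3) : slabAlg T :=
  ⟨fun p => slabMetric T g p i j, slabMetric_contDiffOn hg i j⟩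

/-- Inverse metric coefficients as elements of the slab algebra. -/
def slabGi (hg : SmoothMetricFamily g (Icc 0 T)) (i j : Fin 3) : slabAlg T :=
  ⟨fun p => (slabMetric T g p)⁻¹ i j, slabMetric_inv_contDiffOn hg i j⟩

/-- Christoffel symbols as elements of the slab algebra. -/
def slabΓ (hT : 0 < T) (hg : SmoothMetricFamily g (Icc 0 T)) (k i j : Fin 3) : slabAlg T :=
  (1/2 : ℝ) • ∑ l, slabGi hg k l *
    (slabDx hT i (slabG hg j l) + slabDx hT j (slabG hg i l) - slabDx hT l (slabG hg i j))

/-- The Ricci tensor as an element of the slab algebra. -/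
def slabRic (hT : 0 < T) (hg : SmoothMetricFamily g (Icc 0 T)) (j k : Fin 3) : slabAlg T :=
  algRic (slabDx hT) (slabΓ hT hg) j k

/-- The scalar curvature as an element of the slab algebra. -/
def slabScal (hT : 0 < T) (hg : SmoothMetricFamily g (Icc 0 T)) : slabAlg T :=
  ∑ j, ∑ k, slabGi hg j k * slabRic hT hg j k

lemma slabG_apply (hg : SmoothMetricFamily g (Icc 0 T)) (i j : Fin 3) {x : Fin 3 → ℝ} {t : ℝ}
    (ht : t ∈ Icc 0 T) : (slabG hg i j : (Fin 3 → ℝ) × ℝ → ℝ) (x, t) = g x t i j :=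
  congrFun (congrFun (slabMetric_of_mem ht) i) j

lemma slabGi_apply (hg : SmoothMetricFamily g (Icc 0 T)) (i j : Fin 3) {x : Fin 3 → ℝ} {t : ℝ}
    (ht : t ∈ Icc 0 T) : (slabGi hg i j : (Fin 3 → ℝ) × ℝ → ℝ) (x, t) = (g x t)⁻¹ i j := by
  rw [← slabMetric_of_mem (g := g) ht]; rfl

lemma slabΓ_apply (hT : 0 < T) (hg : SmoothMetricFamily g (Icc 0 T)) (k i j : Fin 3)
    {x : Fin 3 → ℝ} {t : ℝ} (ht : t ∈ Icc 0 T) :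
    (slabΓ hT hg k i j : (Fin 3 → ℝ) × ℝ → ℝ) (x, t) = christoffel (fun y => g y t) x k i j := by
  simp only [christoffel, slabΓ, ← slabG_apply hg _ _ ht, pd_slab hT _ ht, ← slabGi_apply hg _ _ ht]
  simp

lemma slabRic_apply (hT : 0 < T) (hg : SmoothMetricFamily g (Icc 0 T)) (j k : Fin 3)
    {x : Fin 3 → ℝ} {t : ℝ} (ht : t ∈ Icc 0 T) :
    (slabRic hT hg j k : (Fin 3 → ℝ) × ℝ → ℝ) (x, t) = ricci (fun y => g y t) x j k := by
  simp only [ricci, slabRic, algRic, algRm, ← slabΓ_apply hT hg _ _ _ ht, pd_slab hT _ ht]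
  simp

lemma slabScal_apply (hT : 0 < T) (hg : SmoothMetricFamily g (Icc 0 T))
    {x : Fin 3 → ℝ} {t : ℝ} (ht : t ∈ Icc 0 T) :
    (slabScal hT hg : (Fin 3 → ℝ) × ℝ → ℝ) (x, t) = scalarCurv (fun y => g y t) x := by
  simp only [scalarCurv, slabScal, ← slabRic_apply hT hg _ _ ht, ← slabGi_apply hg _ _ ht]
  simp

lemma slab_isLeviCivita (hT : 0 < T) (hg : SmoothMetricFamily g (Icc 0 T)) :
    IsLeviCivita (slabDx hT) (slabG hg) (slabGi hg) (slabΓ hT hg) := by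
  have hs : ∀ i j, slabG hg i j = slabG hg j i := fun i j => by
    ext p; exact (slabMetric_symm hg p).apply j i
  have hi : ∀ i j, ∑ l, slabGi hg i l * slabG hg l j = if i = j then 1 else 0 := fun i j => by
    ext p
    have h := congrFun (congrFun (Matrix.nonsing_inv_mul (slabMetric T g p)
      (slabMetric_posDef hg p).det_pos.ne'.isUnit) i) j
    rw [Matrix.mul_apply, Matrix.one_apply] at h
    have e : ((∑ l, slabGi hg i l * slabG hg l j : slabAlg T) : (Fin 3 → ℝ) × ℝ → ℝ) p
      = ∑ l, (slabMetric T g p)⁻¹ i l * slabMetric T g p l j := by simp [slabGi, slabG]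
    rw [e, h]
    split_ifs <;> rfl
  have hsi : ∀ i j, slabGi hg i j = slabGi hg j i := fun i j => by
    ext p
    have := (slabMetric_symm hg p).inv
    exact this.apply j i
  have low : ∀ i j k, ∑ p, slabΓ hT hg p i j * slabG hg p k = (1/2 : ℝ) •
      (slabDx hT i (slabG hg j k) + slabDx hT j (slabG hg i k) - slabDx hT k (slabG hg i j)) := by
    intro i j k
    have := fun l => hi l k
    calc _ = (1/2 : ℝ) • ∑ l, (∑ p, slabGi hg l p * slabG hg p k) *
          (slabDx hT i (slabG hg j l) + slabDx hT j (slabG hg i l) - slabDx hT l (slabG hg i j)) := by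
          simp only [slabΓ, Finset.sum_mul, smul_mul_assoc, Finset.smul_sum]
          rw [Finset.sum_comm]
          refine Finset.sum_congr rfl fun l _ => Finset.sum_congr rfl fun p _ => ?_
          rw [hsi p l]; congr 1; ring
      _ = _ := by simp [hi]
  refine ⟨fun i j f => slabD_comm hT _ _ f, hs, hsi, hi, fun k i j => ?_, fun a j k => ?_⟩
  · simp only [slabΓ, hs i j]
    congr 1
    refine Finset.sum_congr rfl fun l _ => ?_
    ring
  · simp only [hs j _, low]
    rw [← smul_add]
    have : (slabDx hT a (slabG hg k j) + slabDx hT j (slabG hg a k) - slabDx hT k (slabG hg a j)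
      + (slabDx hT a (slabG hg k j) + slabDx hT k (slabG hg a j) - slabDx hT j (slabG hg a k)))
      = (2 : ℝ) • slabDx hT a (slabG hg k j) := by rw [two_smul]; ring
    rw [this, smul_smul]
    norm_num

lemma slab_isAlgRicciFlow (hT : 0 < T) (hg : SmoothMetricFamily g (Icc 0 T))
    (hf : IsRicciFlow g (Icc 0 T)) :
    IsAlgRicciFlow (slabDx hT) (slabDt hT) (slabG hg) (slabGi hg) (slabΓ hT hg) where
  toIsLeviCivita := slab_isLeviCivita hT hg
  comm_t i f := slabD_comm hT _ _ f
  flow := by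
    intro j k
    ext ⟨x, t⟩
    by_cases ht : t ∈ Icc 0 T
    · have h1 := (hasDerivWithinAt_slab hT (slabG hg j k) (x := x) ht).derivWithin
        (uniqueDiffOn_Icc hT t ht)
      have h2 := hf x t ht j k
      rw [← slabRic_apply hT hg j k ht] at h2
      have e : EqOn (fun s => (slabG hg j k : (Fin 3 → ℝ) × ℝ → ℝ) (x, s)) (fun s => g x s j k)
        (Icc 0 T) := fun s hs => slabG_apply hg j k hs
      rw [derivWithin_congr e (e ht), h2] at h1
      rw [← h1]
      simp [slabRic]
      exact Or.inl rfl
    · have hp : (x, t) ∉ closure (slab T) := by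
        rw [(isClosed_slab T).closure_eq, mem_slab]; exact ht
      have z : ∀ v f, (slabD hT v f : (Fin 3 → ℝ) × ℝ → ℝ) (x, t) = 0 := fun v f => by
        rw [slabD_apply, fderivWithin_zero_of_notMem_closure hp]; rfl
      have zΓ : ∀ k i j, (slabΓ hT hg k i j : (Fin 3 → ℝ) × ℝ → ℝ) (x, t) = 0 := fun k i j => by
        simp [slabΓ, slabDx, z]
      simp [algRic, algRm, slabDt, slabDx, z, zΓ]

end Flow

section CurvatureAlgebra

variable {A : Type*} [CommRing A] [Algebra ℝ A]
variable {D : Fin 3 → Derivation ℝ A A} {g gi : Fin 3 → Fin 3 → A} {Γ : Fin 3 → Fin 3 → Fin 3 → A}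
  {Dt : Derivation ℝ A A}

/-- At the evaluation `φ`, the metric is the identity and the Ricci tensor is diagonal. -/
structure IsAdapted (φ : A →+* ℝ) (D : Fin 3 → Derivation ℝ A A) (g : Fin 3 → Fin 3 → A)
    (Γ : Fin 3 → Fin 3 → Fin 3 → A) (ρ : Fin 3 → ℝ) : Prop where
  metric : ∀ j k, φ (g j k) = if j = k then 1 else 0
  ric : ∀ j k, φ (algRic D Γ j k) = if j = k then ρ j else 0

variable {φ : A →+* ℝ} {ρ : Fin 3 → ℝ}

lemma IsAdapted.inv_metric (h : IsAdapted φ D g Γ ρ) (H : IsLeviCivita D g gi Γ) (j k : Fin 3) :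
    φ (gi j k) = if j = k then 1 else 0 := by
  have e := congrArg φ (H.inv j k)
  simp only [map_sum, map_mul, h.metric] at e
  simpa [apply_ite φ] using e

lemma IsAdapted.swap (h : IsAdapted φ D g Γ ρ) (H : IsLeviCivita D g gi Γ) (a b j k : Fin 3) :
    φ (algRm D Γ k a b j) = - φ (algRm D Γ j a b k) := by
  have e := congrArg φ (riem_lower_swap H a b j k)
  simp only [map_sum, map_mul, h.metric, map_neg] at e
  simpa using e

lemma IsAdapted.swap' (i j k l : Fin 3) :
    φ (algRm D Γ l i j k) = - φ (algRm D Γ l j i k) := by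
  rw [algRm_swap, map_neg]

lemma IsAdapted.dt_ric (h : IsAdapted φ D g Γ ρ) (H : IsAlgRicciFlow D Dt g gi Γ) (j : Fin 3) :
    φ (Dt (algRic D Γ j j)) = ∑ i, φ (cov3 D Γ (cov D Γ (algRic D Γ)) i i j j)
      + 2 * ∑ i, φ (algRm D Γ i i j j) * ρ i - 2 * ρ j ^ 2 := by
  have e := congrArg φ (H.dt_ric j j)
  simp only [map_add, map_sum, map_mul, h.inv_metric H.toIsLeviCivita, h.ric] at e
  have e2 : ∑ i, φ (algRm D Γ j i j i) = - ρ j := by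
    have h1 : φ (algRic D Γ j j) = ρ j := by simp [h.ric]
    rw [← h1, algRic, map_sum, ← Finset.sum_neg_distrib]
    exact Finset.sum_congr rfl fun i _ => h.swap H.toIsLeviCivita _ _ _ _
  rw [e]
  simp only [ite_mul, mul_ite, one_mul, zero_mul, mul_zero, Finset.sum_ite_eq,
    Finset.mem_univ, if_true, Finset.sum_add_distrib, Finset.sum_ite_eq']
  rw [← Finset.sum_mul, e2]
  simp only [Fin.sum_univ_three]; ring

lemma IsAdapted.sectional (h : IsAdapted φ D g Γ ρ) (H : IsLeviCivita D g gi Γ) :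
    φ (algRm D Γ 0 0 0 0) = 0 ∧ φ (algRm D Γ 1 1 1 1) = 0 ∧ φ (algRm D Γ 2 2 2 2) = 0 ∧
    φ (algRm D Γ 1 1 0 0) = (ρ 0 + ρ 1 - ρ 2) / 2 ∧ φ (algRm D Γ 0 0 1 1) = (ρ 0 + ρ 1 - ρ 2) / 2 ∧
    φ (algRm D Γ 2 2 0 0) = (ρ 0 + ρ 2 - ρ 1) / 2 ∧ φ (algRm D Γ 0 0 2 2) = (ρ 0 + ρ 2 - ρ 1) / 2 ∧
    φ (algRm D Γ 2 2 1 1) = (ρ 1 + ρ 2 - ρ 0) / 2 ∧ φ (algRm D Γ 1 1 2 2) = (ρ 1 + ρ 2 - ρ 0) / 2 := by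
  have d : ∀ a, φ (algRm D Γ a a a a) = 0 := fun a => by
    have := IsAdapted.swap' (φ := φ) (D := D) (Γ := Γ) a a a a
    linarith
  have s : ∀ a b, φ (algRm D Γ a a b b) = φ (algRm D Γ b b a a) := fun a b => by
    rw [IsAdapted.swap' (φ := φ) a b b a, h.swap H b a b a, neg_neg]
  have t : ∀ a, φ (algRm D Γ 0 0 a a) + φ (algRm D Γ 1 1 a a) + φ (algRm D Γ 2 2 a a) = ρ a := by
    intro a
    have h1 : φ (algRic D Γ a a) = ρ a := by simp [h.ric]
    rw [← h1, algRic, map_sum, Fin.sum_univ_three]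
  have t0 := t 0
  have t1 := t 1
  have t2 := t 2
  have s01 := s 0 1
  have s02 := s 0 2
  have s12 := s 1 2
  rw [d] at t0 t1 t2
  refine ⟨d _, d _, d _, ?_, ?_, ?_, ?_, ?_, ?_⟩ <;> linarith

lemma IsAdapted.dt_gi (h : IsAdapted φ D g Γ ρ) (H : IsAlgRicciFlow D Dt g gi Γ) (j k : Fin 3) :
    φ (Dt (gi j k)) = if j = k then 2 * ρ j else 0 := by
  have e := congrArg (fun x => φ (Dt x)) (H.inv j k)
  have e2 : φ (Dt (if j = k then (1 : A) else 0)) = 0 := by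
    split_ifs
    · rw [Derivation.map_one_eq_zero, map_zero]
    · simp
  simp only [e2, map_sum, Derivation.leibniz, map_add, smul_eq_mul, map_mul, h.metric,
    h.inv_metric H.toIsLeviCivita, H.flow, h.ric, map_neg, map_ofNat] at e
  simp only [ite_mul, mul_ite, one_mul, zero_mul, mul_zero, Finset.mem_univ,
    if_true, Finset.sum_add_distrib, Finset.sum_ite_eq'] at e
  split_ifs at e ⊢ with hjk
  · subst hjk; linarith
  · linarith

/-- Evolution of the scalar curvature at an adapted point. -/
lemma IsAdapted.dt_scal (h : IsAdapted φ D g Γ ρ) (H : IsAlgRicciFlow D Dt g gi Γ) :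
    φ (Dt (∑ j, ∑ k, gi j k * algRic D Γ j k))
      = ∑ i, φ (D i (D i (∑ j, ∑ k, gi j k * algRic D Γ j k))
          - ∑ p, Γ p i i * D p (∑ j, ∑ k, gi j k * algRic D Γ j k))
        + 2 * ∑ a, ρ a ^ 2 := by
  have lap : ∀ i, φ (D i (D i (∑ j, ∑ k, gi j k * algRic D Γ j k))
          - ∑ p, Γ p i i * D p (∑ j, ∑ k, gi j k * algRic D Γ j k))
      = ∑ j, φ (cov3 D Γ (cov D Γ (algRic D Γ)) i i j j) := by
    intro i
    have e := cov_contract' H.toIsLeviCivita (cov D Γ (algRic D Γ)) i i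
    simp only [← deriv_contract H.toIsLeviCivita] at e
    rw [e]
    simp only [map_sum, map_mul, h.inv_metric H.toIsLeviCivita]
    simp
  have lhs : φ (Dt (∑ j, ∑ k, gi j k * algRic D Γ j k))
      = ∑ j, φ (Dt (algRic D Γ j j)) + ∑ j, 2 * ρ j ^ 2 := by
    simp only [map_sum, Derivation.leibniz, map_add, smul_eq_mul, map_mul,
      h.inv_metric H.toIsLeviCivita, h.ric, h.dt_gi H]
    simp only [ite_mul, mul_ite, one_mul, zero_mul, mul_zero, Finset.sum_ite_eq,
      Finset.mem_univ, if_true, Finset.sum_add_distrib]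
    congr 1
    exact Finset.sum_congr rfl fun j _ => by ring
  rw [lhs]
  simp only [lap, h.dt_ric H, Finset.sum_sub_distrib, Finset.sum_add_distrib]
  rw [Finset.sum_comm]
  obtain ⟨k0, k1, k2, k10, k01, k20, k02, k21, k12⟩ := h.sectional H.toIsLeviCivita
  simp only [Fin.sum_univ_three, k0, k1, k2, k10, k01, k20, k02, k21, k12]
  ring

/-- Evolution of the normalised Ricci curvature in the first frame direction. -/
lemma IsAdapted.dt_ric_zero (h : IsAdapted φ D g Γ ρ) (H : IsAlgRicciFlow D Dt g gi Γ) :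
    φ (Dt (algRic D Γ 0 0)) - φ (algRic D Γ 0 0) * φ (Dt (g 0 0))
      = ∑ i, φ (cov3 D Γ (cov D Γ (algRic D Γ)) i i 0 0)
        + ((ρ 0 + ρ 1 - ρ 2) * ρ 1 + (ρ 0 + ρ 2 - ρ 1) * ρ 2) := by
  rw [h.dt_ric H, H.flow]
  obtain ⟨k0, k1, k2, k10, k01, k20, k02, k21, k12⟩ := h.sectional H.toIsLeviCivita
  simp only [Fin.sum_univ_three, k0, k10, k20, map_mul, map_neg, map_ofNat, h.ric, if_true]
  ring

/-- The second-order coefficient of a parallel field along a geodesic. -/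
def jetField (D : Fin 3 → Derivation ℝ A A) (Γ : Fin 3 → Fin 3 → Fin 3 → A) (i j q : Fin 3) : A :=
  - D i (Γ q i j) + ∑ p, Γ p i i * Γ q p j + ∑ p, Γ p i j * Γ q i p

lemma cov3_cov_diag {S : Fin 3 → Fin 3 → A} (hs : ∀ j k, S j k = S k j) (i : Fin 3) :
    cov3 D Γ (cov D Γ S) i i 0 0
      = D i (D i (S 0 0)) - ∑ c, Γ c i i * D c (S 0 0) - 4 * ∑ a, Γ a i 0 * D i (S a 0)
        + 2 * ∑ a, jetField D Γ i 0 a * S a 0 + 2 * ∑ a, ∑ b, Γ a i 0 * Γ b i 0 * S a b := by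
  simp only [cov3, cov, jetField, Fin.sum_univ_three, map_sub, map_add, Derivation.leibniz, smul_eq_mul]
  simp only [hs 0 1, hs 0 2, hs 1 2]
  ring

end CurvatureAlgebra

/-! ### Second-order jets of functions of one variable -/

section Jet

open Filter Topology

/-- `f` is twice differentiable at `0`, with value `a` and derivatives `b`, `c`. -/
def HasJet (f : ℝ → ℝ) (a b c : ℝ) : Prop :=
  ∃ f' : ℝ → ℝ, (∀ᶠ h in 𝓝 0, HasDerivAt f (f' h) h) ∧ f 0 = a ∧ f' 0 = b ∧ HasDerivAt f' c 0

variable {f f₁ f₂ : ℝ → ℝ} {a b c a₁ b₁ c₁ a₂ b₂ c₂ : ℝ}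

lemma HasJet.congr (h : HasJet f a b c) {a' b' c' : ℝ} (ha : a = a') (hb : b = b') (hc : c = c') :
    HasJet f a' b' c' := by subst ha hb hc; exact h

lemma hasJet_const (a : ℝ) : HasJet (fun _ => a) a 0 0 :=
  ⟨fun _ => 0, .of_forall fun _ => hasDerivAt_const _ _, rfl, rfl, hasDerivAt_const _ _⟩

lemma hasJet_poly (a b c : ℝ) : HasJet (fun h => a + h * b + h ^ 2 / 2 * c) a b c := by
  refine ⟨fun h => b + h * c, .of_forall fun h => ?_, by simp, by simp, ?_⟩
  · have := (((hasDerivAt_id h).mul_const b).const_add a).add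
      ((((hasDerivAt_id h).pow 2).div_const 2).mul_const c)
    refine this.congr_deriv ?_
    simp only [id, Nat.cast_ofNat]; ring
  · simpa using ((hasDerivAt_id (0 : ℝ)).mul_const c).const_add b

lemma HasJet.add (h₁ : HasJet f₁ a₁ b₁ c₁) (h₂ : HasJet f₂ a₂ b₂ c₂) :
    HasJet (fun h => f₁ h + f₂ h) (a₁ + a₂) (b₁ + b₂) (c₁ + c₂) := by
  obtain ⟨f₁', d₁, rfl, rfl, e₁⟩ := h₁
  obtain ⟨f₂', d₂, rfl, rfl, e₂⟩ := h₂
  exact ⟨fun h => f₁' h + f₂' h, by filter_upwards [d₁, d₂] with h x y using x.add y, rfl, rfl,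
    e₁.add e₂⟩

lemma HasJet.mul (h₁ : HasJet f₁ a₁ b₁ c₁) (h₂ : HasJet f₂ a₂ b₂ c₂) :
    HasJet (fun h => f₁ h * f₂ h) (a₁ * a₂) (b₁ * a₂ + a₁ * b₂) (c₁ * a₂ + 2 * b₁ * b₂ + a₁ * c₂) := by
  obtain ⟨f₁', d₁, rfl, rfl, e₁⟩ := h₁
  obtain ⟨f₂', d₂, rfl, rfl, e₂⟩ := h₂
  refine ⟨fun h => f₁' h * f₂ h + f₁ h * f₂' h,
    by filter_upwards [d₁, d₂] with h x y using x.mul y, rfl, rfl, ?_⟩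
  have := (e₁.mul d₂.self_of_nhds).add (d₁.self_of_nhds.mul e₂)
  exact this.congr_deriv (by ring)

lemma HasJet.const_mul (h₁ : HasJet f a b c) (r : ℝ) :
    HasJet (fun h => r * f h) (r * a) (r * b) (r * c) :=
  ((hasJet_const r).mul h₁).congr rfl (by ring) (by ring)

lemma HasJet.sum {f : Fin 3 → ℝ → ℝ} {a b c : Fin 3 → ℝ} (h : ∀ i, HasJet (f i) (a i) (b i) (c i)) :
    HasJet (fun h => ∑ i, f i h) (∑ i, a i) (∑ i, b i) (∑ i, c i) := by
  simp only [Fin.sum_univ_three]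
  exact ((h 0).add (h 1)).add (h 2)

lemma HasJet.comp {φ φ' : ℝ → ℝ} {φ'' : ℝ} (h : HasJet f a b c)
    (hφ : ∀ᶠ u in 𝓝 a, HasDerivAt φ (φ' u) u) (hφ' : HasDerivAt φ' φ'' a) :
    HasJet (fun h => φ (f h)) (φ a) (φ' a * b) (φ'' * b ^ 2 + φ' a * c) := by
  obtain ⟨f', d, rfl, rfl, e⟩ := h
  have hc : Tendsto f (𝓝 0) (𝓝 (f 0)) := d.self_of_nhds.continuousAt
  refine ⟨fun h => φ' (f h) * f' h, ?_, rfl, rfl, ?_⟩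
  · filter_upwards [d, hc.eventually hφ] with h x y using y.comp h x
  · have := (hφ'.comp 0 d.self_of_nhds).mul e
    exact this.congr_deriv (by simp only [Function.comp]; ring)

lemma HasJet.inv_one (h : HasJet f 1 0 0) : HasJet (fun h => (f h)⁻¹) 1 0 0 := by
  have e : HasDerivAt (fun u : ℝ => -(u ^ 2)⁻¹) 2 1 := by
    have := ((hasDerivAt_id (1 : ℝ)).pow 2).inv (by simp)
    exact this.neg.congr_deriv (by norm_num)
  refine (h.comp (φ := fun u => u⁻¹) (φ' := fun u => -(u ^ 2)⁻¹) ?_ e).congr (by simp) (by simp)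
    (by simp)
  filter_upwards [eventually_ne_nhds (one_ne_zero : (1 : ℝ) ≠ 0)] with u hu using hasDerivAt_inv hu

lemma HasJet.first (h : HasJet f a b c) {ε : ℝ} (hε : 0 < ε) :
    ∀ᶠ s in 𝓝 0, |f s - a - s * b| ≤ ε * |s| := by
  obtain ⟨f', d, rfl, rfl, -⟩ := h
  have := d.self_of_nhds.isLittleO.def hε
  simpa [mul_comm] using this

lemma HasJet.second (h : HasJet f a b c) {ε : ℝ} (hε : 0 < ε) :
    ∀ᶠ s in 𝓝 0, |f s + f (-s) - 2 * a - s ^ 2 * c| ≤ ε * s ^ 2 := by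
  obtain ⟨f', d, rfl, rfl, e⟩ := h
  have e1 := e.isLittleO.def (half_pos hε)
  obtain ⟨r, hr, hr'⟩ := Metric.eventually_nhds_iff_ball.1 (d.and e1)
  filter_upwards [Metric.ball_mem_nhds 0 hr] with s hs
  have hball : ∀ u ∈ uIcc 0 s, u ∈ Metric.ball (0 : ℝ) r ∧ -u ∈ Metric.ball (0 : ℝ) r ∧ |u| ≤ |s| := by
    intro u hu
    have : |u| ≤ |s| := by simpa using abs_sub_left_of_mem_uIcc hu
    have hs' : |s| < r := by simpa using hs
    simp only [Metric.mem_ball, dist_zero_right, Real.norm_eq_abs, abs_neg]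
    exact ⟨this.trans_lt hs', this.trans_lt hs', this⟩
  have hd : ∀ u ∈ uIcc 0 s, HasDerivWithinAt (fun u => f u + f (-u) - u ^ 2 * c)
      (f' u - f' (-u) - 2 * u * c) (uIcc 0 s) u := by
    intro u hu
    obtain ⟨h1, h2, -⟩ := hball u hu
    have := (((hr' u h1).1.add ((hr' (-u) h2).1.comp u (hasDerivAt_neg u))).sub
      (((hasDerivAt_id u).pow 2).mul_const c))
    refine (this.congr_deriv ?_).hasDerivWithinAt
    simp [sub_eq_add_neg]
  have hb : ∀ u ∈ uIcc 0 s, ‖f' u - f' (-u) - 2 * u * c‖ ≤ ε * |s| := by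
    intro u hu
    obtain ⟨h1, h2, h3⟩ := hball u hu
    have A := (hr' u h1).2
    have B := (hr' (-u) h2).2
    simp only [sub_zero, smul_eq_mul, Real.norm_eq_abs, abs_neg] at A B
    rw [Real.norm_eq_abs]
    have : f' u - f' (-u) - 2 * u * c = (f' u - f' 0 - u * c) - (f' (-u) - f' 0 - -u * c) := by ring
    rw [this]
    calc _ ≤ ε / 2 * |u| + ε / 2 * |u| := (abs_sub _ _).trans (add_le_add A B)
      _ = ε * |u| := by ring
      _ ≤ _ := by gcongr
  have := (convex_uIcc 0 s).norm_image_sub_le_of_norm_hasDerivWithin_le hd hb left_mem_uIcc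
    right_mem_uIcc
  simp only [Real.norm_eq_abs, sub_zero, neg_zero] at this
  calc _ = |f s + f (-s) - s ^ 2 * c - (f 0 + f 0 - 0 ^ 2 * c)| := by ring_nf
    _ ≤ ε * |s| * |s| := this
    _ = ε * s ^ 2 := by rw [mul_assoc, ← abs_mul, ← sq, abs_of_nonneg (sq_nonneg s)]

end Jet

/-! ### The heat inequality for the pinching function -/

section Heat

variable {T : ℝ} {g : (Fin 3 → ℝ) → ℝ → Matrix (Fin 3) (Fin 3) ℝ}

lemma frame_trace {A : Type*} [CommRing A] [Algebra ℝ A] {D : Fin 3 → Derivation ℝ A A}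
    {e f : Matrix (Fin 3) (Fin 3) A} (hE : IsConstFrame D e f) (S Q : Fin 3 → Fin 3 → A) :
    ∑ a, ∑ b, frameS fᵀ Q a b * frameS e S a b = ∑ j, ∑ k, Q j k * S j k := by
  have h1 := fun a => frame_contract hE (fun l => ∑ k, e k a * S k l) (fun j => ∑ i, f a i * Q i j)
  have h2 := fun l => frame_contract hE (fun k => S k l) (fun i => Q i l)
  calc _ = ∑ a, ∑ b, (∑ l, e l b * ∑ k, e k a * S k l) * (∑ j, f b j * ∑ i, f a i * Q i j) := by
        refine Finset.sum_congr rfl fun a _ => Finset.sum_congr rfl fun b _ => ?_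
        rw [mul_comm]
        congr 1
        · simp only [frameS, Fin.sum_univ_three]; ring
        · simp only [frameS, Matrix.transpose_apply, Fin.sum_univ_three]; ring
    _ = ∑ l, ∑ a, (∑ k, e k a * S k l) * (∑ i, f a i * Q i l) := by
        simp only [h1]; exact Finset.sum_comm
    _ = _ := by
        simp only [h2]; rw [Finset.sum_comm]
        simp only [mul_comm]

/-- Evaluation at a point as a ring homomorphism. -/
def slabEval (T : ℝ) (p : (Fin 3 → ℝ) × ℝ) : slabAlg T →+* ℝ :=
  (Pi.evalRingHom (fun _ => ℝ) p).comp (slabAlg T).val.toRingHom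

lemma slabEval_apply (p : (Fin 3 → ℝ) × ℝ) (f : slabAlg T) :
    slabEval T p f = (f : (Fin 3 → ℝ) × ℝ → ℝ) p := rfl

/-- The quadratic form of a 2-tensor. -/
def quad (S : Fin 3 → Fin 3 → slabAlg T) (p : (Fin 3 → ℝ) × ℝ) (v : Fin 3 → ℝ) : ℝ :=
  ∑ i, ∑ j, v i * v j * (S i j : (Fin 3 → ℝ) × ℝ → ℝ) p

/-- The curve with initial velocity `e` whose acceleration cancels the Christoffel symbols. -/
def geoCurve (G : (Fin 3 → ℝ) → Matrix (Fin 3) (Fin 3) ℝ) (x e : Fin 3 → ℝ) (h : ℝ) : Fin 3 → ℝ :=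
  fun k => x k + h * e k + h ^ 2 / 2 * (- ∑ i, ∑ j, christoffel G x k i j * e i * e j)

lemma hasJet_slab_comp (hT : 0 < T) (f : slabAlg T) {t : ℝ} (ht : t ∈ Icc 0 T) (x y z : Fin 3 → ℝ) :
    HasJet (fun h => (f : (Fin 3 → ℝ) × ℝ → ℝ) (fun k => x k + h * y k + h ^ 2 / 2 * z k, t))
      ((f : (Fin 3 → ℝ) × ℝ → ℝ) (x, t))
      (∑ i, y i * (slabDx hT i f : (Fin 3 → ℝ) × ℝ → ℝ) (x, t))
      (∑ i, z i * (slabDx hT i f : (Fin 3 → ℝ) × ℝ → ℝ) (x, t)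
        + ∑ i, y i * ∑ j, y j * (slabDx hT j (slabDx hT i f) : (Fin 3 → ℝ) × ℝ → ℝ) (x, t)) := by
  have hc : ∀ h : ℝ, HasDerivAt (fun h : ℝ => (fun k => x k + h * y k + h ^ 2 / 2 * z k : Fin 3 → ℝ))
      (fun k => y k + h * z k) h := by
    intro h
    rw [hasDerivAt_pi]
    intro k
    have := (((hasDerivAt_id h).mul_const (y k)).const_add (x k)).add
      ((((hasDerivAt_id h).pow 2).div_const 2).mul_const (z k))
    refine this.congr_deriv ?_
    simp only [id, Nat.cast_ofNat]; ring
  refine ⟨fun h => ∑ i, (y i + h * z i) * (slabDx hT i f : (Fin 3 → ℝ) × ℝ → ℝ)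
    (fun k => x k + h * y k + h ^ 2 / 2 * z k, t),
    .of_forall fun h => hasDerivAt_slab_comp hT f ht (hc h), by simp, by simp, ?_⟩
  have : ∀ i ∈ Finset.univ, HasDerivAt (fun h : ℝ => (y i + h * z i) * (slabDx hT i f : (Fin 3 → ℝ) × ℝ → ℝ)
      (fun k => x k + h * y k + h ^ 2 / 2 * z k, t)) _ 0 := fun i _ =>
    (((hasDerivAt_id (0 : ℝ)).mul_const (z i)).const_add (y i)).mul
      (hasDerivAt_slab_comp hT (slabDx hT i f) ht (hc 0))
  refine (HasDerivAt.fun_sum this).congr_deriv ?_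
  simp [Finset.sum_add_distrib]

variable {E F : Matrix (Fin 3) (Fin 3) ℝ}

/-- A constant matrix with entries in the slab algebra. -/
def constFrame (T : ℝ) (E : Matrix (Fin 3) (Fin 3) ℝ) : Matrix (Fin 3) (Fin 3) (slabAlg T) :=
  E.map (algebraMap ℝ (slabAlg T))

lemma constFrame_isConstFrame (hT : 0 < T) (h : F * E = 1) :
    IsConstFrame (slabDx hT) (constFrame T E) (constFrame T F) where
  inv := by rw [constFrame, constFrame, ← Matrix.map_mul, h]; simp
  const_e i a b := by simp [constFrame]
  const_f i a b := by simp [constFrame]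

lemma constFrame_apply (p : (Fin 3 → ℝ) × ℝ) (a b : Fin 3) :
    slabEval T p (constFrame T E a b) = E a b := by
  simp [slabEval_apply, constFrame]

lemma hasJet_geoCurve (hT : 0 < T) (hg : SmoothMetricFamily g (Icc 0 T)) (h : F * E = 1)
    (f : slabAlg T) {t : ℝ} (ht : t ∈ Icc 0 T) (x : Fin 3 → ℝ) (i : Fin 3) :
    HasJet (fun s => (f : (Fin 3 → ℝ) × ℝ → ℝ) (geoCurve (fun y => g y t) x (fun k => E k i) s, t))
      (slabEval T (x, t) f)
      (slabEval T (x, t) (frameD (constFrame T E) (slabDx hT) i f))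
      (slabEval T (x, t) (frameD (constFrame T E) (slabDx hT) i (frameD (constFrame T E) (slabDx hT) i f)
        - ∑ c, frameΓ (constFrame T E) (constFrame T F) (slabΓ hT hg) c i i
            * frameD (constFrame T E) (slabDx hT) c f)) := by
  have hE := constFrame_isConstFrame hT h
  refine (hasJet_slab_comp hT f ht x _ _).congr rfl ?_ ?_
  · simp only [frameD_apply, map_sum, map_mul, constFrame_apply]; rfl
  · have e := frame_contract hE (fun k => slabDx hT k f)
      (fun k => ∑ i', ∑ j, constFrame T E i' i * constFrame T E j i * slabΓ hT hg k i' j)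
    have e2 : ∑ c, frameΓ (constFrame T E) (constFrame T F) (slabΓ hT hg) c i i
            * frameD (constFrame T E) (slabDx hT) c f
        = ∑ c, (∑ i, constFrame T E i c * slabDx hT i f) * (∑ k, constFrame T F c k *
          (∑ i', ∑ j, constFrame T E i' i * constFrame T E j i * slabΓ hT hg k i' j)) := by
      refine Finset.sum_congr rfl fun c _ => ?_
      rw [frameD_apply, mul_comm]
      congr 1
      simp only [frameΓ, Fin.sum_univ_three]; ring
    have hcomm := fun i j => (slab_isLeviCivita hT hg).comm i j f
    rw [map_sub, e2, e]
    simp only [frameD_apply, Fin.sum_univ_three, map_add, Derivation.leibniz, hE.const_e, smul_eq_mul,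
      map_mul, constFrame_apply, map_zero, hcomm 1 0, hcomm 2 0, hcomm 2 1]
    simp only [slabEval_apply, slabΓ_apply hT hg _ _ _ ht]
    ring

/-- The field along `geoCurve` which is parallel to second order and starts at `E₀`. -/
def geoField (hT : 0 < T) (hg : SmoothMetricFamily g (Icc 0 T)) (E F : Matrix (Fin 3) (Fin 3) ℝ)
    (p : (Fin 3 → ℝ) × ℝ) (i : Fin 3) (h : ℝ) : Fin 3 → ℝ :=
  fun k => ∑ a, E k a * ((if a = 0 then 1 else 0)
    + h * (- slabEval T p (frameΓ (constFrame T E) (constFrame T F) (slabΓ hT hg) a i 0))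
    + h ^ 2 / 2 * slabEval T p (jetField (frameD (constFrame T E) (slabDx hT))
      (frameΓ (constFrame T E) (constFrame T F) (slabΓ hT hg)) i 0 a))

lemma continuous_geoField (hT : 0 < T) (hg : SmoothMetricFamily g (Icc 0 T)) (p : (Fin 3 → ℝ) × ℝ)
    (i : Fin 3) : Continuous (geoField hT hg E F p i) := by
  unfold geoField; fun_prop

lemma geoField_zero (hT : 0 < T) (hg : SmoothMetricFamily g (Icc 0 T)) (p : (Fin 3 → ℝ) × ℝ)
    (i : Fin 3) : geoField hT hg E F p i 0 = fun k => E k 0 := by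
  funext k; simp [geoField]

lemma slabEval_frameS (S : Fin 3 → Fin 3 → slabAlg T) (p : (Fin 3 → ℝ) × ℝ) (a b : Fin 3) :
    slabEval T p (frameS (constFrame T E) S a b)
      = ∑ i, ∑ j, E i a * E j b * (S i j : (Fin 3 → ℝ) × ℝ → ℝ) p := by
  simp only [frameS, map_sum, map_mul, constFrame_apply]; rfl

lemma hasJet_quad (hT : 0 < T) (hg : SmoothMetricFamily g (Icc 0 T)) (h : F * E = 1)
    {S : Fin 3 → Fin 3 → slabAlg T} (hS : ∀ i j, S i j = S j i) {t : ℝ} (ht : t ∈ Icc 0 T)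
    (x : Fin 3 → ℝ) (i : Fin 3) :
    HasJet (fun s => quad S (geoCurve (fun y => g y t) x (fun k => E k i) s, t)
        (geoField hT hg E F (x, t) i s))
      (slabEval T (x, t) (frameS (constFrame T E) S 0 0))
      (slabEval T (x, t) (cov (frameD (constFrame T E) (slabDx hT))
        (frameΓ (constFrame T E) (constFrame T F) (slabΓ hT hg)) (frameS (constFrame T E) S) i 0 0))
      (slabEval T (x, t) (cov3 (frameD (constFrame T E) (slabDx hT))
        (frameΓ (constFrame T E) (constFrame T F) (slabΓ hT hg))
        (cov (frameD (constFrame T E) (slabDx hT))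
          (frameΓ (constFrame T E) (constFrame T F) (slabΓ hT hg)) (frameS (constFrame T E) S))
        i i 0 0)) := by
  have hS' : ∀ a b, frameS (constFrame T E) S a b = frameS (constFrame T E) S b a := by
    intro a b
    simp only [frameS, Fin.sum_univ_three, hS 1 0, hS 2 0, hS 2 1]; ring
  have hq : ∀ p (w : Fin 3 → ℝ), quad S p (fun k => ∑ a, E k a * w a)
      = ∑ a, ∑ b, w a * w b *
        ((frameS (constFrame T E) S a b : slabAlg T) : (Fin 3 → ℝ) × ℝ → ℝ) p := by
    intro p w
    simp only [← slabEval_apply p (frameS _ _ _ _), slabEval_frameS, quad, Fin.sum_univ_three]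
    ring
  have key := HasJet.sum fun a => HasJet.sum fun b =>
    ((hasJet_poly (if a = 0 then 1 else 0)
      (- slabEval T (x, t) (frameΓ (constFrame T E) (constFrame T F) (slabΓ hT hg) a i 0))
      (slabEval T (x, t) (jetField (frameD (constFrame T E) (slabDx hT))
        (frameΓ (constFrame T E) (constFrame T F) (slabΓ hT hg)) i 0 a))).mul
     (hasJet_poly (if b = 0 then 1 else 0)
      (- slabEval T (x, t) (frameΓ (constFrame T E) (constFrame T F) (slabΓ hT hg) b i 0))
      (slabEval T (x, t) (jetField (frameD (constFrame T E) (slabDx hT))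
        (frameΓ (constFrame T E) (constFrame T F) (slabΓ hT hg)) i 0 b)))).mul
     (hasJet_geoCurve hT hg h (frameS (constFrame T E) S a b) ht x i)
  rw [cov3_cov_diag hS']
  have hfun : (fun s => quad S (geoCurve (fun y => g y t) x (fun k => E k i) s, t)
      (geoField hT hg E F (x, t) i s)) = _ := funext fun s => hq _ _
  rw [hfun]
  refine key.congr ?_ ?_ ?_
  · simp
  · simp only [cov, Fin.sum_univ_three, map_sub, map_add, map_mul, hS' 1 0, hS' 2 0, hS' 2 1]
    simp
    ring
  · simp only [Fin.sum_univ_three, map_sub, map_add, map_mul, map_ofNat, hS' 1 0, hS' 2 0, hS' 2 1]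
    simp
    ring

/-- The function whose positive part measures the failure of pinching. -/
def pinch (hT : 0 < T) (hg : SmoothMetricFamily g (Icc 0 T)) (k : ℝ) (p : (Fin 3 → ℝ) × ℝ)
    (v : Fin 3 → ℝ) : ℝ :=
  -k * (slabScal hT hg : (Fin 3 → ℝ) × ℝ → ℝ) p
    + 2 * (k - 1) * (quad (slabRic hT hg) p v * (quad (slabG hg) p v)⁻¹)

/-- An orthonormal frame at a point which diagonalises the Ricci tensor. -/
structure IsRicciFrame (G S E : Matrix (Fin 3) (Fin 3) ℝ) (ρ : Fin 3 → ℝ) : Prop where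
  metric : ∀ a b, ∑ i, ∑ j, E i a * E j b * G i j = if a = b then 1 else 0
  ric : ∀ a b, ∑ i, ∑ j, E i a * E j b * S i j = if a = b then ρ a else 0

/-- The reaction term in the evolution of the pinching function. -/
def reaction (k : ℝ) (ρ : Fin 3 → ℝ) : ℝ :=
  (ρ 0 + ρ 1 - ρ 2) ^ 2 + (ρ 0 + ρ 2 - ρ 1) ^ 2 + 2 * (ρ 1 + ρ 2 - ρ 0) * ρ 0
    + k * ((ρ 1 + ρ 2 - ρ 0) ^ 2 + (ρ 0 + ρ 1 - ρ 2) * (ρ 0 + ρ 2 - ρ 1))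

theorem exists_pinch_jets (hT : 0 < T) (hg : SmoothMetricFamily g (Icc 0 T))
    (hf : IsRicciFlow g (Icc 0 T)) (k : ℝ) {t : ℝ} (ht : t ∈ Icc 0 T) (x : Fin 3 → ℝ)
    {ρ : Fin 3 → ℝ} (hE : IsRicciFrame (g x t) (Matrix.of (ricci (fun y => g y t) x)) E ρ) :
    ∃ (V : Fin 3 → ℝ → Fin 3 → ℝ) (b c : Fin 3 → ℝ) (τ : ℝ),
      (∀ i, Continuous (V i)) ∧ (∀ i, V i 0 = fun a => E a 0) ∧
      (∀ i, HasJet (fun s => pinch hT hg k (geoCurve (fun y => g y t) x (fun a => E a i) s, t) (V i s))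
        (pinch hT hg k (x, t) (fun a => E a 0)) (b i) (c i)) ∧
      HasDerivWithinAt (fun s => pinch hT hg k (x, s) (fun a => E a 0)) τ (Icc 0 T) t ∧
      τ - ∑ i, c i = - reaction k ρ := by
  have hmul : (Eᵀ * g x t) * E = 1 := by
    ext a b
    rw [Matrix.one_apply, ← hE.metric a b]
    simp only [Matrix.mul_apply, Matrix.transpose_apply, Fin.sum_univ_three]; ring
  set F := Eᵀ * g x t with hF
  have hC := constFrame_isConstFrame (T := T) hT hmul
  have H := slab_isAlgRicciFlow hT hg hf
  have H' := H.frame hC (fun a b => by simp [constFrame])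
  set D' := frameD (constFrame T E) (slabDx hT) with hD'
  set Γ' := frameΓ (constFrame T E) (constFrame T F) (slabΓ hT hg) with hΓ'
  have ad : IsAdapted (slabEval T (x, t)) D' (frameS (constFrame T E) (slabG hg)) Γ' ρ := by
    refine ⟨fun a b => ?_, fun a b => ?_⟩
    · rw [slabEval_frameS, ← hE.metric a b]
      simp only [slabG_apply hg _ _ ht]
    · rw [frame_algRic hC, slabEval_frameS, ← hE.ric a b]
      simp only [← slabRic_apply hT hg _ _ ht, Matrix.of_apply, slabRic]
  have ricS : frameS (constFrame T E) (slabRic hT hg) = algRic D' Γ' := by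
    funext a b; rw [frame_algRic hC]; rfl
  have scalS : slabScal hT hg
      = ∑ a, ∑ b, frameS (constFrame T F)ᵀ (slabGi hg) a b * algRic D' Γ' a b := by
    rw [← ricS, frame_trace hC]; rfl
  have jg := fun i => hasJet_quad hT hg hmul H.g_symm ht x i
  have jr := fun i => hasJet_quad hT hg hmul (S := slabRic hT hg) H.ric_symm ht x i
  have js := fun i => hasJet_geoCurve hT hg hmul (slabScal hT hg) ht x i
  have e0 : (fun a b c => cov D' Γ' (frameS (constFrame T E) (slabG hg)) a b c) = fun _ _ _ => 0 := by
    funext a b c; exact cov_metric H'.toIsLeviCivita a b c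
  have jg1 : ∀ i, HasJet (fun s => quad (slabG hg) (geoCurve (fun y => g y t) x (fun k => E k i) s, t)
        (geoField hT hg E F (x, t) i s)) 1 0 0 := fun i =>
    (jg i).congr (by simp [ad.metric]) (by rw [cov_metric H'.toIsLeviCivita, map_zero])
      (by rw [show cov D' Γ' (frameS (constFrame T E) (slabG hg)) = fun _ _ _ => 0 from e0]
          simp [cov3])
  have hquad : ∀ (S : Fin 3 → Fin 3 → slabAlg T) (p : (Fin 3 → ℝ) × ℝ), quad S p (fun a => E a 0)
      = slabEval T p (frameS (constFrame T E) S 0 0) := fun S p => by rw [slabEval_frameS]; rfl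
  have dquad : ∀ S : Fin 3 → Fin 3 → slabAlg T,
      HasDerivWithinAt (fun s => quad S (x, s) (fun a => E a 0))
        (slabEval T (x, t) (slabDt hT (frameS (constFrame T E) S 0 0))) (Icc 0 T) t := fun S => by
    simp only [hquad]
    exact hasDerivWithinAt_slab hT (frameS (constFrame T E) S 0 0 : slabAlg T) (x := x) ht
  have v1 : quad (slabG hg) (x, t) (fun a => E a 0) = 1 := by rw [hquad, ad.metric]; simp
  have vr : quad (slabRic hT hg) (x, t) (fun a => E a 0) = ρ 0 := by rw [hquad, ricS, ad.ric]; simp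
  have pj := fun i => (((js i).const_mul (-k)).add
    (((jr i).mul (jg1 i).inv_one).const_mul (2 * (k - 1))))
  have pt := ((hasDerivWithinAt_slab hT (slabScal hT hg) (x := x) ht).const_mul (-k)).add
      (((dquad (slabRic hT hg)).mul ((dquad (slabG hg)).inv (by rw [v1]; exact one_ne_zero))).const_mul
        (2 * (k - 1)))
  refine ⟨fun i => geoField hT hg E F (x, t) i, _, _, _, fun i => continuous_geoField hT hg _ i,
    fun i => geoField_zero hT hg _ i,
    fun i => (pj i).congr (by rw [pinch, v1, hquad]; simp [slabEval_apply]) rfl rfl, pt, ?_⟩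
  · have hs := ad.dt_scal H'
    rw [← scalS] at hs
    have hr := ad.dt_ric_zero H'
    rw [ad.ric 0 0, if_pos rfl] at hr
    rw [Pi.inv_apply, ← slabEval_apply, hs, v1, vr, ricS]
    simp only [reaction, Fin.sum_univ_three] at hr ⊢
    linear_combination 2 * (k - 1) * hr

end Heat

/-! ### Ricci frames and eigenvalues of the curvature operator -/

lemma isRicciFrame_iff {G S E : Matrix (Fin 3) (Fin 3) ℝ} {ρ : Fin 3 → ℝ} :
    IsRicciFrame G S E ρ ↔ Eᵀ * G * E = 1 ∧ Eᵀ * S * E = Matrix.diagonal ρ := by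
  have key : ∀ (S : Matrix (Fin 3) (Fin 3) ℝ) a b,
      ∑ i, ∑ j, E i a * E j b * S i j = (Eᵀ * S * E) a b := by
    intro S a b
    simp only [Matrix.mul_apply, Matrix.transpose_apply, Fin.sum_univ_three]; ring
  constructor
  · rintro ⟨h1, h2⟩
    refine ⟨?_, ?_⟩
    · ext a b; rw [← key, h1, Matrix.one_apply]
    · ext a b; rw [← key, h2, Matrix.diagonal_apply]
  · rintro ⟨h1, h2⟩
    refine ⟨fun a b => ?_, fun a b => ?_⟩
    · rw [key, h1, Matrix.one_apply]
    · rw [key, h2, Matrix.diagonal_apply]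

open scoped MatrixOrder Matrix.Norms.L2Operator in
lemma exists_eq_transpose_mul_self {G : Matrix (Fin 3) (Fin 3) ℝ} (hG : G.PosSemidef) :
    ∃ B : Matrix (Fin 3) (Fin 3) ℝ, G = Bᵀ * B := by
  obtain ⟨B, hB⟩ := CStarAlgebra.nonneg_iff_eq_star_mul_self.mp hG.nonneg
  exact ⟨B, by rwa [Matrix.star_eq_conjTranspose,
    Matrix.conjTranspose_eq_transpose_of_trivial] at hB⟩

/-- A symmetric form can be diagonalised relative to a positive definite one. -/
lemma exists_isRicciFrame {G S : Matrix (Fin 3) (Fin 3) ℝ} (hG : G.PosDef) (hS : S.IsSymm) :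
    ∃ E ρ, IsRicciFrame G S E ρ ∧ ρ 1 ≤ ρ 0 ∧ ρ 2 ≤ ρ 1 := by
  obtain ⟨B, hB⟩ := exists_eq_transpose_mul_self hG.posSemidef
  have hdet : IsUnit B.det := by
    have := hG.det_pos
    rw [hB, Matrix.det_mul, Matrix.det_transpose] at this
    exact isUnit_iff_ne_zero.mpr fun h => by simp [h] at this
  set P := B⁻¹ with hP
  have hBP : B * P = 1 := Matrix.mul_nonsing_inv B hdet
  have hGP : Pᵀ * G * P = 1 := by
    rw [hB, show Pᵀ * (Bᵀ * B) * P = (B * P)ᵀ * (B * P) by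
      rw [Matrix.transpose_mul]; simp only [Matrix.mul_assoc], hBP]
    simp
  have hH : (Pᵀ * S * P).IsHermitian := by
    rw [Matrix.IsHermitian, Matrix.conjTranspose_eq_transpose_of_trivial]
    simp only [Matrix.transpose_mul, Matrix.transpose_transpose, hS.eq, Matrix.mul_assoc]
  set U : Matrix (Fin 3) (Fin 3) ℝ := (hH.eigenvectorUnitary : Matrix (Fin 3) (Fin 3) ℝ) with hU
  have hUU : Uᵀ * U = 1 := by
    have := (Matrix.mem_unitaryGroup_iff').mp hH.eigenvectorUnitary.2
    rwa [Matrix.star_eq_conjTranspose, Matrix.conjTranspose_eq_transpose_of_trivial] at this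
  have hdiag : Uᵀ * (Pᵀ * S * P) * U = Matrix.diagonal hH.eigenvalues := by
    have := hH.conjStarAlgAut_star_eigenvectorUnitary
    rw [Unitary.conjStarAlgAut_apply] at this
    simp only [Unitary.coe_star, star_star] at this
    rw [Matrix.star_eq_conjTranspose, Matrix.conjTranspose_eq_transpose_of_trivial] at this
    rw [hU, this]; rfl
  set σ := Tuple.sort (fun i => - hH.eigenvalues i) with hσ
  have hmono := Tuple.monotone_sort (fun i => - hH.eigenvalues i)
  refine ⟨(P * U).submatrix id σ, hH.eigenvalues ∘ σ, isRicciFrame_iff.mpr ⟨?_, ?_⟩, ?_, ?_⟩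
  · have : ((P * U).submatrix id σ)ᵀ * G * (P * U).submatrix id σ
        = ((Uᵀ * (Pᵀ * G * P) * U)).submatrix σ σ := by
      ext a b
      simp only [Matrix.mul_apply, Matrix.transpose_apply, Matrix.submatrix_apply, id,
        Fin.sum_univ_three]
      ring
    rw [this, hGP, Matrix.mul_one, hUU]
    simp
  · have : ((P * U).submatrix id σ)ᵀ * S * (P * U).submatrix id σ
        = ((Uᵀ * (Pᵀ * S * P) * U)).submatrix σ σ := by
      ext a b
      simp only [Matrix.mul_apply, Matrix.transpose_apply, Matrix.submatrix_apply, id,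
        Fin.sum_univ_three]
      ring
    rw [this, hdiag, Matrix.submatrix_diagonal_equiv]
  · have := hmono (show (0 : Fin 3) ≤ 1 by decide)
    simp only [Function.comp] at this ⊢
    linarith
  · have := hmono (show (1 : Fin 3) ≤ 2 by decide)
    simp only [Function.comp] at this ⊢
    linarith

lemma eq_of_cubic_eq {a b c l m n : ℝ} (hab : b ≤ a) (hbc : c ≤ b) (hlm : m ≤ l) (hmn : n ≤ m)
    (h : ∀ z : ℝ, (z - a) * (z - b) * (z - c) = (z - l) * (z - m) * (z - n)) :
    a = l ∧ b = m ∧ c = n := by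
  have root : ∀ z, (z = a ∨ z = b ∨ z = c) ↔ (z = l ∨ z = m ∨ z = n) := by
    intro z
    have := h z
    constructor
    · intro hz
      have h0 : (z - l) * (z - m) * (z - n) = 0 := by
        rw [← this]; rcases hz with rfl | rfl | rfl <;> simp
      simpa [sub_eq_zero, or_assoc] using h0
    · intro hz
      have h0 : (z - a) * (z - b) * (z - c) = 0 := by
        rw [this]; rcases hz with rfl | rfl | rfl <;> simp
      simpa [sub_eq_zero, or_assoc] using h0
  have h1 : a = l := by
    apply le_antisymm
    · rcases (root a).mp (Or.inl rfl) with h | h | h <;> linarith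
    · rcases (root l).mpr (Or.inl rfl) with h | h | h <;> linarith
  have h2 : c = n := by
    apply le_antisymm
    · rcases (root n).mpr (Or.inr (Or.inr rfl)) with h | h | h <;> linarith
    · rcases (root c).mp (Or.inr (Or.inr rfl)) with h | h | h <;> linarith
  subst h1 h2
  refine ⟨rfl, ?_, rfl⟩
  have h3 := h (a + 1)
  have h4 : a + 1 - c ≠ 0 := by linarith
  have h5 := mul_right_cancel₀ h4 h3
  linarith

section

variable {G : (Fin 3 → ℝ) → Matrix (Fin 3) (Fin 3) ℝ} {x : Fin 3 → ℝ}
  {E : Matrix (Fin 3) (Fin 3) ℝ} {ρ : Fin 3 → ℝ}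

lemma IsRicciFrame.inv {G S : Matrix (Fin 3) (Fin 3) ℝ} (hE : IsRicciFrame G S E ρ) :
    G⁻¹ = E * Eᵀ := by
  obtain ⟨h1, -⟩ := isRicciFrame_iff.mp hE
  have h2 : E * (Eᵀ * G) = 1 := mul_eq_one_comm.mp h1
  refine Matrix.inv_eq_left_inv ?_
  rw [Matrix.mul_assoc, h2]

lemma IsRicciFrame.scalarCurv (hE : IsRicciFrame (G x) (Matrix.of (ricci G x)) E ρ) :
    scalarCurv G x = ∑ a, ρ a := by
  have h : _root_.scalarCurv G x = ∑ a, ∑ i, ∑ j, E i a * E j a * ricci G x i j := by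
    rw [_root_.scalarCurv, hE.inv]
    simp only [Matrix.mul_apply, Matrix.transpose_apply, Fin.sum_univ_three]; ring
  rw [h]
  refine Finset.sum_congr rfl fun a _ => ?_
  simpa using hE.ric a a

lemma IsRicciFrame.isEigTriple_iff (hE : IsRicciFrame (G x) (Matrix.of (ricci G x)) E ρ)
    (h10 : ρ 1 ≤ ρ 0) (h21 : ρ 2 ≤ ρ 1) {lam mu nu : ℝ} :
    IsEigTriple (curvOp G x) lam mu nu ↔
      ρ 0 + ρ 1 - ρ 2 = lam ∧ ρ 0 + ρ 2 - ρ 1 = mu ∧ ρ 1 + ρ 2 - ρ 0 = nu := by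
  obtain ⟨h1, h2⟩ := isRicciFrame_iff.mp hE
  have hEE : E * (Eᵀ * G x) = 1 := mul_eq_one_comm.mp h1
  set R := ∑ a, ρ a with hR
  have hM : curvOp G x = E * Matrix.diagonal (fun a => R - 2 * ρ a) * (Eᵀ * G x) := by
    have e1 : curvOp G x = (G x)⁻¹ * (R • G x - (2 : ℝ) • Matrix.of (ricci G x)) := by
      ext i j
      simp [curvOp, Matrix.mul_apply, hE.scalarCurv, hR]
    have e2 : Matrix.diagonal (fun a => R - 2 * ρ a)
        = R • (Eᵀ * G x * E) - (2 : ℝ) • (Eᵀ * Matrix.of (ricci G x) * E) := by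
      rw [h1, h2]; ext i j; by_cases hij : i = j <;> simp [hij]
    have e3 : E * (R • (Eᵀ * G x * E) - (2 : ℝ) • (Eᵀ * Matrix.of (ricci G x) * E)) * (Eᵀ * G x)
        = E * Eᵀ * (R • G x - (2 : ℝ) • Matrix.of (ricci G x)) * (E * (Eᵀ * G x)) := by
      simp only [Matrix.mul_sub, Matrix.sub_mul, Matrix.mul_smul, Matrix.smul_mul, Matrix.mul_assoc]
    rw [e1, hE.inv, e2, e3, hEE, Matrix.mul_one]
  have hdet : ∀ z : ℝ, (z • (1 : Matrix (Fin 3) (Fin 3) ℝ) - curvOp G x).det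
      = (z - (ρ 0 + ρ 1 - ρ 2)) * (z - (ρ 0 + ρ 2 - ρ 1)) * (z - (ρ 1 + ρ 2 - ρ 0)) := by
    intro z
    have e : z • (1 : Matrix (Fin 3) (Fin 3) ℝ) - curvOp G x
        = E * Matrix.diagonal (fun a => z - (R - 2 * ρ a)) * (Eᵀ * G x) := by
      have : Matrix.diagonal (fun a => z - (R - 2 * ρ a))
          = z • (1 : Matrix (Fin 3) (Fin 3) ℝ) - Matrix.diagonal (fun a => R - 2 * ρ a) := by
        ext i j; by_cases hij : i = j <;> simp [hij]
      rw [hM, this, Matrix.mul_sub, Matrix.sub_mul, Matrix.mul_smul, Matrix.smul_mul, Matrix.mul_one,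
        hEE]
    rw [e, Matrix.det_mul_comm, ← Matrix.mul_assoc, h1, Matrix.one_mul, Matrix.det_diagonal,
      Fin.prod_univ_three, hR, Fin.sum_univ_three]
    ring
  constructor
  · rintro ⟨hnm, hml, h⟩
    exact eq_of_cubic_eq (by linarith) (by linarith) hml hnm fun z => by rw [← h z, hdet z]
  · rintro ⟨rfl, rfl, rfl⟩
    exact ⟨by linarith, by linarith, hdet⟩

end

/-- The reaction term dominates the square of the pinching quantity. -/
lemma half_sq_le_reaction_one {ρ : Fin 3 → ℝ} {N : ℝ} (hN : N = -(ρ 0 + ρ 1 + ρ 2)) :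
    N ^ 2 / 2 ≤ reaction 1 ρ := by
  rw [hN, reaction]
  nlinarith [sq_nonneg (ρ 0 - ρ 1), sq_nonneg (ρ 0 - ρ 2), sq_nonneg (ρ 1 - ρ 2),
    sq_nonneg (ρ 0 + ρ 1 + ρ 2), sq_nonneg (ρ 0), sq_nonneg (ρ 1), sq_nonneg (ρ 2)]

lemma half_sq_le_reaction {ρ : Fin 3 → ℝ} (h10 : ρ 1 ≤ ρ 0) (h21 : ρ 2 ≤ ρ 1) {k N m : ℝ}
    (hk : 2 ≤ k) (hN : N = -k * (ρ 0 + ρ 1 + ρ 2) + 2 * (k - 1) * ρ 0) (hN0 : 0 < N)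
    (hm : -(k - 1) * (ρ 0 + ρ 1 + ρ 2) + 2 * (k - 2) * ρ 0 ≤ m) (hNm : 4 * k * m ≤ N) :
    N ^ 2 / 2 ≤ reaction k ρ := by
  obtain ⟨a, ha⟩ : ∃ a, a = ρ 0 - ρ 1 - ρ 2 := ⟨_, rfl⟩
  have h0 : ρ 0 = (k * a - N) / 2 := by rw [hN, ha]; ring
  have hd : 0 ≤ (ρ 0 - ρ 1) * (ρ 0 - ρ 2) := mul_nonneg (by linarith) (by linarith)
  have h12 : ρ 1 + ρ 2 = ρ 0 - a := by rw [ha]; ring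
  have hF : reaction k ρ - (k - 2) * (4 * ((ρ 0 - ρ 1) * (ρ 0 - ρ 2)))
      = (k + 2) * a ^ 2 - (k + 1) * a * N + N ^ 2 := by
    rw [reaction, ha, hN]; ring
  have hmm : N - a ≤ m := by rw [hN, ha]; linarith
  have hka : (4 * k - 1) * N ≤ 4 * k * a := by nlinarith
  have hquad : 0 ≤ (k - 2) * (4 * ((ρ 0 - ρ 1) * (ρ 0 - ρ 2))) :=
    mul_nonneg (by linarith) (by linarith)
  have h78 : 7 / 8 * N ≤ a := by
    have : 0 ≤ (k - 2) * N := mul_nonneg (by linarith) hN0.le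
    by_contra hcon
    push Not at hcon
    nlinarith
  nlinarith [mul_nonneg (sub_nonneg.mpr h78) hN0.le, mul_nonneg (sub_nonneg.mpr hk) hN0.le,
    mul_nonneg (sub_nonneg.mpr hka) hN0.le, mul_nonneg (sub_nonneg.mpr h78) (sub_nonneg.mpr hka),
    sq_nonneg (a - N), mul_nonneg (sub_nonneg.mpr hk) (sq_nonneg (a - N))]

/-! ### Lengths of paths and the distance function -/

section Paths

/-- The quadratic form of a matrix. -/
def qf (M : Matrix (Fin n) (Fin n) ℝ) (u : Fin n → ℝ) : ℝ := ∑ i, ∑ j, M i j * u i * u j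

lemma qf_smul (M : Matrix (Fin n) (Fin n) ℝ) (c : ℝ) (u : Fin n → ℝ) :
    qf M (c • u) = c ^ 2 * qf M u := by
  simp only [qf, Finset.mul_sum, Pi.smul_apply, smul_eq_mul]
  exact Finset.sum_congr rfl fun i _ => Finset.sum_congr rfl fun j _ => by ring

lemma qf_eq_dotProduct (M : Matrix (Fin n) (Fin n) ℝ) (u : Fin n → ℝ) :
    qf M u = star u ⬝ᵥ (M *ᵥ u) := by
  simp only [qf, dotProduct, Matrix.mulVec, Finset.mul_sum, Pi.star_apply, star_trivial]
  exact Finset.sum_congr rfl fun i _ => Finset.sum_congr rfl fun j _ => by ring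

lemma qf_nonneg {M : Matrix (Fin n) (Fin n) ℝ} (hM : M.PosDef) (u : Fin n → ℝ) : 0 ≤ qf M u := by
  rw [qf_eq_dotProduct]; exact hM.posSemidef.dotProduct_mulVec_nonneg u

lemma qf_pos {M : Matrix (Fin n) (Fin n) ℝ} (hM : M.PosDef) {u : Fin n → ℝ} (hu : u ≠ 0) :
    0 < qf M u := by
  rw [qf_eq_dotProduct]; exact hM.dotProduct_mulVec_pos hu

variable {G : (Fin n → ℝ) → Matrix (Fin n) (Fin n) ℝ}

lemma ContinuousOn.sqrt_qf {X : Type*} [TopologicalSpace X] {s : Set X} {γ V : X → Fin n → ℝ}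
    (hG : ∀ i j, Continuous fun x => G x i j) (hγ : ContinuousOn γ s) (hV : ContinuousOn V s) :
    ContinuousOn (fun τ => Real.sqrt (qf (G (γ τ)) (V τ))) s := by
  refine ContinuousOn.sqrt ?_
  refine continuousOn_finsetSum _ fun i _ => continuousOn_finsetSum _ fun j _ => ?_
  exact (((hG i j).comp_continuousOn hγ).mul ((continuous_apply i).comp_continuousOn hV)).mul
    ((continuous_apply j).comp_continuousOn hV)

lemma bddBelow_pathLengths (x y : Fin n → ℝ) :
    BddBelow {L : ℝ | ∃ γ : ℝ → (Fin n → ℝ),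
      ContDiffOn ℝ 1 γ (Icc 0 1) ∧ γ 0 = x ∧ γ 1 = y ∧ L = pathLength G γ} :=
  ⟨0, by
    rintro L ⟨γ, -, -, -, rfl⟩
    exact intervalIntegral.integral_nonneg zero_le_one fun _ _ => Real.sqrt_nonneg _⟩

lemma riemDist_nonneg (x y : Fin n → ℝ) : 0 ≤ riemDist G x y := by
  refine Real.sInf_nonneg ?_
  rintro L ⟨γ, -, -, -, rfl⟩
  exact intervalIntegral.integral_nonneg zero_le_one fun _ _ => Real.sqrt_nonneg _

lemma pathLengths_nonempty (x y : Fin n → ℝ) :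
    {L : ℝ | ∃ γ : ℝ → (Fin n → ℝ),
      ContDiffOn ℝ 1 γ (Icc 0 1) ∧ γ 0 = x ∧ γ 1 = y ∧ L = pathLength G γ}.Nonempty :=
  ⟨_, fun s => x + s • (y - x), ContDiff.contDiffOn (by fun_prop), by simp, by simp, rfl⟩

/-- The distance is at most the length of a path given with its velocity. -/
lemma riemDist_le_integral {γ V : ℝ → Fin n → ℝ}
    (hγ : ∀ τ ∈ Icc (0 : ℝ) 1, HasDerivWithinAt γ (V τ) (Icc 0 1) τ)
    (hV : ContinuousOn V (Icc 0 1)) :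
    riemDist G (γ 0) (γ 1) ≤ ∫ s in (0 : ℝ)..1, Real.sqrt (qf (G (γ s)) (V s)) := by
  refine csInf_le (bddBelow_pathLengths _ _) ⟨γ, ?_, rfl, rfl, ?_⟩
  · have hu : UniqueDiffOn ℝ (Icc (0 : ℝ) 1) := uniqueDiffOn_Icc zero_lt_one
    rw [show (1 : WithTop ℕ∞) = 0 + 1 by rfl, contDiffOn_succ_iff_derivWithin hu]
    refine ⟨fun τ hτ => (hγ τ hτ).differentiableWithinAt, by simp, ?_⟩
    rw [contDiffOn_zero]
    exact hV.congr fun τ hτ => (hγ τ hτ).derivWithin (hu τ hτ)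
  · refine intervalIntegral.integral_congr_ae ?_
    have : ∀ᵐ s : ℝ, s ≠ 1 := by simp [ae_iff, measure_singleton]
    filter_upwards [this] with s hs hs'
    rw [uIoc_of_le zero_le_one] at hs'
    have := (hγ s ⟨hs'.1.le, hs'.2⟩).hasDerivAt (Icc_mem_nhds hs'.1 (lt_of_le_of_ne hs'.2 hs))
    simp only [this.deriv, qf]

lemma riemDist_le_integral_of_nonneg {γ V : ℝ → Fin n → ℝ} {b : ℝ} (hb : 0 ≤ b)
    (hγ : ∀ τ ∈ Icc (0 : ℝ) b, HasDerivAt γ (V τ) τ) (hV : ContinuousOn V (Icc 0 b)) :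
    riemDist G (γ 0) (γ b) ≤ ∫ s in (0 : ℝ)..b, Real.sqrt (qf (G (γ s)) (V s)) := by
  have hmem : ∀ τ ∈ Icc (0 : ℝ) 1, b * τ ∈ Icc (0 : ℝ) b := fun τ hτ =>
    ⟨mul_nonneg hb hτ.1, by nlinarith [hτ.2]⟩
  have h := riemDist_le_integral (G := G) (γ := fun τ => γ (b * τ)) (V := fun τ => b • V (b * τ))
    (fun τ hτ => by
      have h1 : HasDerivAt (fun τ : ℝ => b * τ) b τ := by simpa using (hasDerivAt_id τ).const_mul b
      exact ((hγ _ (hmem τ hτ)).scomp τ h1).hasDerivWithinAt)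
    ((hV.comp (by fun_prop) hmem).const_smul b)
  simp only [mul_zero, mul_one, qf_smul] at h
  refine h.trans_eq ?_
  have e : ∀ s, Real.sqrt (b ^ 2 * qf (G (γ (b * s))) (V (b * s)))
      = b * Real.sqrt (qf (G (γ (b * s))) (V (b * s))) := fun s => by
    rw [Real.sqrt_mul (sq_nonneg b), Real.sqrt_sq hb]
  simp only [e, intervalIntegral.integral_const_mul]
  have := intervalIntegral.mul_integral_comp_mul_left
    (f := fun s => Real.sqrt (qf (G (γ s)) (V s))) (a := 0) (b := 1) b
  simpa using this

/-- Half the squared distance is at most the energy. -/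
lemma sq_riemDist_le_integral (hG : ∀ i j, Continuous fun x => G x i j) (hpos : ∀ x, (G x).PosDef)
    {γ V : ℝ → Fin n → ℝ} (hγ : ∀ τ ∈ Icc (0 : ℝ) 1, HasDerivWithinAt γ (V τ) (Icc 0 1) τ)
    (hV : ContinuousOn V (Icc 0 1)) :
    riemDist G (γ 0) (γ 1) ^ 2 ≤ ∫ s in (0 : ℝ)..1, qf (G (γ s)) (V s) := by
  have hγc : ContinuousOn γ (Icc 0 1) := fun τ hτ => (hγ τ hτ).continuousWithinAt
  have hf := ContinuousOn.sqrt_qf hG hγc hV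
  set f := fun s => Real.sqrt (qf (G (γ s)) (V s)) with hfdef
  set a := ∫ s in (0 : ℝ)..1, f s with ha
  have hfi : IntervalIntegrable f volume 0 1 := by
    apply ContinuousOn.intervalIntegrable; rwa [uIcc_of_le zero_le_one]
  have hf2 : IntervalIntegrable (fun s => f s ^ 2) volume 0 1 := by
    apply ContinuousOn.intervalIntegrable; rw [uIcc_of_le zero_le_one]; exact hf.pow 2
  have hda := riemDist_le_integral (G := G) hγ hV
  have h0 : 0 ≤ ∫ s in (0 : ℝ)..1, (f s - a) ^ 2 :=
    intervalIntegral.integral_nonneg zero_le_one fun _ _ => sq_nonneg _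
  have h1 : ∫ s in (0 : ℝ)..1, (f s - a) ^ 2 = (∫ s in (0 : ℝ)..1, f s ^ 2) - a ^ 2 := by
    have : ∀ s, (f s - a) ^ 2 = f s ^ 2 - 2 * a * f s + a ^ 2 := fun s => by ring
    simp only [this]
    rw [intervalIntegral.integral_add (hf2.sub (hfi.const_mul _)) (by simp),
      intervalIntegral.integral_sub hf2 (hfi.const_mul _), intervalIntegral.integral_const_mul]
    simp only [intervalIntegral.integral_const, ← ha]
    simp; ring
  have h2 : ∀ s, f s ^ 2 = qf (G (γ s)) (V s) := fun s => Real.sq_sqrt (qf_nonneg (hpos _) _)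
  simp only [h2] at h1
  have := riemDist_nonneg (G := G) (γ 0) (γ 1)
  nlinarith

/-- Points closer than `ℓ` are joined by a path of speed at most `ℓ`. -/
lemma exists_path_of_riemDist_lt (hG : ∀ i j, Continuous fun x => G x i j) {x y : Fin n → ℝ} {ℓ : ℝ}
    (h : riemDist G x y < ℓ) :
    ∃ γ V : ℝ → Fin n → ℝ, (∀ τ, HasDerivAt γ (V τ) τ) ∧ Continuous V ∧ γ 0 = x ∧ γ 1 = y ∧
      ∀ τ, Real.sqrt (qf (G (γ τ)) (V τ)) ≤ ℓ := by
  have hℓ : 0 < ℓ := (riemDist_nonneg x y).trans_lt h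
  obtain ⟨_, ⟨γ₀, hγ₀, h0, h1, rfl⟩, hL⟩ := exists_lt_of_csInf_lt
    (pathLengths_nonempty (G := G) x y) h
  have hu : UniqueDiffOn ℝ (Icc (0 : ℝ) 1) := uniqueDiffOn_Icc zero_lt_one
  have hd : ContinuousOn (derivWithin γ₀ (Icc 0 1)) (Icc 0 1) :=
    hγ₀.continuousOn_derivWithin hu le_rfl
  set V₀ : ℝ → Fin n → ℝ := fun s => derivWithin γ₀ (Icc 0 1) (projIcc 0 1 zero_le_one s) with hV₀
  have hV₀c : Continuous V₀ := hd.comp_continuous (by fun_prop) fun s => (projIcc 0 1 _ s).2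
  set γ₁ : ℝ → Fin n → ℝ := fun s => x + ∫ r in (0 : ℝ)..s, V₀ r with hγ₁
  have hγ₁d : ∀ s, HasDerivAt γ₁ (V₀ s) s := fun s =>
    (intervalIntegral.integral_hasDerivAt_right (hV₀c.intervalIntegrable _ _)
      (hV₀c.stronglyMeasurableAtFilter _ _) hV₀c.continuousAt).const_add x
  have hγ₁c : Continuous γ₁ := continuous_iff_continuousAt.mpr fun s => (hγ₁d s).continuousAt
  have hV₀eq : ∀ s ∈ Icc (0 : ℝ) 1, V₀ s = derivWithin γ₀ (Icc 0 1) s := fun s hs => by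
    simp only [hV₀, projIcc_of_mem _ hs]
  have heq : ∀ s ∈ Icc (0 : ℝ) 1, γ₁ s = γ₀ s := by
    refine (convex_Icc (0 : ℝ) 1).eqOn_of_fderivWithin_eq (𝕜 := ℝ)
      (fun s _ => (hγ₁d s).differentiableAt.differentiableWithinAt) (hγ₀.differentiableOn one_ne_zero)
      hu ?_ (left_mem_Icc.mpr zero_le_one) (by simp [hγ₁, h0])
    intro s hs
    rw [(hγ₁d s).hasDerivWithinAt.hasFDerivWithinAt.fderivWithin (hu s hs), hV₀eq s hs,
      ((hγ₀.differentiableOn one_ne_zero s hs).hasDerivWithinAt).hasFDerivWithinAt.fderivWithin (hu s hs)]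
  set f : ℝ → ℝ := fun s => Real.sqrt (qf (G (γ₁ s)) (V₀ s)) with hf
  have hfc : Continuous f := by
    rw [← continuousOn_univ]
    exact ContinuousOn.sqrt_qf hG hγ₁c.continuousOn hV₀c.continuousOn
  have hlen : ∫ s in (0 : ℝ)..1, f s = pathLength G γ₀ := by
    refine intervalIntegral.integral_congr_ae ?_
    have : ∀ᵐ s : ℝ, s ≠ 1 := by simp [ae_iff, measure_singleton]
    filter_upwards [this] with s hs hs'
    rw [uIoc_of_le zero_le_one] at hs'
    have hs1 : s ∈ Icc (0 : ℝ) 1 := ⟨hs'.1.le, hs'.2⟩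
    simp only [hf, heq s hs1, hV₀eq s hs1, qf,
      derivWithin_of_mem_nhds (Icc_mem_nhds hs'.1 (lt_of_le_of_ne hs'.2 hs))]
  set η := ℓ - pathLength G γ₀ with hη
  have hη0 : 0 < η := by linarith
  set σ : ℝ → ℝ := fun s => ℓ⁻¹ * ∫ r in (0 : ℝ)..s, (f r + η) with hσ
  have hfηc : Continuous fun r => f r + η := by fun_prop
  have hf0 : ∀ r, 0 ≤ f r := fun r => Real.sqrt_nonneg _
  have hσd : ∀ s, HasDerivAt σ (ℓ⁻¹ * (f s + η)) s := fun s =>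
    (intervalIntegral.integral_hasDerivAt_right (hfηc.intervalIntegrable _ _)
      (hfηc.stronglyMeasurableAtFilter _ _) hfηc.continuousAt).const_mul _
  have hσpos : ∀ s, 0 < ℓ⁻¹ * (f s + η) := fun s =>
    mul_pos (inv_pos.mpr hℓ) (by linarith [hf0 s])
  have hσm : StrictMono σ := strictMono_of_deriv_pos fun s => by rw [(hσd s).deriv]; exact hσpos s
  have hσc : Continuous σ := continuous_iff_continuousAt.mpr fun s => (hσd s).continuousAt
  have hσ0 : σ 0 = 0 := by simp [hσ]
  have hσ1 : σ 1 = 1 := by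
    simp only [hσ]
    rw [intervalIntegral.integral_add (hfc.intervalIntegrable _ _) (by simp), hlen]
    simp only [intervalIntegral.integral_const, hη]
    simp; field_simp
  have hσd' : ∀ s, HasDerivAt (fun s => σ s - (ℓ⁻¹ * η) * s) (ℓ⁻¹ * (f s + η) - ℓ⁻¹ * η) s :=
    fun s => ((hσd s).sub ((hasDerivAt_id s).const_mul _)).congr_deriv (by simp)
  have hmono : Monotone fun s => σ s - (ℓ⁻¹ * η) * s := by
    refine monotone_of_deriv_nonneg (fun s => (hσd' s).differentiableAt) fun s => ?_
    rw [(hσd' s).deriv]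
    have := mul_nonneg (inv_pos.mpr hℓ).le (hf0 s)
    linarith
  have hc0 : 0 < ℓ⁻¹ * η := mul_pos (inv_pos.mpr hℓ) hη0
  have htop : Filter.Tendsto σ Filter.atTop Filter.atTop := by
    refine Filter.tendsto_atTop_mono' _ ?_ (Filter.tendsto_id.const_mul_atTop hc0)
    filter_upwards [Filter.eventually_ge_atTop 0] with s hs
    have := hmono hs
    simp only [hσ0, mul_zero, sub_zero] at this
    simp only [id]; linarith
  have hbot : Filter.Tendsto σ Filter.atBot Filter.atBot := by
    refine Filter.tendsto_atBot_mono' _ ?_ (Filter.tendsto_id.const_mul_atBot hc0)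
    filter_upwards [Filter.eventually_le_atBot 0] with s hs
    have := hmono hs
    simp only [hσ0, mul_zero, sub_zero] at this
    simp only [id]; linarith
  set e := hσm.orderIsoOfSurjective σ (hσc.surjective htop hbot) with he
  have heσ : ∀ s, e s = σ s := fun s => rfl
  set φ : ℝ → ℝ := fun τ => e.symm τ with hφ
  have hσφ : ∀ τ, σ (φ τ) = τ := fun τ => e.apply_symm_apply τ
  have hφσ : ∀ s, φ (σ s) = s := fun s => e.symm_apply_apply s
  have hφc : Continuous φ := e.symm.continuous
  have hφd : ∀ τ, HasDerivAt φ (ℓ⁻¹ * (f (φ τ) + η))⁻¹ τ := fun τ =>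
    HasDerivAt.of_local_left_inverse hφc.continuousAt (hσd _) (hσpos _).ne' (.of_forall hσφ)
  refine ⟨γ₁ ∘ φ, fun τ => (ℓ⁻¹ * (f (φ τ) + η))⁻¹ • V₀ (φ τ), fun τ => (hγ₁d _).scomp τ (hφd τ),
    ?_, ?_, ?_, fun τ => ?_⟩
  · refine Continuous.smul (Continuous.inv₀ ?_ fun τ => (hσpos _).ne') (hV₀c.comp hφc)
    exact continuous_const.mul ((hfc.comp hφc).add continuous_const)
  · have : φ 0 = 0 := by rw [← hσ0, hφσ, hσ0]
    simp [this, hγ₁]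
  · have : φ 1 = 1 := by rw [← hσ1, hφσ, hσ1]
    simp only [Function.comp, this]
    rw [heq 1 (right_mem_Icc.mpr zero_le_one), h1]
  · rw [qf_smul, Real.sqrt_mul (sq_nonneg _), Real.sqrt_sq (inv_pos.mpr (hσpos _)).le]
    change (ℓ⁻¹ * (f (φ τ) + η))⁻¹ * f (φ τ) ≤ ℓ
    have h3 : 0 < f (φ τ) + η := by linarith [hf0 (φ τ)]
    rw [mul_inv, inv_inv, mul_assoc]
    refine mul_le_of_le_one_right hℓ.le ?_
    rw [inv_mul_le_iff₀ h3]
    linarith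

end Paths

/-! ### Linear ordinary differential equations -/

section LinearODE

/-- Coordinatewise projection to a cube. -/
def clamp (L : ℝ) (y : Fin n → ℝ) : Fin n → ℝ := fun i => max (-L) (min L (y i))

lemma norm_clamp_sub_le (L : ℝ) (y z : Fin n → ℝ) : ‖clamp L y - clamp L z‖ ≤ ‖y - z‖ := by
  refine (pi_norm_le_iff_of_nonneg (norm_nonneg _)).mpr fun i => ?_
  refine le_trans ?_ (norm_le_pi_norm (y - z) i)
  simp only [clamp, Pi.sub_apply, Real.norm_eq_abs]
  have h1 := abs_max_sub_max_le_max (-L) (min L (y i)) (-L) (min L (z i))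
  have h2 := abs_min_sub_min_le_max L (y i) L (z i)
  simp only [sub_self, abs_zero] at h1 h2
  exact h1.trans (max_le (abs_nonneg _) (h2.trans (max_le (abs_nonneg _) le_rfl)))

lemma norm_clamp_le {L : ℝ} (hL : 0 ≤ L) (y : Fin n → ℝ) : ‖clamp L y‖ ≤ L := by
  refine (pi_norm_le_iff_of_nonneg hL).mpr fun i => ?_
  rw [Real.norm_eq_abs, abs_le]
  exact ⟨le_max_left _ _, max_le (by linarith) (min_le_left _ _)⟩

lemma clamp_zero {L : ℝ} (hL : 0 ≤ L) : clamp L (0 : Fin n → ℝ) = 0 := by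
  funext i; simp [clamp, hL]

lemma clamp_of_norm_le {L : ℝ} {y : Fin n → ℝ} (hy : ‖y‖ ≤ L) : clamp L y = y := by
  funext i
  have := (norm_le_pi_norm y i).trans hy
  rw [Real.norm_eq_abs, abs_le] at this
  simp [clamp, this.1, this.2]

lemma exists_linear_ode {M : ℝ → (Fin n → ℝ) →L[ℝ] (Fin n → ℝ)} (hM : Continuous M)
    (y₀ : Fin n → ℝ) :
    ∃ Y : ℝ → Fin n → ℝ, Y 0 = y₀ ∧
      ∀ τ ∈ Icc (0 : ℝ) 1, HasDerivWithinAt Y (M τ (Y τ)) (Icc 0 1) τ := by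
  obtain ⟨C, hC⟩ := isCompact_Icc.exists_bound_of_continuousOn (hM.continuousOn (s := Icc (0 : ℝ) 1))
  have hC0 : 0 ≤ C := (norm_nonneg _).trans (hC 0 (left_mem_Icc.mpr zero_le_one))
  set L := gronwallBound ‖y₀‖ C 0 1 with hL
  have hL0 : 0 ≤ L := by rw [hL, gronwallBound_ε0]; positivity
  have hb : ∀ τ ∈ Icc (0 : ℝ) 1, ∀ y, ‖M τ (clamp L y)‖ ≤ C * L := fun τ hτ y =>
    ((M τ).le_opNorm _).trans (mul_le_mul (hC τ hτ) (norm_clamp_le hL0 y) (norm_nonneg _) hC0)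
  have hPL : IsPicardLindelof (fun τ y => M τ (clamp L y)) (tmin := 0) (tmax := 1)
      ⟨0, left_mem_Icc.mpr zero_le_one⟩ y₀ (C * L).toNNReal 0 (C * L).toNNReal C.toNNReal := by
    refine ⟨fun τ hτ => LipschitzOnWith.of_dist_le_mul fun y _ z _ => ?_, fun y _ => ?_,
      fun τ hτ y _ => ?_, ?_⟩
    · rw [dist_eq_norm, dist_eq_norm, ← map_sub, Real.coe_toNNReal _ hC0]
      exact ((M τ).le_opNorm _).trans (mul_le_mul (hC τ hτ) (norm_clamp_sub_le _ _ _) (norm_nonneg _) hC0)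
    · exact (hM.clm_apply continuous_const).continuousOn
    · rw [Real.coe_toNNReal _ (mul_nonneg hC0 hL0)]; exact hb τ hτ y
    · simp
  obtain ⟨Y, hY0, hY⟩ := hPL.exists_eq_forall_mem_Icc_hasDerivWithinAt₀
  have hYc : ContinuousOn Y (Icc 0 1) := fun τ hτ => (hY τ hτ).continuousWithinAt
  have hg := norm_le_gronwallBound_of_norm_deriv_right_le (δ := ‖y₀‖) (K := C) (ε := 0) hYc
    (f' := fun τ => M τ (clamp L (Y τ)))
    (fun τ hτ => (hY τ ⟨hτ.1, hτ.2.le⟩).mono_of_mem_nhdsWithin (Icc_mem_nhdsGE_of_mem hτ))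
    (by rw [← hY0]) (fun τ hτ => by
      rw [add_zero]
      refine ((M τ).le_opNorm _).trans (mul_le_mul (hC τ ⟨hτ.1, hτ.2.le⟩) ?_ (norm_nonneg _) hC0)
      have := norm_clamp_sub_le L (Y τ) 0
      rwa [clamp_zero hL0, sub_zero, sub_zero] at this)
  refine ⟨Y, hY0, fun τ hτ => ?_⟩
  have h1 : ‖Y τ‖ ≤ L := by
    refine (hg τ hτ).trans ?_
    rw [hL, gronwallBound_ε0, gronwallBound_ε0]
    have : C * (τ - 0) ≤ C * 1 := mul_le_mul_of_nonneg_left (by linarith [hτ.2]) hC0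
    gcongr
  have := hY τ hτ
  rwa [clamp_of_norm_le h1] at this

lemma exists_linear_ode_backward {M : ℝ → (Fin n → ℝ) →L[ℝ] (Fin n → ℝ)} (hM : Continuous M)
    (y₁ : Fin n → ℝ) :
    ∃ Y : ℝ → Fin n → ℝ, Y 1 = y₁ ∧
      ∀ τ ∈ Icc (0 : ℝ) 1, HasDerivWithinAt Y (M τ (Y τ)) (Icc 0 1) τ := by
  obtain ⟨Y, hY0, hY⟩ := exists_linear_ode (M := fun τ => - M (1 - τ)) (by fun_prop) y₁
  refine ⟨fun τ => Y (1 - τ), by simp [hY0], fun τ hτ => ?_⟩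
  have h1 : HasDerivWithinAt (fun τ : ℝ => 1 - τ) (-1) (Icc 0 1) τ := by
    simpa using ((hasDerivAt_id τ).const_sub 1).hasDerivWithinAt
  have h2 := (hY (1 - τ) ⟨by linarith [hτ.2], by linarith [hτ.1]⟩).scomp τ h1
    (fun r hr => ⟨by linarith [hr.2], by linarith [hr.1]⟩)
  refine h2.congr_deriv ?_
  simp

end LinearODE

/-! ### Taylor expansion with uniform remainder -/

section Taylor

variable {P : Type*} [NormedAddCommGroup P]

lemma eventually_forall_abs_sub_le {f : ℝ × P → ℝ} (hf : Continuous f) {K : Set P} (hK : IsCompact K)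
    {η : ℝ} (hη : 0 < η) :
    ∃ δ > 0, ∀ s, |s| < δ → ∀ p ∈ K, |f (s, p) - f (0, p)| ≤ η := by
  have h : ∀ᶠ s in nhds (0 : ℝ), ∀ p ∈ K, |f (s, p) - f (0, p)| < η := by
    refine hK.eventually_forall_of_forall_eventually fun p _ => ?_
    have hc : Continuous fun q : ℝ × P => |f (q.1, q.2) - f (0, q.2)| := by fun_prop
    refine hc.continuousAt.eventually_lt_const ?_
    simpa using hη
  obtain ⟨δ, hδ, h⟩ := Metric.eventually_nhds_iff.mp h
  exact ⟨δ, hδ, fun s hs p hp => (h (by simpa [Real.dist_eq] using hs) p hp).le⟩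

variable [NormedSpace ℝ P]

lemma abs_le_mul_of_hasDerivAt {f f' : ℝ → ℝ} {C h : ℝ} (hf : ∀ s, |s| ≤ |h| → HasDerivAt f (f' s) s)
    (h0 : f 0 = 0) (hC : ∀ s, |s| ≤ |h| → |f' s| ≤ C) : |f h| ≤ C * |h| := by
  have hs : ∀ s ∈ Icc (-|h|) |h|, |s| ≤ |h| := fun s hs => abs_le.mpr hs
  have := (convex_Icc (-|h|) |h|).norm_image_sub_le_of_norm_hasDerivWithin_le (f := f) (f' := f')
    (C := C) (x := 0) (y := h)
    (fun s hs' => (hf s (hs s hs')).hasDerivWithinAt) (fun s hs' => hC s (hs s hs'))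
    (by simp) (abs_le.mp le_rfl)
  simpa [h0] using this

variable {Φ : ℝ × P → ℝ} {K : Set P}

lemma hasDerivAt_fst {Φ : ℝ × P → ℝ} (hΦ : Differentiable ℝ Φ) (s : ℝ) (p : P) :
    HasDerivAt (fun s => Φ (s, p)) (fderiv ℝ Φ (s, p) (1, 0)) s :=
  (hΦ (s, p)).hasFDerivAt.comp_hasDerivAt s ((hasDerivAt_id s).prodMk (hasDerivAt_const s p))

lemma HasJet.eq_fderiv (hΦ : Differentiable ℝ Φ) {p : P} {a b c : ℝ}
    (hj : HasJet (fun s => Φ (s, p)) a b c) :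
    Φ (0, p) = a ∧ fderiv ℝ Φ (0, p) (1, 0) = b := by
  obtain ⟨f', h1, h2, h3, -⟩ := hj
  exact ⟨h2, by rw [← h3]; exact (hasDerivAt_fst hΦ 0 p).unique h1.self_of_nhds⟩

lemma uniform_first_order (hΦ : ContDiff ℝ 2 Φ) (hK : IsCompact K) {η : ℝ} (hη : 0 < η) :
    ∃ δ > 0, ∀ h, |h| < δ → ∀ p ∈ K, ∀ a b c, HasJet (fun s => Φ (s, p)) a b c →
      |Φ (h, p) - a - h * b| ≤ η * |h| := by
  have hd := hΦ.differentiable two_ne_zero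
  have hc : Continuous fun q : ℝ × P => fderiv ℝ Φ q (1, 0) :=
    (hΦ.continuous_fderiv two_ne_zero).clm_apply continuous_const
  obtain ⟨δ, hδ, H⟩ := eventually_forall_abs_sub_le hc hK hη
  refine ⟨δ, hδ, fun h hh p hp a b c hj => ?_⟩
  obtain ⟨ha, hb⟩ := hj.eq_fderiv hd
  refine abs_le_mul_of_hasDerivAt (f := fun h => Φ (h, p) - a - h * b)
    (fun s _ => ((hasDerivAt_fst hd s p).sub_const _).sub ((hasDerivAt_id s).mul_const (b)))
    (by simp [ha]) fun s hs => ?_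
  rw [one_mul, ← hb]
  exact H s (hs.trans_lt hh) p hp

lemma uniform_second_order (hΦ : ContDiff ℝ 2 Φ) (hK : IsCompact K) {η : ℝ} (hη : 0 < η) :
    ∃ δ > 0, ∀ h, |h| < δ → ∀ p ∈ K, ∀ a b c, HasJet (fun s => Φ (s, p)) a b c →
      |Φ (h, p) + Φ (-h, p) - 2 * a - h ^ 2 * c| ≤ η * h ^ 2 := by
  have hd := hΦ.differentiable two_ne_zero
  have h1 : ContDiff ℝ 1 fun q : ℝ × P => fderiv ℝ Φ q (1, 0) :=
    (hΦ.fderiv_right (m := 1) (by norm_num)).clm_apply contDiff_const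
  have hd1 := h1.differentiable one_ne_zero
  have hc : Continuous fun q : ℝ × P => fderiv ℝ (fun q : ℝ × P => fderiv ℝ Φ q (1, 0)) q (1, 0) :=
    (h1.continuous_fderiv one_ne_zero).clm_apply continuous_const
  obtain ⟨δ, hδ, H⟩ := eventually_forall_abs_sub_le hc hK (half_pos hη)
  refine ⟨δ, hδ, fun h hh p hp a b c hj => ?_⟩
  obtain ⟨ha, -⟩ := hj.eq_fderiv hd
  have hcp : fderiv ℝ (fun q : ℝ × P => fderiv ℝ Φ q (1, 0)) (0, p) (1, 0) = c := by
    obtain ⟨f', e1, -, -, e4⟩ := hj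
    have : (fun s => fderiv ℝ Φ (s, p) (1, 0)) =ᶠ[nhds 0] f' := by
      filter_upwards [e1] with s hs using (hasDerivAt_fst hd s p).unique hs
    exact (hasDerivAt_fst hd1 0 p).unique (e4.congr_of_eventuallyEq this)
  have neg : ∀ {f f' : ℝ → ℝ} (s : ℝ), (∀ s, HasDerivAt f (f' s) s) →
      HasDerivAt (fun s => f (-s)) (-f' (-s)) s := fun s hf => by
    have := HasDerivAt.comp s (hf (-s)) (hasDerivAt_neg s)
    rwa [mul_neg_one] at this
  have D1 : ∀ s, |s| ≤ |h| → |fderiv ℝ Φ (s, p) (1, 0) - fderiv ℝ Φ (-s, p) (1, 0) - 2 * s * c|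
      ≤ η * |s| := by
    intro s hs
    refine abs_le_mul_of_hasDerivAt
      (f := fun s => fderiv ℝ Φ (s, p) (1, 0) - fderiv ℝ Φ (-s, p) (1, 0) - 2 * s * c)
      (fun r _ => ((hasDerivAt_fst hd1 r p).sub (neg r fun r => hasDerivAt_fst hd1 r p)).sub
        (((hasDerivAt_id r).const_mul 2).mul_const (c))) (by simp) fun r hr => ?_
    have hr' : |r| < δ := (hr.trans hs).trans_lt hh
    have A1 := H r hr' p hp
    have A2 := H (-r) (by rwa [abs_neg]) p hp
    rw [hcp] at A1 A2
    rw [abs_le] at A1 A2 ⊢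
    constructor <;> linarith [A1.1, A1.2, A2.1, A2.2]
  have := abs_le_mul_of_hasDerivAt (h := h) (C := η * |h|)
    (f := fun s => Φ (s, p) + Φ (-s, p) - 2 * a - s ^ 2 * c)
    (fun r _ => (((hasDerivAt_fst hd r p).add (neg r fun r => hasDerivAt_fst hd r p)).sub_const _).sub
        (((hasDerivAt_id r).pow 2).mul_const (c))) (by simp [ha]; ring) fun r hr => by
      have e := D1 r hr
      refine le_trans (le_of_eq ?_) (e.trans (mul_le_mul_of_nonneg_left hr hη.le))
      congr 1
      simp only [id, Nat.cast_ofNat]; ring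
  rwa [mul_assoc, ← sq, sq_abs] at this

end Taylor

/-! ### The second variation of energy -/

section Variation

section Algebra

variable {A : Type*} [CommRing A] [Algebra ℝ A] {D : Fin 3 → Derivation ℝ A A}
  {g gi : Fin 3 → Fin 3 → A} {Γ : Fin 3 → Fin 3 → Fin 3 → A} {φ : A →+* ℝ}

lemma map_deriv_metric (H : IsLeviCivita D g gi Γ) (hφ : ∀ a b, φ (g a b) = if a = b then 1 else 0)
    (i a b : Fin 3) : φ (D i (g a b)) = φ (Γ b a i) + φ (Γ a b i) := by
  rw [H.compat, H.torsion b a i, H.torsion a b i]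
  simp [map_sum, hφ]

lemma map_deriv_deriv_metric (H : IsLeviCivita D g gi Γ)
    (hφ : ∀ a b, φ (g a b) = if a = b then 1 else 0) (i a b : Fin 3) :
    φ (D i (D i (g a b))) = φ (D i (Γ b a i)) + φ (D i (Γ a b i))
      + ∑ p, φ (Γ p a i) * (φ (Γ b p i) + φ (Γ p b i))
      + ∑ p, φ (Γ p b i) * (φ (Γ a p i) + φ (Γ p a i)) := by
  rw [H.compat, ← Finset.sum_add_distrib, map_sum, map_sum]
  simp only [map_add, Derivation.leibniz, smul_eq_mul, map_mul, map_deriv_metric H hφ, hφ,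
    H.torsion _ i]
  simp [Finset.sum_add_distrib, mul_add]
  ring

lemma second_variation_algebra (H : IsLeviCivita D g gi Γ)
    (hφ : ∀ a b, φ (g a b) = if a = b then 1 else 0) (i : Fin 3) (θ : Fin 3 → ℝ) :
    ∑ a, ∑ b, θ a * θ b * φ (D i (D i (g a b)) - ∑ c, Γ c i i * D c (g a b))
      = 2 * ∑ a, ∑ b, θ a * θ b * φ (algRm D Γ a i b i)
        + 2 * ∑ a, θ a * ∑ b, θ b * φ (D b (Γ a i i))
        + 2 * ∑ a, (∑ b, φ (Γ a b i) * θ b) ^ 2 := by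
  simp only [algRm, map_sub, map_add, map_mul, map_deriv_deriv_metric H hφ,
    map_deriv_metric H hφ, H.torsion _ i, Fin.sum_univ_three]
  have t10 : ∀ c, Γ c 1 0 = Γ c 0 1 := fun c => H.torsion c 1 0
  have t20 : ∀ c, Γ c 2 0 = Γ c 0 2 := fun c => H.torsion c 2 0
  have t21 : ∀ c, Γ c 2 1 = Γ c 1 2 := fun c => H.torsion c 2 1
  simp only [t10, t20, t21]
  ring

lemma map_algRm_contract (H : IsLeviCivita D g gi Γ)
    (hφ : ∀ a b, φ (g a b) = if a = b then 1 else 0) (a b : Fin 3) :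
    ∑ i, φ (algRm D Γ a i b i) = - φ (algRic D Γ b a) := by
  rw [algRic, map_sum, ← Finset.sum_neg_distrib]
  refine Finset.sum_congr rfl fun i _ => ?_
  have := congrArg φ (riem_lower_swap H i b i a)
  simpa [map_sum, hφ] using this

end Algebra

variable {T : ℝ} {g : (Fin 3 → ℝ) → ℝ → Matrix (Fin 3) (Fin 3) ℝ} {E : Matrix (Fin 3) (Fin 3) ℝ}

/-- The data of a second-order variation: the first three entries describe the position, the last
three the velocity. -/
abbrev VarData := ((Fin 3 → ℝ) × (Fin 3 → ℝ) × (Fin 3 → ℝ)) × (Fin 3 → ℝ) × (Fin 3 → ℝ) × (Fin 3 → ℝ)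

/-- The energy density of a variation. -/
def varEnergy (G : (Fin 3 → ℝ) → Matrix (Fin 3) (Fin 3) ℝ) (q : ℝ × VarData) : ℝ :=
  1 / 2 * qf (G (fun k => q.2.1.1 k + q.1 * q.2.1.2.1 k + q.1 ^ 2 / 2 * q.2.1.2.2 k))
    (fun k => q.2.2.1 k + q.1 * q.2.2.2.1 k + q.1 ^ 2 / 2 * q.2.2.2.2 k)

/-- The covariant correction of the velocity of a parallel field. -/
def parDeriv (Γ : Fin 3 → Fin 3 → Fin 3 → ℝ) (v e : Fin 3 → ℝ) : Fin 3 → ℝ :=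
  fun k => ∑ i, ∑ j, Γ k i j * v i * e j

/-- The variation through `s • e`, where `e` is parallel along a curve with velocity `v`. -/
def varData (x v e : Fin 3 → ℝ) (Γ : Fin 3 → Fin 3 → Fin 3 → ℝ)
    (dΓ : Fin 3 → Fin 3 → Fin 3 → Fin 3 → ℝ) (s s' : ℝ) : VarData :=
  ((x, fun k => s * e k, fun k => -(s ^ 2 * parDeriv Γ e e k)),
    v, fun k => s' * e k - s * parDeriv Γ v e k,
    fun k => -(s ^ 2 * ∑ l, v l * parDeriv (dΓ l) e e k
      + 2 * s * parDeriv Γ (fun k => s' * e k - s * parDeriv Γ v e k) e k))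

/-- The Christoffel symbols and their derivatives at a point. -/
def slabΓAt (hT : 0 < T) (hg : SmoothMetricFamily g (Icc 0 T)) (p : (Fin 3 → ℝ) × ℝ)
    (k i j : Fin 3) : ℝ := slabEval T p (slabΓ hT hg k i j)

/-- The derivatives of the Christoffel symbols at a point. -/
def slabdΓAt (hT : 0 < T) (hg : SmoothMetricFamily g (Icc 0 T)) (p : (Fin 3 → ℝ) × ℝ)
    (l k i j : Fin 3) : ℝ := slabEval T p (slabDx hT l (slabΓ hT hg k i j))

lemma HasJet.comp_mul_left {f : ℝ → ℝ} {a b c : ℝ} (h : HasJet f a b c) (s : ℝ) :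
    HasJet (fun h => f (s * h)) a (s * b) (s ^ 2 * c) := by
  obtain ⟨f', d, rfl, rfl, e⟩ := h
  have hs : ∀ h : ℝ, HasDerivAt (fun h => s * h) s h := fun h => by
    simpa using (hasDerivAt_id h).const_mul s
  have hc : Filter.Tendsto (fun h => s * h) (nhds 0) (nhds 0) := by
    simpa using (hs 0).continuousAt.tendsto
  refine ⟨fun h => f' (s * h) * s, ?_, by simp, by simp [mul_comm], ?_⟩
  · filter_upwards [hc.eventually d] with h hh
    exact HasDerivAt.comp h hh (hs h)
  · have e' : HasDerivAt f' c (s * 0) := by rwa [mul_zero]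
    refine ((HasDerivAt.comp 0 e' (hs 0)).mul_const s).congr_deriv (by ring)

lemma second_variation_collect (i : Fin 3) (θ : Fin 3 → ℝ) (γ : Fin 3 → Fin 3 → Fin 3 → ℝ)
    (L R d : Fin 3 → Fin 3 → ℝ) (s s' : ℝ)
    (hL : ∑ a, ∑ b, θ a * θ b * L a b = 2 * ∑ a, ∑ b, θ a * θ b * R a b
      + 2 * ∑ a, θ a * ∑ b, θ b * d a b + 2 * ∑ a, (∑ b, γ a b i * θ b) ^ 2) :
    1 / 2 * ∑ a, ∑ b,
      ((-(s ^ 2 * ∑ c, θ c * d a c + 2 * s * ∑ c, γ a c i *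
          (s' * (if c = i then 1 else 0) - s * ∑ e, γ c e i * θ e)) * θ b
        + 2 * (s' * (if a = i then 1 else 0) - s * ∑ e, γ a e i * θ e)
          * (s' * (if b = i then 1 else 0) - s * ∑ e, γ b e i * θ e)
        + θ a * -(s ^ 2 * ∑ c, θ c * d b c + 2 * s * ∑ c, γ b c i *
          (s' * (if c = i then 1 else 0) - s * ∑ e, γ c e i * θ e))) * (if a = b then 1 else 0)
      + 2 * ((s' * (if a = i then 1 else 0) - s * ∑ e, γ a e i * θ e) * θ b
          + θ a * (s' * (if b = i then 1 else 0) - s * ∑ e, γ b e i * θ e))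
        * (s * (γ b a i + γ a b i)) + θ a * θ b * (s ^ 2 * L a b))
      = s' ^ 2 + s ^ 2 * ∑ a, ∑ b, θ a * θ b * R a b := by
  fin_cases i <;> simp [Fin.sum_univ_three] at hL ⊢ <;> linear_combination s ^ 2 / 2 * hL

theorem hasJet_varEnergy (hT : 0 < T) (hg : SmoothMetricFamily g (Icc 0 T)) {t : ℝ}
    (ht : t ∈ Icc 0 T) (x v : Fin 3 → ℝ) (hE : Eᵀ * g x t * E = 1) :
    ∃ Q : Fin 3 → ℝ, ∑ i, Q i = - quad (slabRic hT hg) (x, t) v ∧ ∀ i s s',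
      HasJet (fun h => varEnergy (fun y => g y t) (h, varData x v (fun k => E k i)
        (slabΓAt hT hg (x, t)) (slabdΓAt hT hg (x, t)) s s'))
        (1 / 2 * qf (g x t) v) (s' * ∑ j, ∑ k, g x t j k * v j * E k i) (s' ^ 2 + s ^ 2 * Q i) := by
  set F := Eᵀ * g x t with hF
  have hEF : E * F = 1 := mul_eq_one_comm.mp hE
  have hC := constFrame_isConstFrame (T := T) hT hE
  have H := (slab_isLeviCivita hT hg).frame hC
  set D' := frameD (constFrame T E) (slabDx hT) with hD'
  set Γ' := frameΓ (constFrame T E) (constFrame T F) (slabΓ hT hg) with hΓ'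
  set g' := frameS (constFrame T E) (slabG hg) with hg'
  set φ := slabEval T (x, t) with hφdef
  have hφ : ∀ a b, φ (g' a b) = if a = b then 1 else 0 := fun a b => by
    rw [hg', slabEval_frameS]
    simp only [slabG_apply hg _ _ ht]
    rw [← Matrix.one_apply, ← hE]
    simp only [Matrix.mul_apply, hF, Matrix.transpose_apply, Fin.sum_univ_three]; ring
  have hexp : ∀ w : Fin 3 → ℝ, ∀ k, w k = ∑ a, E k a * ∑ p, F a p * w p := fun w k => by
    have : w = (E * F) *ᵥ w := by rw [hEF, Matrix.one_mulVec]
    conv_lhs => rw [this, ← Matrix.mulVec_mulVec]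
    rfl
  set θ : Fin 3 → ℝ := fun a => ∑ p, F a p * v p with hθ
  have hv : ∀ k, v k = ∑ a, E k a * θ a := hexp v
  have hFE : ∀ a b, ∑ p, F a p * E p b = if a = b then 1 else 0 := fun a b => by
    rw [← Matrix.one_apply, ← hE, Matrix.mul_apply]
  have hΓ'φ : ∀ a b i, φ (Γ' a b i)
      = ∑ j, E j b * ∑ p, ∑ q, F a p * slabΓAt hT hg (x, t) p j q * E q i := fun a b i => by
    simp only [hΓ', frameΓ, map_sum, map_mul, hφdef, constFrame_apply, slabΓAt]
  have hdΓ' : ∀ l a b i, φ (D' l (Γ' a b i)) = ∑ m, E m l *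
      ∑ j, E j b * ∑ p, ∑ q, F a p * slabdΓAt hT hg (x, t) m p j q * E q i := fun l a b i => by
    simp only [hΓ', hD', frameΓ, frameD_apply, map_sum, map_mul, hφdef, constFrame_apply, slabdΓAt,
      Derivation.leibniz, hC.const_e, hC.const_f, smul_eq_mul, map_add, map_zero, mul_zero]
    simp only [Fin.sum_univ_three]; ring
  refine ⟨fun i => ∑ a, ∑ b, θ a * θ b * φ (algRm D' Γ' a i b i), ?_, fun i s s' => ?_⟩
  · have h1 : ∑ i, ∑ a, ∑ b, θ a * θ b * φ (algRm D' Γ' a i b i)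
        = ∑ a, ∑ b, θ a * θ b * ∑ i, φ (algRm D' Γ' a i b i) := by
      simp only [Fin.sum_univ_three]; ring
    simp only [h1, map_algRm_contract H hφ]
    simp only [hD', hΓ', frame_algRic hC, hφdef, slabEval_frameS, quad, hv, slabRic,
      Fin.sum_univ_three]
    ring
  set w : Fin 3 → ℝ := fun k => s' * E k i - s * parDeriv (slabΓAt hT hg (x, t)) v (fun k => E k i) k
    with hw
  set u : Fin 3 → ℝ := fun k => -(s ^ 2 * ∑ l, v l * parDeriv (slabdΓAt hT hg (x, t) l)
      (fun k => E k i) (fun k => E k i) k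
      + 2 * s * parDeriv (slabΓAt hT hg (x, t)) w (fun k => E k i) k) with hu
  have hw1 : ∀ a, ∑ p, F a p * w p = s' * (if a = i then 1 else 0) - s * ∑ b, φ (Γ' a b i) * θ b := by
    intro a
    rw [← hFE]
    simp only [hw, hΓ'φ, parDeriv, hv, Fin.sum_univ_three]; ring
  have hu1 : ∀ a, ∑ p, F a p * u p = -(s ^ 2 * ∑ b, θ b * φ (D' b (Γ' a i i))
      + 2 * s * ∑ b, φ (Γ' a b i) * ∑ p, F b p * w p) := by
    intro a
    have e1 : ∑ p, F a p * ∑ l, v l * parDeriv (slabdΓAt hT hg (x, t) l)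
        (fun k => E k i) (fun k => E k i) p = ∑ b, θ b * φ (D' b (Γ' a i i)) := by
      simp only [hdΓ', parDeriv, hv, Fin.sum_univ_three]; ring
    have e2 : ∑ p, F a p * parDeriv (slabΓAt hT hg (x, t)) w (fun k => E k i) p
        = ∑ b, φ (Γ' a b i) * (fun b => ∑ p, F b p * w p) b := by
      have hwk : ∀ k, w k = ∑ a, E k a * (fun b => ∑ p, F b p * w p) a := hexp w
      generalize (fun b => ∑ p, F b p * w p) = W at hwk ⊢
      simp only [parDeriv, hΓ'φ, hwk, Fin.sum_univ_three]; ring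
    rw [← e1, ← e2]
    simp only [hu, Fin.sum_univ_three]; ring
  have hq : ∀ y (ω : Fin 3 → ℝ), qf (g y t) (fun k => ∑ a, E k a * ω a)
      = ∑ a, ∑ b, ω a * ω b * ((g' a b : slabAlg T) : (Fin 3 → ℝ) × ℝ → ℝ) (y, t) := by
    intro y ω
    simp only [← slabEval_apply (y, t)]
    simp only [hg', slabEval_frameS, qf, slabG_apply hg _ _ ht, Fin.sum_univ_three]
    ring
  have key := (HasJet.sum fun a => HasJet.sum fun b =>
    ((hasJet_poly (θ a) (∑ p, F a p * w p) (∑ p, F a p * u p)).mul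
     (hasJet_poly (θ b) (∑ p, F b p * w p) (∑ p, F b p * u p))).mul
     ((hasJet_geoCurve hT hg hE (g' a b) ht x i).comp_mul_left s)).const_mul (1 / 2)
  have hfun : (fun h => varEnergy (fun y => g y t) (h, varData x v (fun k => E k i)
        (slabΓAt hT hg (x, t)) (slabdΓAt hT hg (x, t)) s s')) = fun h => 1 / 2 * ∑ a, ∑ b,
        (θ a + h * (∑ p, F a p * w p) + h ^ 2 / 2 * (∑ p, F a p * u p)) *
        (θ b + h * (∑ p, F b p * w p) + h ^ 2 / 2 * (∑ p, F b p * u p)) *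
        ((g' a b : slabAlg T) : (Fin 3 → ℝ) × ℝ → ℝ)
          (geoCurve (fun y => g y t) x (fun k => E k i) (s * h), t) := by
    funext h
    have e1 : (fun k => v k + h * w k + h ^ 2 / 2 * u k)
        = fun k => ∑ a, E k a * (θ a + h * (∑ p, F a p * w p) + h ^ 2 / 2 * (∑ p, F a p * u p)) := by
      funext k
      simp only [mul_add, Finset.sum_add_distrib, ← hv]
      rw [hexp w k, hexp u k, Finset.mul_sum, Finset.mul_sum]
      congr 1
      · congr 1
        exact Finset.sum_congr rfl fun a _ => by ring
      · exact Finset.sum_congr rfl fun a _ => by ring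
    have e2 : (fun k => x k + h * (s * E k i)
          + h ^ 2 / 2 * -(s ^ 2 * parDeriv (slabΓAt hT hg (x, t)) (fun k => E k i) (fun k => E k i) k))
        = geoCurve (fun y => g y t) x (fun k => E k i) (s * h) := by
      funext k
      simp only [geoCurve, parDeriv, slabΓAt, slabEval_apply, slabΓ_apply hT hg _ _ _ ht]
      ring
    show 1 / 2 * qf (g (fun k => x k + h * (s * E k i)
          + h ^ 2 / 2 * -(s ^ 2 * parDeriv (slabΓAt hT hg (x, t)) (fun k => E k i) (fun k => E k i) k)) t)
      (fun k => v k + h * w k + h ^ 2 / 2 * u k) = _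
    rw [e1, e2, hq]
  rw [hfun]
  have sva := second_variation_algebra H hφ i θ
  have h1 := map_deriv_metric H hφ i
  have hs : ∀ c a b, φ (Γ' c a b) = φ (Γ' c b a) := fun c a b => by rw [H.torsion]
  have hθ1 : ∑ j, ∑ k, g x t j k * v j * E k i = θ i := by
    have hsym : ∀ j k, g x t j k = g x t k j := fun j k => ((hg.2 x t ht).1.apply j k).symm
    simp only [hθ, hF, Matrix.mul_apply, Matrix.transpose_apply, Fin.sum_univ_three, hsym 1 0,
      hsym 2 0, hsym 2 1]
    ring
  rw [hθ1]
  refine key.congr ?_ ?_ ?_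
  · conv_rhs => rw [show v = fun k => ∑ a, E k a * θ a from funext hv, hq]
    rfl
  · simp only [hw1]
    change _ * (∑ a, ∑ b, ((_ * φ (g' a b)) + _ * (s * φ (D' i (g' a b))))) = _
    simp only [hφ, h1]
    fin_cases i <;> simp [Fin.sum_univ_three] <;> ring
  · simp only [hu1]
    simp only [hw1]
    change _ * (∑ a, ∑ b, (_ * φ (g' a b) + 2 * _ * (s * φ (D' i (g' a b))) +
      _ * (s ^ 2 * φ (D' i (D' i (g' a b)) - ∑ c, Γ' c i i * D' c (g' a b))))) = _
    simp only [hφ, h1]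
    exact second_variation_collect i θ (fun a b c => φ (Γ' a b c)) _ _ _ s s' sva

end Variation

/-! ### Uniform expansions over compact sets -/

section Bundle

section Compact

variable {X : Type*} [TopologicalSpace X] {M : X → Matrix (Fin n) (Fin n) ℝ} {K : Set X}

lemma continuous_qf (hM : ∀ i j, Continuous fun x => M x i j) :
    Continuous fun p : X × (Fin n → ℝ) => qf (M p.1) p.2 := by
  unfold qf
  have : ∀ i j, Continuous fun p : X × (Fin n → ℝ) => M p.1 i j := fun i j =>
    (hM i j).comp continuous_fst
  fun_prop (disch := assumption)

lemma exists_mul_sq_norm_le_qf (hK : IsCompact K) (hM : ∀ i j, Continuous fun x => M x i j)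
    (hpos : ∀ x ∈ K, (M x).PosDef) :
    ∃ m > 0, ∀ x ∈ K, ∀ v, m * ‖v‖ ^ 2 ≤ qf (M x) v := by
  have hS : IsCompact (K ×ˢ Metric.sphere (0 : Fin n → ℝ) 1) := hK.prod (isCompact_sphere 0 1)
  have key : ∀ m : ℝ, (∀ p ∈ K ×ˢ Metric.sphere (0 : Fin n → ℝ) 1, m ≤ qf (M p.1) p.2) →
      ∀ x ∈ K, ∀ v, m * ‖v‖ ^ 2 ≤ qf (M x) v := by
    intro m hm x hx v
    rcases eq_or_ne v 0 with rfl | hv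
    · simp [qf]
    have hn := norm_pos_iff.mpr hv
    have h := hm (x, ‖v‖⁻¹ • v) ⟨hx, by simp [norm_smul, hn.ne']⟩
    rw [qf_smul, inv_pow, ← div_eq_inv_mul, le_div_iff₀ (by positivity)] at h
    exact h
  rcases (K ×ˢ Metric.sphere (0 : Fin n → ℝ) 1).eq_empty_or_nonempty with he | hne
  · exact ⟨1, one_pos, key 1 (by simp [he])⟩
  · obtain ⟨p, hp, hmin⟩ := hS.exists_isMinOn hne (continuous_qf hM).continuousOn
    refine ⟨qf (M p.1) p.2, qf_pos (hpos _ hp.1) ?_, key _ fun q hq => hmin hq⟩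
    rintro h0
    have := hp.2
    simp [h0] at this

lemma isCompact_qf_le (hK : IsCompact K) (hM : ∀ i j, Continuous fun x => M x i j)
    (hpos : ∀ x ∈ K, (M x).PosDef) (L : ℝ) :
    IsCompact {p : X × (Fin n → ℝ) | p.1 ∈ K ∧ qf (M p.1) p.2 ≤ L} := by
  obtain ⟨m, hm, H⟩ := exists_mul_sq_norm_le_qf hK hM hpos
  have hB : IsCompact (K ×ˢ Metric.closedBall (0 : Fin n → ℝ) (√(L / m))) :=
    hK.prod (isCompact_closedBall _ _)
  have : {p : X × (Fin n → ℝ) | p.1 ∈ K ∧ qf (M p.1) p.2 ≤ L}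
      = (K ×ˢ Metric.closedBall (0 : Fin n → ℝ) (√(L / m))) ∩ {p | qf (M p.1) p.2 ≤ L} := by
    ext p
    refine ⟨fun h => ⟨⟨h.1, ?_⟩, h.2⟩, fun h => ⟨h.1.1, h.2⟩⟩
    rw [mem_closedBall_zero_iff]
    refine Real.le_sqrt_of_sq_le ?_
    rw [le_div_iff₀ hm, mul_comm]
    exact (H _ h.1 _).trans h.2
  rw [this]
  exact hB.inter_right (isClosed_le (continuous_qf hM) continuous_const)

end Compact

variable {T : ℝ} {g : (Fin 3 → ℝ) → ℝ → Matrix (Fin 3) (Fin 3) ℝ} {t : ℝ}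

lemma SmoothMetricFamily.contDiff_space (hg : SmoothMetricFamily g (Icc 0 T)) (ht : t ∈ Icc 0 T)
    (i j : Fin 3) : ContDiff ℝ (⊤ : ℕ∞) fun x => g x t i j :=
  (hg.1 i j).comp_contDiff (contDiff_id.prodMk contDiff_const) fun _ => ⟨mem_univ _, ht⟩

lemma SmoothMetricFamily.continuous_space (hg : SmoothMetricFamily g (Icc 0 T)) (ht : t ∈ Icc 0 T)
    (i j : Fin 3) : Continuous fun x => g x t i j := (hg.contDiff_space ht i j).continuous

lemma continuous_slab_space (f : slabAlg T) (ht : t ∈ Icc 0 T) :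
    Continuous fun x : Fin 3 → ℝ => (f : (Fin 3 → ℝ) × ℝ → ℝ) (x, t) :=
  ((slabAlg_contDiffOn f).comp_contDiff (contDiff_id.prodMk contDiff_const)
    fun _ => mem_slab.2 ht).continuous

lemma contDiff_varEnergy {G : (Fin 3 → ℝ) → Matrix (Fin 3) (Fin 3) ℝ} {m : WithTop ℕ∞}
    (hG : ∀ i j, ContDiff ℝ m fun x => G x i j) : ContDiff ℝ m (varEnergy G) := by
  unfold varEnergy qf
  have hx : ContDiff ℝ m fun q : ℝ × VarData =>
      (fun k => q.2.1.1 k + q.1 * q.2.1.2.1 k + q.1 ^ 2 / 2 * q.2.1.2.2 k : Fin 3 → ℝ) := by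
    rw [contDiff_pi]; intro k; fun_prop
  have hv : ∀ k, ContDiff ℝ m fun q : ℝ × VarData =>
      (q.2.2.1 k + q.1 * q.2.2.2.1 k + q.1 ^ 2 / 2 * q.2.2.2.2 k) := by intro k; fun_prop
  exact contDiff_const.mul (ContDiff.sum fun i _ => ContDiff.sum fun j _ =>
    (((hG i j).comp hx).mul (hv i)).mul (hv j))

lemma continuous_varData {X : Type*} [TopologicalSpace X] {x v e : X → Fin 3 → ℝ}
    {Γ : X → Fin 3 → Fin 3 → Fin 3 → ℝ} {dΓ : X → Fin 3 → Fin 3 → Fin 3 → Fin 3 → ℝ} {s s' : X → ℝ}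
    (hx : Continuous x) (hv : Continuous v) (he : Continuous e)
    (hΓ : ∀ k i j, Continuous fun p => Γ p k i j) (hdΓ : ∀ l k i j, Continuous fun p => dΓ p l k i j)
    (hs : Continuous s) (hs' : Continuous s') :
    Continuous fun p => varData (x p) (v p) (e p) (Γ p) (dΓ p) (s p) (s' p) := by
  unfold varData parDeriv
  fun_prop (disch := assumption)

/-- Uniform second-order expansion of the energy density of the variations. -/
lemma uniform_varEnergy (hT : 0 < T) (hg : SmoothMetricFamily g (Icc 0 T)) (ht : t ∈ Icc 0 T)
    {K : Set (Fin 3 → ℝ)} (hK : IsCompact K) (L S : ℝ) {η : ℝ} (hη : 0 < η) :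
    ∃ δ > 0, ∀ h, |h| < δ → ∀ x ∈ K, ∀ v, qf (g x t) v ≤ L → ∀ E : Matrix (Fin 3) (Fin 3) ℝ,
      Eᵀ * g x t * E = 1 → ∀ s ∈ Icc 0 S, ∀ s' ∈ Icc 0 S,
      (∑ i, (varEnergy (fun y => g y t) (h, varData x v (fun k => E k i)
          (slabΓAt hT hg (x, t)) (slabdΓAt hT hg (x, t)) s s')
        + varEnergy (fun y => g y t) (-h, varData x v (fun k => E k i)
          (slabΓAt hT hg (x, t)) (slabdΓAt hT hg (x, t)) s s') - qf (g x t) v)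
        ≤ h ^ 2 * (3 * s' ^ 2 - s ^ 2 * quad (slabRic hT hg) (x, t) v + η)) ∧
      ∀ i, varEnergy (fun y => g y t) (h, varData x v (fun k => E k i)
          (slabΓAt hT hg (x, t)) (slabdΓAt hT hg (x, t)) s s')
        ≤ 1 / 2 * qf (g x t) v + h * (s' * ∑ j, ∑ k, g x t j k * v j * E k i) + η * |h| := by
  set G := fun y => g y t with hG
  have hGc := hg.continuous_space ht
  have hGp : ∀ x, (G x).PosDef := fun x => (hg.2 x t ht).2
  let P := {p : (Fin 3 → ℝ) × (Fin 3 → ℝ) | p.1 ∈ K ∧ qf (G p.1) p.2 ≤ L}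
  have hP : IsCompact P := isCompact_qf_le hK hGc (fun x _ => hGp x) L
  let P' := {p : ((Fin 3 → ℝ) × (Fin 3 → ℝ)) × (Fin 3 → ℝ) | p.1 ∈ P ∧ qf (G p.1.1) p.2 ≤ 1}
  have hP' : IsCompact P' := isCompact_qf_le (M := fun p : (Fin 3 → ℝ) × (Fin 3 → ℝ) => G p.1) hP
    (fun i j => (hGc i j).comp continuous_fst) (fun p _ => hGp p.1) 1
  let F : (((Fin 3 → ℝ) × (Fin 3 → ℝ)) × (Fin 3 → ℝ)) × ℝ × ℝ → VarData := fun p =>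
    varData p.1.1.1 p.1.1.2 p.1.2 (slabΓAt hT hg (p.1.1.1, t)) (slabdΓAt hT hg (p.1.1.1, t)) p.2.1 p.2.2
  have hF : Continuous F := continuous_varData (by fun_prop) (by fun_prop) (by fun_prop)
    (fun k i j => (continuous_slab_space (slabΓ hT hg k i j) ht).comp (by fun_prop))
    (fun l k i j => (continuous_slab_space (slabDx hT l (slabΓ hT hg k i j)) ht).comp (by fun_prop))
    (by fun_prop) (by fun_prop)
  have hc := (hP'.prod ((isCompact_Icc (a := (0 : ℝ)) (b := S)).prod
    (isCompact_Icc (a := (0 : ℝ)) (b := S)))).image hF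
  have hΦ : ContDiff ℝ 2 (varEnergy G) := (contDiff_varEnergy (hg.contDiff_space ht)).of_le
    (WithTop.coe_le_coe.2 (le_top : (2 : ℕ∞) ≤ ⊤))
  obtain ⟨δ₁, hδ₁, H₁⟩ := uniform_first_order hΦ hc hη
  obtain ⟨δ₂, hδ₂, H₂⟩ := uniform_second_order hΦ hc (show 0 < η / 3 by positivity)
  refine ⟨min δ₁ δ₂, lt_min hδ₁ hδ₂, fun h hh x hx v hv E hE s hs s' hs' => ?_⟩
  obtain ⟨Q, hQ, hj⟩ := hasJet_varEnergy hT hg ht x v hE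
  have hmem : ∀ i, varData x v (fun k => E k i) (slabΓAt hT hg (x, t)) (slabdΓAt hT hg (x, t)) s s'
      ∈ F '' (P' ×ˢ Icc (0 : ℝ) S ×ˢ Icc (0 : ℝ) S) := fun i => by
    refine ⟨(((x, v), fun k => E k i), s, s'), ⟨⟨⟨hx, hv⟩, ?_⟩, hs, hs'⟩, rfl⟩
    have := congrFun (congrFun hE i) i
    rw [Matrix.one_apply_eq] at this
    refine le_of_eq ?_
    rw [← this]
    simp only [qf, hG, Matrix.mul_apply, Matrix.transpose_apply, Fin.sum_univ_three]; ring
  constructor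
  · have e : ∀ i, _ := fun i => (abs_le.mp (H₂ h (hh.trans_le (min_le_right _ _)) _ (hmem i) _ _ _
      (hj i s s'))).2
    rw [Fin.sum_univ_three] at hQ ⊢
    have e0 := e 0; have e1 := e 1; have e2 := e 2
    linear_combination e0 + e1 + e2 + h ^ 2 * s ^ 2 * hQ
  · intro i
    have := (abs_le.mp (H₁ h (hh.trans_le (min_le_left _ _)) _ (hmem i) _ _ _ (hj i s s'))).2
    linarith

/-- Backward first-order expansion of the metric in time. -/
lemma uniform_metric_backward (hT : 0 < T) (hg : SmoothMetricFamily g (Icc 0 T))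
    (hf : IsRicciFlow g (Icc 0 T)) (ht : t ∈ Icc 0 T)
    {K : Set (Fin 3 → ℝ)} (hK : IsCompact K) (L : ℝ) {η : ℝ} (hη : 0 < η) :
    ∃ δ > 0, ∀ σ, 0 ≤ σ → σ < δ → σ ≤ t → ∀ x ∈ K, ∀ v, qf (g x t) v ≤ L →
      1 / 2 * qf (g x (t - σ)) v
        ≤ 1 / 2 * qf (g x t) v + σ * quad (slabRic hT hg) (x, t) v + η * σ := by
  have hP := isCompact_qf_le (M := fun y => g y t) hK (hg.continuous_space ht)
    (fun x _ => (hg.2 x t ht).2) L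
  let f : ℝ × ((Fin 3 → ℝ) × (Fin 3 → ℝ)) → ℝ := fun q =>
    quad (slabRic hT hg) (q.2.1, projIcc 0 T hT.le (t - q.1)) q.2.2
  have hfc : Continuous f := by
    have : ∀ i j, Continuous fun q : ℝ × ((Fin 3 → ℝ) × (Fin 3 → ℝ)) =>
        (slabRic hT hg i j : (Fin 3 → ℝ) × ℝ → ℝ) (q.2.1, projIcc 0 T hT.le (t - q.1)) := fun i j => by
      refine (slabAlg_contDiffOn (slabRic hT hg i j)).continuousOn.comp_continuous ?_ ?_
      · exact continuous_snd.fst.prodMk (continuous_subtype_val.comp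
          (continuous_projIcc.comp (by fun_prop)))
      · intro q; exact mem_slab.2 (projIcc 0 T hT.le (t - q.1)).2
    simp only [f, quad]
    fun_prop (disch := assumption)
  obtain ⟨δ, hδ, H⟩ := eventually_forall_abs_sub_le hfc hP hη
  refine ⟨δ, hδ, fun σ hσ hσδ hσt x hx v hv => ?_⟩
  have hd : ∀ r ∈ Icc 0 T, HasDerivWithinAt (fun r => 1 / 2 * qf (g x r) v)
      (- quad (slabRic hT hg) (x, r) v) (Icc 0 T) r := by
    intro r hr
    have h1 : ∀ i j, HasDerivWithinAt (fun r => g x r i j)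
        (-2 * (slabRic hT hg i j : (Fin 3 → ℝ) × ℝ → ℝ) (x, r)) (Icc 0 T) r := fun i j => by
      rw [slabRic_apply hT hg _ _ hr, ← hf x r hr i j]
      refine DifferentiableWithinAt.hasDerivWithinAt ?_
      refine ((hg.1 i j).differentiableOn (by simp) (x, r) ⟨mem_univ _, hr⟩).comp r
        (f := fun r : ℝ => (x, r)) (by fun_prop) (fun _ h => ⟨mem_univ _, h⟩)
    have := (HasDerivWithinAt.fun_sum fun i (_ : i ∈ Finset.univ) => HasDerivWithinAt.fun_sum
      fun j (_ : j ∈ Finset.univ) => ((h1 i j).mul_const (v i)).mul_const (v j)).const_mul (1 / 2)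
    refine this.congr_deriv ?_
    simp only [quad, Fin.sum_univ_three]; ring
  have hsub : ∀ r ∈ Icc (t - σ) t, r ∈ Icc 0 T := fun r hr => ⟨by linarith [hr.1], hr.2.trans ht.2⟩
  have hb : ∀ r ∈ Icc (t - σ) t,
      |- quad (slabRic hT hg) (x, r) v + quad (slabRic hT hg) (x, t) v| ≤ η := by
    intro r hr
    have := H (t - r) (by rw [abs_lt]; constructor <;> linarith [hr.1, hr.2]) (x, v) ⟨hx, hv⟩
    simp only [f, sub_sub_cancel, sub_zero, projIcc_of_mem hT.le (hsub r hr),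
      projIcc_of_mem hT.le ht] at this
    rw [abs_sub_comm] at this
    rwa [neg_add_eq_sub]
  have := (convex_Icc (t - σ) t).norm_image_sub_le_of_norm_hasDerivWithin_le
    (f := fun r => 1 / 2 * qf (g x r) v + r * quad (slabRic hT hg) (x, t) v)
    (C := η) (x := t) (y := t - σ)
    (fun r hr => ((hd r (hsub r hr)).mono hsub).add ((hasDerivWithinAt_id r _).mul_const _))
    (fun r hr => by simpa using hb r hr) ⟨by linarith, le_rfl⟩ ⟨le_rfl, by linarith⟩
  simp only [Real.norm_eq_abs, sub_sub_cancel_left, abs_neg, abs_of_nonneg hσ] at this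
  have := (abs_le.mp this).2
  linarith

end Bundle

/-! ### Parallel frames and variations along a curve -/

section Parallel

variable {T : ℝ} {g : (Fin 3 → ℝ) → ℝ → Matrix (Fin 3) (Fin 3) ℝ} {t : ℝ} {γ V : ℝ → Fin 3 → ℝ}

lemma continuous_matrix_toCLM {m : ℝ → Fin n → Fin n → ℝ} (hm : ∀ i j, Continuous fun τ => m τ i j) :
    ∃ M : ℝ → (Fin n → ℝ) →L[ℝ] (Fin n → ℝ), Continuous M ∧ ∀ τ y i, M τ y i = ∑ j, m τ i j * y j := by
  refine ⟨fun τ => LinearMap.toContinuousLinearMap (Matrix.toLin' (Matrix.of (m τ))), ?_, ?_⟩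
  · have h1 : Continuous fun τ => Matrix.of (m τ) :=
      continuous_matrix fun i j => hm i j
    exact (LinearMap.continuous_of_finiteDimensional
      (LinearMap.toContinuousLinearMap.toLinearMap ∘ₗ Matrix.toLin'.toLinearMap :
        Matrix (Fin n) (Fin n) ℝ →ₗ[ℝ] (Fin n → ℝ) →L[ℝ] (Fin n → ℝ))).comp h1
  · intro τ y i
    simp [Matrix.mulVec, dotProduct]

lemma exists_parallel_frame (hT : 0 < T) (hg : SmoothMetricFamily g (Icc 0 T)) (ht : t ∈ Icc 0 T)
    (hγ : ∀ τ, HasDerivAt γ (V τ) τ) (hV : Continuous V) {E : Matrix (Fin 3) (Fin 3) ℝ}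
    (hE : Eᵀ * g (γ 1) t * E = 1) :
    ∃ Y : ℝ → Matrix (Fin 3) (Fin 3) ℝ, Y 1 = E ∧
      (∀ τ ∈ Icc (0 : ℝ) 1, ∀ i, HasDerivWithinAt (fun τ k => Y τ k i)
        (fun k => - parDeriv (slabΓAt hT hg (γ τ, t)) (V τ) (fun k => Y τ k i) k) (Icc 0 1) τ) ∧
      ∀ τ ∈ Icc (0 : ℝ) 1, (Y τ)ᵀ * g (γ τ) t * Y τ = 1 := by
  have hγc : Continuous γ := continuous_iff_continuousAt.2 fun τ => (hγ τ).continuousAt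
  have hΓ : ∀ k i j, Continuous fun τ => slabΓAt hT hg (γ τ, t) k i j := fun k i j =>
    (continuous_slab_space (slabΓ hT hg k i j) ht).comp hγc
  obtain ⟨M, hM, hMa⟩ := continuous_matrix_toCLM
    (m := fun τ k j => - ∑ i, slabΓAt hT hg (γ τ, t) k i j * V τ i)
    (fun k j => by fun_prop (disch := assumption))
  choose Z hZ1 hZ using fun i => exists_linear_ode_backward hM (fun k => E k i)
  have hYd : ∀ τ ∈ Icc (0 : ℝ) 1, ∀ i, HasDerivWithinAt (fun τ k => Z i τ k)
      (fun k => - parDeriv (slabΓAt hT hg (γ τ, t)) (V τ) (fun k => Z i τ k) k) (Icc 0 1) τ := by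
    intro τ hτ i
    refine (hZ i τ hτ).congr_deriv (funext fun k => ?_)
    rw [hMa]
    simp only [parDeriv, Fin.sum_univ_three]; ring
  refine ⟨fun τ => Matrix.of fun k i => Z i τ k, ?_, hYd, ?_⟩
  · ext k i
    exact congrFun (hZ1 i) k
  have key : ∀ a b, ∀ τ ∈ Icc (0 : ℝ) 1,
      HasDerivWithinAt (fun τ => ∑ j, ∑ k, g (γ τ) t j k * Z a τ j * Z b τ k) 0 (Icc 0 1) τ := by
    intro a b τ hτ
    have hG : ∀ j k, HasDerivWithinAt (fun τ => g (γ τ) t j k)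
        (∑ i, V τ i * (slabDx hT i (slabG hg j k) : (Fin 3 → ℝ) × ℝ → ℝ) (γ τ, t)) (Icc 0 1) τ := by
      intro j k
      have := (hasDerivAt_slab_comp hT (slabG hg j k) ht (hγ τ)).hasDerivWithinAt (s := Icc 0 1)
      simpa only [slabG_apply hg j k ht] using this
    have hZa := fun c => hasDerivWithinAt_pi.1 (hYd τ hτ c)
    have := HasDerivWithinAt.fun_sum fun j (_ : j ∈ Finset.univ) => HasDerivWithinAt.fun_sum
      fun k (_ : k ∈ Finset.univ) => ((hG j k).mul (hZa a j)).mul (hZa b k)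
    refine this.congr_deriv ?_
    have hc : ∀ i j k, (slabDx hT i (slabG hg j k) : (Fin 3 → ℝ) × ℝ → ℝ) (γ τ, t)
        = ∑ p, slabΓAt hT hg (γ τ, t) p i j * g (γ τ) t p k
          + ∑ p, slabΓAt hT hg (γ τ, t) p i k * g (γ τ) t j p := by
      intro i j k
      have := congrArg (slabEval T (γ τ, t)) ((slab_isLeviCivita hT hg).compat i j k)
      simp only [map_add, map_sum, map_mul] at this
      simpa only [slabEval_apply, slabG_apply hg _ _ ht, slabΓAt] using this
    simp only [hc, parDeriv, Fin.sum_univ_three, Pi.mul_apply]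
    ring
  intro τ hτ
  have h1 : ∀ a b, ∑ j, ∑ k, g (γ τ) t j k * Z a τ j * Z b τ k
      = ∑ j, ∑ k, g (γ 1) t j k * E j a * E k b := by
    intro a b
    have := (convex_Icc (0 : ℝ) 1).norm_image_sub_le_of_norm_hasDerivWithin_le (C := 0)
      (key a b) (by simp) (x := 1) (y := τ) (by simp) hτ
    simp only [zero_mul, norm_le_zero_iff, sub_eq_zero] at this
    rw [this]
    simp only [hZ1]
  ext a b
  rw [← hE]
  have h2 := h1 a b
  simp only [Matrix.mul_apply, Matrix.transpose_apply, Matrix.of_apply, Fin.sum_univ_three] at h2 ⊢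
  linear_combination h2

/-- The position of a variation. -/
def varPos (h : ℝ) (d : VarData) : Fin 3 → ℝ :=
  fun k => d.1.1 k + h * d.1.2.1 k + h ^ 2 / 2 * d.1.2.2 k

/-- The velocity of a variation. -/
def varVel (h : ℝ) (d : VarData) : Fin 3 → ℝ :=
  fun k => d.2.1 k + h * d.2.2.1 k + h ^ 2 / 2 * d.2.2.2 k

lemma varEnergy_eq (G : (Fin 3 → ℝ) → Matrix (Fin 3) (Fin 3) ℝ) (h : ℝ) (d : VarData) :
    varEnergy G (h, d) = 1 / 2 * qf (G (varPos h d)) (varVel h d) := rfl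

lemma hasDerivWithinAt_varPos (hT : 0 < T) (hg : SmoothMetricFamily g (Icc 0 T)) (ht : t ∈ Icc 0 T)
    (hγ : ∀ τ, HasDerivAt γ (V τ) τ) {e : ℝ → Fin 3 → ℝ} {τ : ℝ}
    (he : HasDerivWithinAt e (fun k => - parDeriv (slabΓAt hT hg (γ τ, t)) (V τ) (e τ) k) (Icc 0 1) τ)
    {s s' : ℝ → ℝ} (hs : HasDerivAt s (s' τ) τ) (h : ℝ) :
    HasDerivWithinAt (fun τ => varPos h (varData (γ τ) (V τ) (e τ) (slabΓAt hT hg (γ τ, t))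
        (slabdΓAt hT hg (γ τ, t)) (s τ) (s' τ)))
      (varVel h (varData (γ τ) (V τ) (e τ) (slabΓAt hT hg (γ τ, t))
        (slabdΓAt hT hg (γ τ, t)) (s τ) (s' τ))) (Icc 0 1) τ := by
  have hΓ : ∀ k i j, HasDerivWithinAt (fun τ => slabΓAt hT hg (γ τ, t) k i j)
      (∑ l, V τ l * slabdΓAt hT hg (γ τ, t) l k i j) (Icc 0 1) τ := fun k i j =>
    (hasDerivAt_slab_comp hT (slabΓ hT hg k i j) ht (hγ τ)).hasDerivWithinAt
  have hsym : ∀ k i j, slabΓAt hT hg (γ τ, t) k i j = slabΓAt hT hg (γ τ, t) k j i := fun k i j => by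
    rw [slabΓAt, (slab_isLeviCivita hT hg).torsion]; rfl
  have he' := hasDerivWithinAt_pi.1 he
  have hs' := hs.hasDerivWithinAt (s := Icc 0 1)
  have hγ' := hasDerivWithinAt_pi.1 ((hγ τ).hasDerivWithinAt (s := Icc 0 1))
  rw [hasDerivWithinAt_pi]
  intro k
  have hP := HasDerivWithinAt.fun_sum fun i (_ : i ∈ Finset.univ) => HasDerivWithinAt.fun_sum
      fun j (_ : j ∈ Finset.univ) => ((hΓ k i j).mul (he' i)).mul (he' j)
  have := ((hγ' k).add ((hs'.mul (he' k)).const_mul h)).add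
    ((((hs'.pow 2).mul hP).neg).const_mul (h ^ 2 / 2))
  refine this.congr_deriv ?_
  simp only [varVel, varData, parDeriv, Fin.sum_univ_three, Pi.mul_apply, Pi.pow_apply]
  have s10 := hsym k 1 0
  have s20 := hsym k 2 0
  have s21 := hsym k 2 1
  simp only [s10, s20, s21]
  push_cast
  ring

end Parallel

/-! ### Barriers for the squared distance -/

section Barrier

variable {G : (Fin n → ℝ) → Matrix (Fin n) (Fin n) ℝ}

lemma abs_bilin_le {M : Matrix (Fin n) (Fin n) ℝ} (hM : M.PosDef) {u v : Fin n → ℝ} {ℓ : ℝ}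
    (hℓ : 0 ≤ ℓ) (hu : qf M u ≤ ℓ ^ 2) (hv : qf M v = 1) :
    |∑ i, ∑ j, M i j * u i * v j| ≤ ℓ := by
  set c := ∑ i, ∑ j, M i j * u i * v j with hc
  have hs : ∑ i, ∑ j, M i j * v i * u j = c := by
    rw [hc, Finset.sum_comm]
    refine Finset.sum_congr rfl fun i _ => Finset.sum_congr rfl fun j _ => ?_
    rw [show M j i = M i j by simpa using (hM.isHermitian.apply i j)]; ring
  have h0 := qf_nonneg hM (u - c • v)
  have h1 : qf M (u - c • v) = qf M u - c ^ 2 := by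
    have : qf M (u - c • v) = qf M u - c * (∑ i, ∑ j, M i j * u i * v j)
        - c * (∑ i, ∑ j, M i j * v i * u j) + c ^ 2 * qf M v := by
      simp only [qf, Finset.mul_sum, ← Finset.sum_sub_distrib, ← Finset.sum_add_distrib]
      refine Finset.sum_congr rfl fun i _ => Finset.sum_congr rfl fun j _ => ?_
      simp only [Pi.sub_apply, Pi.smul_apply, smul_eq_mul]; ring
    rw [this, hs, hv, ← hc]; ring
  exact abs_le_of_sq_le_sq (by linarith) hℓ

lemma hasDerivAt_max_zero_sq (x : ℝ) : HasDerivAt (fun x : ℝ => max x 0 ^ 2) (2 * max x 0) x := by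
  rcases lt_trichotomy x 0 with hx | rfl | hx
  · rw [max_eq_right hx.le, mul_zero]
    refine (hasDerivAt_const x (0 : ℝ)).congr_of_eventuallyEq ?_
    filter_upwards [gt_mem_nhds hx] with y hy
    simp [max_eq_right hy.le]
  · simp only [max_self, mul_zero]
    have h : (fun x : ℝ => max x 0 ^ 2) =O[nhds 0] fun x : ℝ => ‖x - 0‖ ^ 2 := by
      refine Asymptotics.IsBigO.of_bound 1 (Filter.Eventually.of_forall fun x => ?_)
      rw [sub_zero, one_mul, norm_pow, norm_pow, norm_norm]
      gcongr
      rw [Real.norm_eq_abs, Real.norm_eq_abs, abs_of_nonneg (le_max_right x 0)]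
      exact max_le (le_abs_self x) (abs_nonneg x)
    simpa using (h.hasFDerivAt one_lt_two (𝕜 := ℝ)).hasDerivAt
  · rw [max_eq_left hx.le]
    refine ((hasDerivAt_pow 2 x).congr_of_eventuallyEq ?_).congr_deriv (by simp)
    filter_upwards [lt_mem_nhds hx] with y hy
    simp [max_eq_left hy.le]

/-- The derivative of the cutoff along a path. -/
def rampDeriv (A τ : ℝ) : ℝ := 2 * A * max (1 - A * τ) 0

/-- A cutoff along a path. -/
def ramp (A τ : ℝ) : ℝ := 1 - max (1 - A * τ) 0 ^ 2

lemma hasDerivAt_ramp (A τ : ℝ) : HasDerivAt (ramp A) (rampDeriv A τ) τ := by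
  have h1 : HasDerivAt (fun τ : ℝ => 1 - A * τ) (-A) τ := by
    simpa using ((hasDerivAt_id τ).const_mul A).const_sub 1
  refine (((hasDerivAt_max_zero_sq (1 - A * τ)).comp τ h1).const_sub 1).congr_deriv ?_
  rw [rampDeriv]; ring

lemma continuous_rampDeriv (A : ℝ) : Continuous (rampDeriv A) := by
  unfold rampDeriv; fun_prop

lemma integral_rampDeriv {A : ℝ} (hA : 1 ≤ A) : ∫ τ in (0 : ℝ)..1, rampDeriv A τ = 1 := by
  rw [intervalIntegral.integral_eq_sub_of_hasDerivAt (fun τ _ => hasDerivAt_ramp A τ)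
    ((continuous_rampDeriv A).intervalIntegrable _ _)]
  simp [ramp, max_eq_right (sub_nonpos.2 hA)]

lemma ramp_bound {A τ R : ℝ} (hA : 0 ≤ A) (hτ : 0 ≤ τ) (hR : A * τ < 1 → R ≤ 2 * A ^ 2) :
    3 * rampDeriv A τ ^ 2 + (1 - ramp A τ ^ 2) * R ≤ 8 * A * rampDeriv A τ := by
  rw [rampDeriv, ramp]
  rcases le_or_gt 1 (A * τ) with h | h
  · rw [max_eq_right (by linarith)]; simp
  · rw [max_eq_left (by linarith)]
    set q := 1 - A * τ with hq
    have hq0 : 0 ≤ q := by linarith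
    have hq1 : q ≤ 1 := by nlinarith
    have hq2 : q ^ 2 ≤ q := by nlinarith
    have h0 : 0 ≤ 2 * q ^ 2 - q ^ 4 := by nlinarith [mul_nonneg (sq_nonneg q) hq0]
    have h1 := mul_le_mul_of_nonneg_left (hR h) h0
    have h2 := mul_le_mul_of_nonneg_left hq2 (sq_nonneg A)
    have h3 : 0 ≤ A ^ 2 * q ^ 4 := by positivity
    nlinarith only [h1, h2, h3]

variable {T : ℝ} {g : (Fin 3 → ℝ) → ℝ → Matrix (Fin 3) (Fin 3) ℝ} {t : ℝ} {x₀ x₁ : Fin 3 → ℝ}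
  {r₀ A : ℝ} {E : Matrix (Fin 3) (Fin 3) ℝ}

lemma quad_ricci_le (hT : 0 < T) (hg : SmoothMetricFamily g (Icc 0 T)) (ht : t ∈ Icc 0 T)
    {c : ℝ} {x : Fin 3 → ℝ} (h : Matrix.PosSemidef (Matrix.of fun i j =>
      c * g x t i j - ricci (fun y => g y t) x i j)) (v : Fin 3 → ℝ) :
    quad (slabRic hT hg) (x, t) v ≤ c * qf (g x t) v := by
  have := h.dotProduct_mulVec_nonneg v
  simp only [quad, qf, slabRic_apply hT hg _ _ ht]
  simp only [dotProduct, Matrix.mulVec, Matrix.of_apply, Fin.sum_univ_three, Pi.star_apply,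
    star_trivial] at this ⊢
  linear_combination this

set_option maxHeartbeats 1600000 in
theorem distance_barrier (hT : 0 < T) (hg : SmoothMetricFamily g (Icc 0 T))
    (hf : IsRicciFlow g (Icc 0 T)) (ht : t ∈ Icc 0 T) (ht0 : 0 < t) (hr : 0 < r₀) (hA : 1 ≤ A)
    (hK : IsCompact (closure (rBall (fun y => g y t) x₀ (A * r₀))))
    (hRic : ∀ x ∈ rBall (fun y => g y t) x₀ r₀, Matrix.PosSemidef (Matrix.of fun i j =>
      2 / r₀ ^ 2 * g x t i j - ricci (fun y => g y t) x i j))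
    (hd : riemDist (fun y => g y t) x₀ x₁ < A * r₀) (hE : Eᵀ * g x₁ t * E = 1) {η : ℝ} (hη : 0 < η) :
    ∃ δ > 0, ∀ h, 0 < h → h < δ →
      ∑ i, (1 / 2 * riemDist (fun y => g y t) x₀ (geoCurve (fun y => g y t) x₁ (fun k => E k i) h) ^ 2
        + 1 / 2 * riemDist (fun y => g y t) x₀ (geoCurve (fun y => g y t) x₁ (fun k => E k i) (-h)) ^ 2
        - riemDist (fun y => g y t) x₀ x₁ ^ 2)
        + (1 / 2 * riemDist (fun y => g y (t - h ^ 2)) x₀ x₁ ^ 2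
          - 1 / 2 * riemDist (fun y => g y t) x₀ x₁ ^ 2) ≤ (8 * A + η) * h ^ 2 ∧
      ∀ i, ∀ h', |h'| = h →
        1 / 2 * riemDist (fun y => g y t) x₀ (geoCurve (fun y => g y t) x₁ (fun k => E k i) h') ^ 2
          ≤ 1 / 2 * riemDist (fun y => g y t) x₀ x₁ ^ 2
            + h * (riemDist (fun y => g y t) x₀ x₁ + η) := by
  set G := fun y => g y t with hG
  set d := riemDist G x₀ x₁ with hdd
  have hd0 : 0 ≤ d := riemDist_nonneg _ _
  have hAr : 0 < A * r₀ := by positivity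
  have hGc := hg.continuous_space ht
  have hGp : ∀ x, (G x).PosDef := fun x => (hg.2 x t ht).2
  set S := 2 * A with hS
  set L := A ^ 2 * r₀ ^ 2 with hL
  have hdL : 0 < L - d ^ 2 := by nlinarith
  obtain ⟨δ₁, hδ₁, H₁⟩ := uniform_varEnergy hT hg ht hK L S (show 0 < η / 4 by positivity)
  obtain ⟨δ₂, hδ₂, H₂⟩ := uniform_metric_backward hT hg hf ht hK L (show 0 < η / 4 by positivity)
  set η₁ := min (η / 7) (min (η ^ 2 / 16) ((L - d ^ 2) / 2)) with hη₁
  have hη₁0 : 0 < η₁ := lt_min (by positivity) (lt_min (by positivity) (by linarith))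
  have hη₁a : η₁ ≤ η / 7 := min_le_left _ _
  have hη₁b : η₁ ≤ η ^ 2 / 16 := (min_le_right _ _).trans (min_le_left _ _)
  have hη₁c : η₁ ≤ (L - d ^ 2) / 2 := (min_le_right _ _).trans (min_le_right _ _)
  refine ⟨min (min δ₁ δ₂) (min 1 t), by positivity, fun h hh0 hh => ?_⟩
  have hhδ₁ : h < δ₁ := hh.trans_le ((min_le_left _ _).trans (min_le_left _ _))
  have hhδ₂ : h < δ₂ := hh.trans_le ((min_le_left _ _).trans (min_le_right _ _))
  have hh1 : h < 1 := hh.trans_le ((min_le_right _ _).trans (min_le_left _ _))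
  have hht : h < t := hh.trans_le ((min_le_right _ _).trans (min_le_right _ _))
  have hsq : h ^ 2 < h := by nlinarith
  have hsq0 : 0 < h ^ 2 := by positivity
  set ℓ := √(d ^ 2 + η₁ * h ^ 2) with hℓ
  have hℓ2 : ℓ ^ 2 = d ^ 2 + η₁ * h ^ 2 := Real.sq_sqrt (by positivity)
  have hℓ0 : 0 ≤ ℓ := Real.sqrt_nonneg _
  have hℓL : ℓ ^ 2 < L := by nlinarith
  have hdℓ : d < ℓ := Real.lt_sqrt_of_sq_lt (by linarith [mul_pos hη₁0 hsq0])
  have hℓA : ℓ < A * r₀ := lt_of_pow_lt_pow_left₀ 2 hAr.le (by rw [mul_pow]; exact hℓL)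
  have hℓd : ℓ ≤ d + η / 4 := by
    refine (le_abs_self _).trans (abs_le_of_sq_le_sq ?_ (by positivity))
    rw [hℓ2]; nlinarith
  obtain ⟨γ, V, hγ, hV, hγ0, hγ1, hsp⟩ := exists_path_of_riemDist_lt hGc hdℓ
  have hγc : Continuous γ := continuous_iff_continuousAt.2 fun τ => (hγ τ).continuousAt
  have hqV : ∀ τ, qf (G (γ τ)) (V τ) ≤ ℓ ^ 2 := fun τ => by
    rw [← Real.sq_sqrt (qf_nonneg (hGp _) _)]
    exact pow_le_pow_left₀ (Real.sqrt_nonneg _) (hsp τ) 2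
  have hdist : ∀ τ ∈ Icc (0 : ℝ) 1, riemDist G x₀ (γ τ) ≤ ℓ * τ := by
    intro τ hτ
    have h1 := riemDist_le_integral_of_nonneg (G := G) hτ.1 (fun σ _ => hγ σ) hV.continuousOn
    rw [hγ0] at h1
    refine h1.trans ?_
    have := intervalIntegral.integral_mono_on (μ := volume) hτ.1
      ((ContinuousOn.sqrt_qf (s := univ) hGc hγc.continuousOn hV.continuousOn).mono
        (subset_univ _) |>.intervalIntegrable) intervalIntegrable_const (fun σ _ => hsp σ)
    refine this.trans_eq ?_
    simp [mul_comm]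
  have hmem : ∀ τ ∈ Icc (0 : ℝ) 1, γ τ ∈ closure (rBall G x₀ (A * r₀)) := fun τ hτ =>
    subset_closure (show riemDist G x₀ (γ τ) < A * r₀ from by nlinarith only [hdist τ hτ, hτ.2, hτ.1, hℓA, hℓ0])
  obtain ⟨Y, hY1, hY, hYo⟩ := exists_parallel_frame hT hg ht hγ hV (E := E) (by rwa [hγ1])
  set vd : Fin 3 → ℝ → VarData := fun i τ => varData (γ τ) (V τ) (fun k => Y τ k i)
    (slabΓAt hT hg (γ τ, t)) (slabdΓAt hT hg (γ τ, t)) (ramp A τ) (rampDeriv A τ) with hvd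
  have hvdc : ∀ i, ContinuousOn (vd i) (Icc 0 1) := by
    intro i
    rw [continuousOn_iff_continuous_domRestrict]
    refine continuous_varData (X := Icc (0 : ℝ) 1) (by fun_prop) (by fun_prop) ?_ (fun k a b => ?_)
      (fun l k a b => ?_) ?_ ?_
    · refine continuousOn_iff_continuous_domRestrict.1 fun τ hτ => (hY τ hτ i).continuousWithinAt
    · exact (continuous_slab_space (slabΓ hT hg k a b) ht).comp (hγc.comp continuous_subtype_val)
    · exact (continuous_slab_space (slabDx hT l (slabΓ hT hg k a b)) ht).comp
        (hγc.comp continuous_subtype_val)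
    · exact (continuous_iff_continuousAt.2 fun τ => (hasDerivAt_ramp A τ).continuousAt).comp
        continuous_subtype_val
    · exact (continuous_rampDeriv A).comp continuous_subtype_val
  have hvel : ∀ i h', ContinuousOn (fun τ => varVel h' (vd i τ)) (Icc 0 1) := fun i h' => by
    have : Continuous (varVel h') := by unfold varVel; fun_prop
    exact this.comp_continuousOn (hvdc i)
  have hen : ∀ i h', ContinuousOn (fun τ => varEnergy G (h', vd i τ)) (Icc 0 1) := fun i h' =>
    (contDiff_varEnergy (m := 0) fun a b => (hg.contDiff_space ht a b).of_le (by simp)).continuous.comp_continuousOn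
      (continuousOn_const.prodMk (hvdc i))
  have hpar : ∀ e : Fin 3 → ℝ, parDeriv (slabΓAt hT hg (x₁, t)) e e = fun k =>
      ∑ i, ∑ j, christoffel G x₁ k i j * e i * e j := fun e => by
    funext k
    simp only [parDeriv, slabΓAt, slabEval_apply, slabΓ_apply hT hg _ _ _ ht, hG]
  have hr0 : ramp A 0 = 0 := by simp [ramp]
  have hr1 : ramp A 1 = 1 := by simp [ramp, max_eq_right (sub_nonpos.2 hA)]
  have hgeo : ∀ i h', 1 / 2 * riemDist G x₀ (geoCurve G x₁ (fun k => E k i) h') ^ 2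
      ≤ ∫ τ in (0 : ℝ)..1, varEnergy G (h', vd i τ) := by
    intro i h'
    have h1 := sq_riemDist_le_integral hGc hGp (γ := fun τ => varPos h' (vd i τ))
      (V := fun τ => varVel h' (vd i τ))
      (fun τ hτ => hasDerivWithinAt_varPos hT hg ht hγ (hY τ hτ i) (hasDerivAt_ramp A τ) h')
      (hvel i h')
    have e0 : varPos h' (vd i 0) = x₀ := by
      funext k; simp [varPos, hvd, varData, hr0, hγ0]
    have e1 : varPos h' (vd i 1) = geoCurve G x₁ (fun k => E k i) h' := by
      funext k
      simp only [varPos, hvd, varData, hr1, hγ1, hY1, hpar, geoCurve]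
      ring
    simp only [e0, e1] at h1
    simp only [varEnergy_eq, intervalIntegral.integral_const_mul]
    linarith
  have hrange : ∀ τ ∈ Icc (0 : ℝ) 1, ramp A τ ∈ Icc 0 S ∧ rampDeriv A τ ∈ Icc 0 S ∧
      ramp A τ ≤ 1 := by
    intro τ hτ
    have h0 : 0 ≤ max (1 - A * τ) 0 := le_max_right _ _
    have h1 : max (1 - A * τ) 0 ≤ 1 := max_le (by nlinarith [hτ.1]) zero_le_one
    simp only [ramp, rampDeriv, hS, mem_Icc]
    refine ⟨⟨by nlinarith, by nlinarith⟩, ⟨by positivity, by nlinarith⟩, by nlinarith⟩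
  have hU := fun h' hh' τ (hτ : τ ∈ Icc (0 : ℝ) 1) => H₁ h' hh' (γ τ) (hmem τ hτ) (V τ)
    ((hqV τ).trans hℓL.le) (Y τ) (hYo τ hτ) (ramp A τ) (hrange τ hτ).1 (rampDeriv A τ)
    (hrange τ hτ).2.1
  have hEint : ∀ i h', IntervalIntegrable (fun τ => varEnergy G (h', vd i τ)) volume 0 1 :=
    fun i h' => ContinuousOn.intervalIntegrable (by rw [uIcc_of_le zero_le_one]; exact hen i h')
  have hramp_int := (continuous_rampDeriv A).intervalIntegrable (μ := volume) 0 1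
  constructor
  · have hth : t - h ^ 2 ∈ Icc 0 T := ⟨by linarith, by linarith [ht.2]⟩
    have hqb : Continuous fun τ => 1 / 2 * qf (g (γ τ) (t - h ^ 2)) (V τ) :=
      continuous_const.mul ((continuous_qf (M := fun y => g y (t - h ^ 2))
        (hg.continuous_space hth)).comp (hγc.prodMk hV))
    have htime : 1 / 2 * riemDist (fun y => g y (t - h ^ 2)) x₀ x₁ ^ 2
        ≤ ∫ τ in (0 : ℝ)..1, 1 / 2 * qf (g (γ τ) (t - h ^ 2)) (V τ) := by
      have h1 := sq_riemDist_le_integral (hg.continuous_space hth)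
        (fun x => (hg.2 x _ hth).2) (fun τ _ => (hγ τ).hasDerivWithinAt) hV.continuousOn
      rw [hγ0, hγ1] at h1
      rw [intervalIntegral.integral_const_mul]
      linarith
    have hsum : ∫ τ in (0 : ℝ)..1, (∑ i, (varEnergy G (h, vd i τ) + varEnergy G (-h, vd i τ))
          + 1 / 2 * qf (g (γ τ) (t - h ^ 2)) (V τ))
        ≤ ∫ τ in (0 : ℝ)..1, (7 / 2 * ℓ ^ 2 + h ^ 2 * (η / 2) + 8 * A * h ^ 2 * rampDeriv A τ) := by
      refine intervalIntegral.integral_mono_on zero_le_one ?_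
        (intervalIntegrable_const.add (hramp_int.const_mul _)) ?_
      · refine IntervalIntegrable.add ?_ (hqb.intervalIntegrable _ _)
        simp only [Fin.sum_univ_three]
        exact (((hEint 0 h).add (hEint 0 (-h))).add ((hEint 1 h).add (hEint 1 (-h)))).add
          ((hEint 2 h).add (hEint 2 (-h)))
      intro τ hτ
      have u1 := (hU h (by rwa [abs_of_pos hh0]) τ hτ).1
      have u2 := H₂ (h ^ 2) hsq0.le (by linarith) (by linarith) (γ τ) (hmem τ hτ) (V τ)
        ((hqV τ).trans hℓL.le)
      simp only [Finset.sum_sub_distrib, Finset.sum_const, Finset.card_univ, Fintype.card_fin,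
        nsmul_eq_mul] at u1
      set R := quad (slabRic hT hg) (γ τ, t) (V τ) with hR
      have hfin : 3 * rampDeriv A τ ^ 2 + (1 - ramp A τ ^ 2) * R ≤ 8 * A * rampDeriv A τ := by
        refine ramp_bound (zero_le_one.trans hA) hτ.1 fun hτA => ?_
        have hball : γ τ ∈ rBall G x₀ r₀ := by
          refine (hdist τ hτ).trans_lt ?_
          nlinarith only [hτ.1, hℓA, hτA, hℓ0, hr, hA]
        refine (quad_ricci_le hT hg ht (hRic _ hball) (V τ)).trans ?_
        rw [div_mul_eq_mul_div, div_le_iff₀ (by positivity)]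
        have hv := hqV τ
        change qf (g (γ τ) t) (V τ) ≤ _ at hv
        linarith only [hv, hℓL, hL]
      have := mul_le_mul_of_nonneg_left hfin hsq0.le
      have hv := hqV τ
      push_cast at u1
      change _ ≤ 1 / 2 * qf (G (γ τ)) (V τ) + _ + _ at u2
      change _ - 3 * qf (G (γ τ)) (V τ) ≤ _ at u1
      linarith only [u1, u2, hv, this]
    rw [intervalIntegral.integral_add (by
        simp only [Fin.sum_univ_three]
        exact (((hEint 0 h).add (hEint 0 (-h))).add ((hEint 1 h).add (hEint 1 (-h)))).add
          ((hEint 2 h).add (hEint 2 (-h)))) (hqb.intervalIntegrable _ _),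
      intervalIntegral.integral_finsetSum (fun i _ => (hEint i h).add (hEint i (-h))),
      intervalIntegral.integral_add intervalIntegrable_const (hramp_int.const_mul _),
      intervalIntegral.integral_const_mul (8 * A * h ^ 2), integral_rampDeriv hA] at hsum
    simp only [intervalIntegral.integral_const, sub_zero, one_smul, mul_one, Fin.sum_univ_three]
      at hsum ⊢
    rw [intervalIntegral.integral_add (hEint 0 h) (hEint 0 (-h)),
      intervalIntegral.integral_add (hEint 1 h) (hEint 1 (-h)),
      intervalIntegral.integral_add (hEint 2 h) (hEint 2 (-h))] at hsum
    have := mul_le_mul_of_nonneg_right hη₁a hsq0.le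
    linarith only [htime, hsum, this, hℓ2, mul_pos hη hsq0, hgeo 0 h, hgeo 0 (-h), hgeo 1 h, hgeo 1 (-h), hgeo 2 h, hgeo 2 (-h)]
  · intro i h' hh'
    have hle : ∫ τ in (0 : ℝ)..1, varEnergy G (h', vd i τ)
        ≤ ∫ τ in (0 : ℝ)..1, (1 / 2 * ℓ ^ 2 + η / 4 * h + h * ℓ * rampDeriv A τ) := by
      refine intervalIntegral.integral_mono_on zero_le_one (hEint i h')
        (intervalIntegrable_const.add (hramp_int.const_mul _)) fun τ hτ => ?_
      have u := (hU h' (by rwa [hh']) τ hτ).2 i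
      have hb := abs_bilin_le (hGp (γ τ)) hℓ0 (hqV τ) (v := fun k => Y τ k i) (by
        have := congrFun (congrFun (hYo τ hτ) i) i
        rw [Matrix.one_apply_eq] at this
        rw [← this]
        simp only [qf, hG, Matrix.mul_apply, Matrix.transpose_apply, Fin.sum_univ_three]; ring)
      have hb2 : h' * (rampDeriv A τ * ∑ j, ∑ k, G (γ τ) j k * V τ j * Y τ k i)
          ≤ h * ℓ * rampDeriv A τ := by
        refine (le_abs_self _).trans ?_
        rw [abs_mul, abs_mul, hh', abs_of_nonneg (hrange τ hτ).2.1.1, mul_assoc, mul_comm ℓ]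
        exact mul_le_mul_of_nonneg_left (mul_le_mul_of_nonneg_left hb (hrange τ hτ).2.1.1) hh0.le
      rw [hh'] at u
      have hv := hqV τ
      change _ ≤ 1 / 2 * qf (G (γ τ)) (V τ) + _ + _ at u
      change _ ≤ _ at hb2
      linarith only [u, hv, hb2]
    rw [intervalIntegral.integral_add intervalIntegrable_const (hramp_int.const_mul _),
      intervalIntegral.integral_const_mul, integral_rampDeriv hA] at hle
    simp only [intervalIntegral.integral_const, sub_zero, one_smul, mul_one] at hle
    have h1 := hgeo i h'
    have h2 := mul_le_mul_of_nonneg_left hℓd hh0.le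
    have h3 : η₁ * h ^ 2 ≤ η / 7 * h := mul_le_mul hη₁a hsq.le hsq0.le (by positivity)
    nlinarith only [h1, h2, h3, hle, hℓ2, mul_pos hη hh0]

end Barrier

/-! ### Compactness of the epigraph of the distance function -/

section Epigraph

variable {M : (Fin n → ℝ) × ℝ → Matrix (Fin n) (Fin n) ℝ} {x₀ : Fin n → ℝ}

lemma continuous_section (hM : ∀ i j, Continuous fun p => M p i j) (t : ℝ) (i j : Fin n) :
    Continuous fun y => M (y, t) i j := (hM i j).comp (by fun_prop)

lemma riemDist_semicontinuous (hM : ∀ i j, Continuous fun p => M p i j) (hpos : ∀ p, (M p).PosDef)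
    {t : ℝ} {K : Set (Fin n → ℝ)} (hK : IsCompact K) {r r' ρ : ℝ} (hr0 : 0 ≤ r) (hr : r < r')
    (hρ : r' ≤ ρ) (hsub : rBall (fun y => M (y, t)) x₀ ρ ⊆ K) :
    ∀ᶠ q : (Fin n → ℝ) × ℝ in nhds (0, t), ∀ x, riemDist (fun y => M (y, q.2)) x₀ x < r →
      riemDist (fun y => M (y, t)) x₀ (x + q.1) ≤ r' := by
  have hr'0 : 0 < r' := hr0.trans_lt hr
  have hGc := continuous_section hM t
  let P := {p : (Fin n → ℝ) × (Fin n → ℝ) | p.1 ∈ K ∧ qf (M (p.1, t)) p.2 ≤ r' ^ 2}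
    ∩ {p | qf (M (p.1, t)) p.2 = r' ^ 2}
  have hP : IsCompact P :=
    (isCompact_qf_le (M := fun y => M (y, t)) hK hGc (fun _ _ => hpos _) _).inter_right
      (isClosed_eq (continuous_qf (M := fun y => M (y, t)) hGc) continuous_const)
  have hQ := hP.prod ((isCompact_Icc (a := (0 : ℝ)) (b := 1)).prod
    (isCompact_Icc (a := (0 : ℝ)) (b := 1)))
  have hF : Continuous fun q : ((Fin n → ℝ) × ℝ) × ((Fin n → ℝ) × (Fin n → ℝ)) × ℝ × ℝ =>
      qf (M (q.2.1.1 - q.2.2.1 • q.1.1, q.1.2)) (q.2.1.2 - q.2.2.2 • q.1.1) :=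
    (continuous_qf hM).comp (f := fun q : ((Fin n → ℝ) × ℝ) × ((Fin n → ℝ) × (Fin n → ℝ)) × ℝ × ℝ =>
      ((q.2.1.1 - q.2.2.1 • q.1.1, q.1.2), q.2.1.2 - q.2.2.2 • q.1.1)) (by fun_prop)
  have htube : ∀ᶠ q : (Fin n → ℝ) × ℝ in nhds (0, t), ∀ p ∈ P ×ˢ Icc (0 : ℝ) 1 ×ˢ Icc (0 : ℝ) 1,
      r ^ 2 < qf (M (p.1.1 - p.2.1 • q.1, q.2)) (p.1.2 - p.2.2 • q.1) := by
    refine hQ.eventually_forall_of_forall_eventually fun p hp => ?_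
    refine hF.continuousAt.eventually_const_lt ?_
    have := hp.1.2
    simp only [mem_ofPred_eq] at this
    simp only [smul_zero, sub_zero, this]
    gcongr
  filter_upwards [htube] with q hq x hx
  obtain ⟨γ, V, hγ, hV, hγ0, hγ1, hsp⟩ := exists_path_of_riemDist_lt (continuous_section hM q.2) hx
  have hγc : Continuous γ := continuous_iff_continuousAt.2 fun τ => (hγ τ).continuousAt
  have hc : ∀ τ, HasDerivAt (fun τ => γ τ + τ • q.1) (V τ + q.1) τ := fun τ => by
    have := (hasDerivAt_id τ).smul_const q.1
    rw [one_smul] at this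
    exact (hγ τ).add this
  have hW : Continuous fun τ => V τ + q.1 := hV.add continuous_const
  set f : ℝ → ℝ := fun τ => √(qf (M (γ τ + τ • q.1, t)) (V τ + q.1)) with hf
  have hfc : Continuous f := Real.continuous_sqrt.comp
    ((continuous_qf (M := fun y => M (y, t)) hGc).comp (f := fun τ => (γ τ + τ • q.1, V τ + q.1))
      (by fun_prop))
  have hdist : ∀ τ, 0 ≤ τ → riemDist (fun y => M (y, t)) x₀ (γ τ + τ • q.1) ≤ ∫ σ in (0 : ℝ)..τ, f σ := by
    intro τ hτ
    have := riemDist_le_integral_of_nonneg (G := fun y => M (y, t)) hτ (fun σ _ => hc σ) hW.continuousOn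
    simpa [hγ0] using this
  have hL : ∀ τ ∈ Icc (0 : ℝ) 1, ∫ σ in (0 : ℝ)..τ, f σ ≤ r' * τ := by
    have hLd : ∀ τ, HasDerivAt (fun τ => ∫ σ in (0 : ℝ)..τ, f σ) (f τ) τ := fun τ =>
      intervalIntegral.integral_hasDerivAt_right (hfc.intervalIntegrable _ _)
        hfc.stronglyMeasurable.stronglyMeasurableAtFilter hfc.continuousAt
    have hB : ∀ τ, HasDerivAt (fun τ : ℝ => r' * τ) r' τ := fun τ => by
      simpa using (hasDerivAt_id τ).const_mul r'
    refine image_le_of_deriv_right_lt_deriv_boundary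
      (fun τ _ => (hLd τ).continuousAt.continuousWithinAt) (fun τ _ => (hLd τ).hasDerivWithinAt)
      (by simp) hB fun τ hτ he => ?_
    have hz : γ τ + τ • q.1 ∈ K := hsub <| (hdist τ hτ.1).trans_lt <| by
      rw [he]; nlinarith [hτ.2]
    by_contra! hcon
    have hf0 : 0 < f τ := hr'0.trans_le hcon
    set a := r' / f τ with ha
    have ha0 : 0 ≤ a := by positivity
    have ha1 : a ≤ 1 := (div_le_one hf0).2 hcon
    have hfs : qf (M (γ τ + τ • q.1, t)) (V τ + q.1) = f τ ^ 2 :=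
      (Real.sq_sqrt (qf_nonneg (hpos _) _)).symm
    have hae : qf (M (γ τ + τ • q.1, t)) (a • (V τ + q.1)) = r' ^ 2 := by
      rw [qf_smul, hfs, ha]; field_simp
    have := hq ((γ τ + τ • q.1, a • (V τ + q.1)), τ, a) ⟨⟨⟨hz, hae.le⟩, hae⟩, ⟨hτ.1, hτ.2.le⟩, ha0, ha1⟩
    simp only [add_sub_cancel_right, smul_add, qf_smul] at this
    have hs : qf (M (γ τ, q.2)) (V τ) ≤ r ^ 2 := by
      rw [← Real.sq_sqrt (qf_nonneg (hpos _) _)]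
      exact pow_le_pow_left₀ (Real.sqrt_nonneg _) (hsp τ) 2
    nlinarith [qf_nonneg (hpos (γ τ, q.2)) (V τ), mul_le_mul ha1 ha1 ha0 zero_le_one]
  have := (hdist 1 zero_le_one).trans (hL 1 ⟨zero_le_one, le_rfl⟩)
  simpa [hγ1] using this

theorem isCompact_epigraph (hM : ∀ i j, Continuous fun p => M p i j) (hpos : ∀ p, (M p).PosDef)
    {T R ρ : ℝ} (hR : R < ρ)
    (hK : ∀ t ∈ Icc 0 T, IsCompact (closure (rBall (fun y => M (y, t)) x₀ ρ))) :
    IsCompact {p : (Fin n → ℝ) × ℝ × ℝ | p.2.1 ∈ Icc 0 T ∧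
      riemDist (fun y => M (y, p.2.1)) x₀ p.1 ≤ p.2.2 ∧ p.2.2 ≤ R} := by
  set S := {p : (Fin n → ℝ) × ℝ × ℝ | p.2.1 ∈ Icc 0 T ∧
      riemDist (fun y => M (y, p.2.1)) x₀ p.1 ≤ p.2.2 ∧ p.2.2 ≤ R} with hS
  rcases lt_or_ge R 0 with hR0 | hR0
  · convert isCompact_empty
    refine eq_empty_of_forall_notMem fun p hp => ?_
    exact absurd ((riemDist_nonneg _ _).trans (hp.2.1.trans hp.2.2)) (not_le.2 hR0)
  have hclosed : IsClosed S := by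
    refine isClosed_of_closure_subset fun p hp => ?_
    have hA : IsClosed {p : (Fin n → ℝ) × ℝ × ℝ | p.2.1 ∈ Icc 0 T ∧ 0 ≤ p.2.2 ∧ p.2.2 ≤ R} :=
      (isClosed_Icc.preimage (f := fun p : (Fin n → ℝ) × ℝ × ℝ => p.2.1) (by fun_prop)).inter
        ((isClosed_le continuous_const continuous_snd.snd).inter
          (isClosed_le continuous_snd.snd continuous_const))
    have hpA := closure_minimal (t := {p : (Fin n → ℝ) × ℝ × ℝ | p.2.1 ∈ Icc 0 T ∧ 0 ≤ p.2.2 ∧ p.2.2 ≤ R})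
      (fun q hq => ⟨hq.1, (riemDist_nonneg _ _).trans hq.2.1, hq.2.2⟩) hA hp
    refine ⟨hpA.1, ?_, hpA.2.2⟩
    by_contra! hcon
    obtain ⟨r', h1, h2⟩ := exists_between (lt_min hcon (hpA.2.2.trans_lt hR))
    obtain ⟨r, h3, h4⟩ := exists_between h1
    have hev := riemDist_semicontinuous (x₀ := x₀) hM hpos (hK p.2.1 hpA.1) (hpA.2.1.trans h3.le) h4
      (h2.le.trans (min_le_right _ _)) subset_closure
    have hc : Continuous fun q : (Fin n → ℝ) × ℝ × ℝ => (p.1 - q.1, q.2.1) := by fun_prop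
    have hev2 := (hc.tendsto' p (0, p.2.1) (by simp)).eventually hev
    have hev3 : ∀ᶠ q : (Fin n → ℝ) × ℝ × ℝ in nhds p, q.2.2 < r :=
      (continuous_snd.snd.tendsto p).eventually_lt_const h3
    obtain ⟨q, hqS, hq2, hq3⟩ := ((mem_closure_iff_frequently.1 hp).and_eventually (hev2.and hev3)).exists
    have := hq2 q.1 (hqS.2.1.trans_lt hq3)
    simp only [add_sub_cancel] at this
    exact absurd (this.trans_lt (h2.trans_le (min_le_left _ _))) (lt_irrefl _)
  have hbdd : ∃ B, ∀ t ∈ Icc 0 T, ∀ x, riemDist (fun y => M (y, t)) x₀ x ≤ R → ‖x‖ ≤ B := by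
    refine isCompact_Icc.induction_on (p := fun s => ∃ B, ∀ t ∈ s, ∀ x,
      riemDist (fun y => M (y, t)) x₀ x ≤ R → ‖x‖ ≤ B) ⟨0, by simp⟩ ?_ ?_ ?_
    · rintro s s' hs ⟨B, hB⟩
      exact ⟨B, fun t ht => hB t (hs ht)⟩
    · rintro s s' ⟨B, hB⟩ ⟨B', hB'⟩
      refine ⟨max B B', fun t ht x hx => ?_⟩
      rcases ht with ht | ht
      · exact (hB t ht x hx).trans (le_max_left _ _)
      · exact (hB' t ht x hx).trans (le_max_right _ _)
    · intro t ht
      obtain ⟨r', h1, h2⟩ := exists_between hR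
      obtain ⟨r, h3, h4⟩ := exists_between h1
      have hev := riemDist_semicontinuous (x₀ := x₀) hM hpos (hK t ht) (hR0.trans h3.le) h4 h2.le
        subset_closure
      have hc : Continuous fun s : ℝ => ((0 : Fin n → ℝ), s) := by fun_prop
      obtain ⟨B, hB⟩ := (hK t ht).isBounded.exists_norm_le
      refine ⟨{s | ∀ x, riemDist (fun y => M (y, s)) x₀ x < r →
        riemDist (fun y => M (y, t)) x₀ (x + 0) ≤ r'}, mem_nhdsWithin_of_mem_nhds
          ((hc.tendsto t).eventually hev), B, fun s hs x hx => ?_⟩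
      have := hs x (hx.trans_lt h3)
      rw [add_zero] at this
      exact hB x (subset_closure (this.trans_lt h2))
  obtain ⟨B, hB⟩ := hbdd
  refine ((isCompact_closedBall (0 : Fin n → ℝ) B).prod
    ((isCompact_Icc (a := (0 : ℝ)) (b := T)).prod (isCompact_Icc (a := (0 : ℝ)) (b := R)))).of_isClosed_subset
    hclosed fun p hp => ⟨?_, hp.1, (riemDist_nonneg _ _).trans hp.2.1, hp.2.2⟩
  rw [mem_closedBall_zero_iff]
  exact hB _ hp.1 _ (hp.2.1.trans hp.2.2)

end Epigraph

/-! ### Differential inequalities at a touching point -/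

section Touch

open Filter Topology

lemma hasDerivAt_rpow_neg_half {u : ℝ} (hu : 0 < u) :
    HasDerivAt (fun u : ℝ => u ^ (-(1 / 2) : ℝ)) (-(1 / 2) * u ^ (-(3 / 2) : ℝ)) u :=
  (Real.hasDerivAt_rpow_const (Or.inl hu.ne')).congr_deriv (by norm_num)

lemma HasJet.const_mul_rpow_neg_half {f : ℝ → ℝ} {a b c : ℝ} (h : HasJet f a b c) (ha : 0 < a) (W : ℝ) :
    HasJet (fun s => W * (f s / a) ^ (-(1 / 2) : ℝ)) W (-(W * b / (2 * a)))
      (W * (3 * b ^ 2 / (4 * a ^ 2) - c / (2 * a))) := by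
  have h1 : HasJet (fun s => f s / a) 1 (b / a) (c / a) := by
    simpa only [div_eq_inv_mul, inv_mul_cancel₀ ha.ne'] using h.const_mul a⁻¹
  have e : HasDerivAt (fun u : ℝ => -(1 / 2) * u ^ (-(3 / 2) : ℝ)) (3 / 4) 1 :=
    ((Real.hasDerivAt_rpow_const (p := -(3 / 2)) (Or.inl one_ne_zero)).const_mul _).congr_deriv
      (by norm_num)
  refine ((h1.comp (φ := fun u => u ^ (-(1 / 2) : ℝ)) ?_ e).const_mul W).congr (by simp) ?_ ?_
  · filter_upwards [lt_mem_nhds (one_pos (α := ℝ))] with u hu using hasDerivAt_rpow_neg_half hu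
  · simp only [Real.one_rpow]; ring
  · simp only [Real.one_rpow]; field_simp; ring

lemma le_mul_rpow_neg_half {w W u : ℝ} (hW : 0 ≤ W) (hu : 0 < u) (h : 0 ≤ w → w ^ 2 * u ≤ W ^ 2) :
    w ≤ W * u ^ (-(1 / 2) : ℝ) := by
  rcases le_total 0 w with hw | hw
  · refine (pow_le_pow_iff_left₀ hw (by positivity) two_ne_zero).1 ?_
    rw [mul_pow, ← Real.rpow_natCast (u ^ _), ← Real.rpow_mul hu.le]
    norm_num
    rw [Real.rpow_neg_one, ← div_eq_mul_inv, le_div_iff₀ hu]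
    exact h hw
  · exact hw.trans (by positivity)

/-- Comparison of the first and second variations of the cutoff and of the pinching function at a
maximum point of their product. -/
lemma touching_inequalities {T t c Z₀ W₀ N₀ d B τ m' : ℝ} {b e : Fin 3 → ℝ} {N Z : Fin 3 → ℝ → ℝ}
    {Nt Zt m : ℝ → ℝ} (ht0 : 0 < t) (htT : t ≤ T) (hc : 0 < c) (hZ₀ : W₀ = 1 - Z₀ / c) (hW₀ : 0 < W₀)
    (hN₀ : 0 < N₀) (hN : ∀ i, HasJet (N i) N₀ (b i) (e i)) (hNt : HasDerivWithinAt Nt τ (Icc 0 T) t)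
    (hNt₀ : Nt t = N₀) (hm : HasDerivWithinAt m m' (Icc 0 T) t) (hm0 : ∀ s ∈ Icc 0 T, 0 < m s)
    (hmaxS : ∀ i, ∀ᶠ h in 𝓝 0, Z i h ≤ c → (1 - Z i h / c) ^ 2 * N i h ≤ W₀ ^ 2 * N₀)
    (hmaxT : ∀ s ∈ Icc 0 T, Zt s ≤ c → (1 - Zt s / c) ^ 2 * Nt s * m t ≤ W₀ ^ 2 * N₀ * m s)
    (hbar : ∀ η > 0, ∃ δ > 0, ∀ h, 0 < h → h < δ →
      ∑ i, (Z i h + Z i (-h) - 2 * Z₀) + (Zt (t - h ^ 2) - Z₀) ≤ (B + η) * h ^ 2 ∧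
      ∀ i, ∀ h', |h'| = h → Z i h' ≤ Z₀ + h * (d + η)) :
    c * (W₀ / (2 * N₀) * (∑ i, e i - τ) + W₀ * m' / (2 * m t)
      - 3 * W₀ / (4 * N₀ ^ 2) * ∑ i, b i ^ 2) ≤ B ∧
    ∀ i, c * W₀ * |b i| ≤ 2 * N₀ * d := by
  have ht : t ∈ Icc 0 T := ⟨ht0.le, htT⟩
  have hmt := hm0 t ht
  set J : Fin 3 → ℝ → ℝ := fun i h => W₀ * (N i h / N₀) ^ (-(1 / 2) : ℝ) with hJ
  have hJj := fun i => (hN i).const_mul_rpow_neg_half hN₀ W₀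
  have hZJ : ∀ i, ∀ᶠ h in 𝓝 0, c * (1 - J i h) ≤ Z i h := by
    intro i
    have hpos : ∀ᶠ h in 𝓝 0, 0 < N i h := by
      obtain ⟨f', hd, h0, -⟩ := hN i
      exact hd.self_of_nhds.continuousAt.eventually_const_lt (h0 ▸ hN₀)
    filter_upwards [hmaxS i, hpos] with h h1 h2
    have : 1 - Z i h / c ≤ J i h := le_mul_rpow_neg_half hW₀.le (div_pos h2 hN₀) fun hw => by
      rw [mul_div_assoc', div_le_iff₀ hN₀]
      exact h1 (by rwa [sub_nonneg, div_le_one hc] at hw)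
    rw [mul_sub, mul_one]
    have h3 : c * (Z i h / c) = Z i h := by field_simp
    nlinarith
  have hZc : Z₀ = c * (1 - W₀) := by rw [hZ₀]; field_simp; ring
  set Jt : ℝ → ℝ := fun s => W₀ * ((Nt s * m t) / (N₀ * m s)) ^ (-(1 / 2) : ℝ) with hJt
  have hu : HasDerivWithinAt (fun s => (Nt s * m t) / (N₀ * m s)) (τ / N₀ - m' / m t) (Icc 0 T) t := by
    refine ((hNt.mul_const (m t)).div (hm.const_mul N₀) (by positivity)).congr_deriv ?_
    rw [hNt₀]; field_simp
  have hut : (Nt t * m t) / (N₀ * m t) = 1 := by rw [hNt₀]; exact div_self (by positivity)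
  have hJt' : HasDerivWithinAt Jt (-(W₀ / 2) * (τ / N₀ - m' / m t)) (Icc 0 T) t := by
    have := (hasDerivAt_rpow_neg_half (show 0 < (Nt t * m t) / (N₀ * m t) by rw [hut]; exact one_pos))
    refine ((this.comp_hasDerivWithinAt t hu).const_mul W₀).congr_deriv ?_
    rw [hut, Real.one_rpow]; ring
  have hJt0 : Jt t = W₀ := by rw [hJt]; simp only [hut, Real.one_rpow, mul_one]
  have hZt : ∀ᶠ s in 𝓝[Icc 0 T] t, c * (1 - Jt s) ≤ Zt s := by
    have hpos : ∀ᶠ s in 𝓝[Icc 0 T] t, 0 < (Nt s * m t) / (N₀ * m s) :=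
      hu.continuousWithinAt.eventually_const_lt (one_pos.trans_eq hut.symm)
    filter_upwards [hpos, self_mem_nhdsWithin] with s h1 h2
    have hms := hm0 s h2
    have : 1 - Zt s / c ≤ Jt s := le_mul_rpow_neg_half hW₀.le h1 fun hw => by
      rw [mul_div_assoc', div_le_iff₀ (by positivity), ← mul_assoc, ← mul_assoc]
      exact hmaxT s h2 (by rwa [sub_nonneg, div_le_one hc] at hw)
    rw [mul_sub, mul_one]
    have h3 : c * (Zt s / c) = Zt s := by field_simp
    nlinarith
  have hsq : Tendsto (fun h : ℝ => t - h ^ 2) (𝓝 0) (𝓝[Icc 0 T] t) := by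
    have hcont : Tendsto (fun h : ℝ => t - h ^ 2) (𝓝 0) (𝓝 t) :=
      (by fun_prop : Continuous fun h : ℝ => t - h ^ 2).tendsto' _ _ (by simp)
    refine tendsto_nhdsWithin_iff.2 ⟨hcont, ?_⟩
    filter_upwards [hcont.eventually_const_lt ht0] with h hh
    exact ⟨hh.le, by nlinarith [sq_nonneg h]⟩
  have hneg : Tendsto (fun h : ℝ => -h) (𝓝 0) (𝓝 0) :=
    (continuous_neg (G := ℝ)).tendsto' _ _ neg_zero
  refine ⟨le_of_forall_pos_le_add fun ε hε => ?_, fun i => ?_⟩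
  · obtain ⟨δ, hδ, H⟩ := hbar (ε / 2) (half_pos hε)
    obtain ⟨ε', hε', hε2⟩ : ∃ ε' > 0, c * (4 * ε') ≤ ε / 2 := ⟨ε / (8 * c), by positivity, by
      field_simp; norm_num⟩
    have e1 := fun i => (hJj i).second hε'
    have e2 : ∀ᶠ h in 𝓝 (0 : ℝ), |Jt (t - h ^ 2) - W₀ - -h ^ 2 * (-(W₀ / 2) * (τ / N₀ - m' / m t))|
        ≤ ε' * h ^ 2 := by
      have := hsq.eventually (hJt'.isLittleO.def hε')
      simpa [hJt0] using this
    have hev := (e1 0).and <| (e1 1).and <| (e1 2).and <| e2.and <| (hZJ 0).and <| (hZJ 1).and <|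
      (hZJ 2).and <| (hneg.eventually (hZJ 0)).and <| (hneg.eventually (hZJ 1)).and <|
      (hneg.eventually (hZJ 2)).and (hsq.eventually hZt)
    obtain ⟨h, ⟨a0, a1, a2, a3, b0, b1, b2, c0, c1, c2, d0⟩, h0, hδ'⟩ :=
      ((hev.filter_mono nhdsWithin_le_nhds).and (Ioo_mem_nhdsGT hδ)).exists
    have key := (H h h0 hδ').1
    simp only [Fin.sum_univ_three] at key ⊢
    rw [abs_le] at a0 a1 a2 a3
    change -_ ≤ J 0 h + J 0 (-h) - _ - _ ∧ J 0 h + J 0 (-h) - _ - _ ≤ _ at a0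
    change -_ ≤ J 1 h + J 1 (-h) - _ - _ ∧ J 1 h + J 1 (-h) - _ - _ ≤ _ at a1
    change -_ ≤ J 2 h + J 2 (-h) - _ - _ ∧ J 2 h + J 2 (-h) - _ - _ ≤ _ at a2
    have hh : 0 < h ^ 2 := by positivity
    refine le_of_mul_le_mul_right ?_ hh
    set X := W₀ / (2 * N₀) * (e 0 + e 1 + e 2 - τ) + W₀ * m' / (2 * m t)
      - 3 * W₀ / (4 * N₀ ^ 2) * (b 0 ^ 2 + b 1 ^ 2 + b 2 ^ 2) with hX
    have hX' : X * h ^ 2 = -(h ^ 2 * (W₀ * (3 * b 0 ^ 2 / (4 * N₀ ^ 2) - e 0 / (2 * N₀)))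
        + h ^ 2 * (W₀ * (3 * b 1 ^ 2 / (4 * N₀ ^ 2) - e 1 / (2 * N₀)))
        + h ^ 2 * (W₀ * (3 * b 2 ^ 2 / (4 * N₀ ^ 2) - e 2 / (2 * N₀)))
        + -h ^ 2 * (-(W₀ / 2) * (τ / N₀ - m' / m t))) := by
      rw [hX]; field_simp; ring
    have hXle : X * h ^ 2 ≤ (6 * W₀ - (J 0 h + J 0 (-h)) - (J 1 h + J 1 (-h)) - (J 2 h + J 2 (-h)))
        + (W₀ - Jt (t - h ^ 2)) + 4 * ε' * h ^ 2 := by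
      rw [hX']; linarith [a0.2, a1.2, a2.2, a3.2]
    have := mul_le_mul_of_nonneg_left hXle hc.le
    have h4 := mul_le_mul_of_nonneg_right hε2 hh.le
    rw [hZc] at key
    linarith
  · refine le_of_forall_pos_le_add fun ε hε => ?_
    obtain ⟨ε', hε', hε2⟩ : ∃ ε' > 0, 2 * N₀ * ((1 + c) * ε') ≤ ε :=
      ⟨ε / (2 * N₀ * (1 + c)), by positivity, by field_simp; norm_num⟩
    obtain ⟨δ, hδ, H⟩ := hbar ε' hε'
    have e1 := (hJj i).first hε'
    have hev := e1.and <| (hneg.eventually e1).and <| (hZJ i).and (hneg.eventually (hZJ i))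
    obtain ⟨h, ⟨a0, a1, b0, b1⟩, h0, hδ'⟩ :=
      ((hev.filter_mono nhdsWithin_le_nhds).and (Ioo_mem_nhdsGT hδ)).exists
    have key := (H h h0 hδ').2 i
    have k1 := key h (abs_of_pos h0)
    have k2 := key (-h) (by rw [abs_neg, abs_of_pos h0])
    rw [abs_neg, abs_of_pos h0, abs_le] at a1
    rw [abs_of_pos h0, abs_le] at a0
    change -_ ≤ J i h - _ - _ ∧ J i h - _ - _ ≤ _ at a0
    change -_ ≤ J i (-h) - _ - _ ∧ J i (-h) - _ - _ ≤ _ at a1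
    set y := W₀ * b i / (2 * N₀) with hy
    have hb : c * W₀ * |b i| = 2 * N₀ * (c * |y|) := by
      rw [hy, abs_div, abs_mul, abs_of_pos hW₀, abs_of_pos (by positivity : 0 < 2 * N₀)]; field_simp
    have p1 := mul_le_mul_of_nonneg_left a0.2 hc.le
    have p2 := mul_le_mul_of_nonneg_left a1.2 hc.le
    rw [hZc] at k1 k2
    have q : c * |y| ≤ d + (1 + c) * ε' := by
      rw [← abs_of_pos hc, ← abs_mul, abs_of_pos hc]
      refine abs_le'.2 ⟨?_, ?_⟩ <;> refine le_of_mul_le_mul_right ?_ h0 <;> linarith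
    rw [hb]
    have := mul_le_mul_of_nonneg_left q (by positivity : 0 ≤ 2 * N₀)
    linarith

end Touch

/-! ### The maximum principle for the localised pinching function -/

section Maximum

open Filter Topology

variable {T : ℝ} {g : (Fin 3 → ℝ) → ℝ → Matrix (Fin 3) (Fin 3) ℝ} {t : ℝ} {x : Fin 3 → ℝ}
  {E : Matrix (Fin 3) (Fin 3) ℝ} {ρ : Fin 3 → ℝ}

/-- A Ricci frame with eigenvalues in decreasing order. -/
def IsSortedFrame (G S E : Matrix (Fin 3) (Fin 3) ℝ) (ρ : Fin 3 → ℝ) : Prop :=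
  IsRicciFrame G S E ρ ∧ ρ 1 ≤ ρ 0 ∧ ρ 2 ≤ ρ 1

/-- The largest value of the pinching function in terms of the Ricci eigenvalues. -/
def maxPinch (k : ℝ) (ρ : Fin 3 → ℝ) : ℝ := -k * (ρ 0 + ρ 1 + ρ 2) + 2 * (k - 1) * ρ 0

lemma exists_isSortedFrame (hT : 0 < T) (hg : SmoothMetricFamily g (Icc 0 T))
    (hf : IsRicciFlow g (Icc 0 T)) (ht : t ∈ Icc 0 T) (x : Fin 3 → ℝ) :
    ∃ E ρ, IsSortedFrame (g x t) (Matrix.of (ricci (fun y => g y t) x)) E ρ := by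
  refine exists_isRicciFrame (hg.2 x t ht).2 (Matrix.IsSymm.ext fun i j => ?_)
  have := (slab_isAlgRicciFlow hT hg hf).ric_symm i j
  rw [Matrix.of_apply, Matrix.of_apply, ← slabRic_apply hT hg _ _ ht, ← slabRic_apply hT hg _ _ ht]
  exact congrArg (fun f : slabAlg T => (f : (Fin 3 → ℝ) × ℝ → ℝ) (x, t)) this.symm

lemma IsSortedFrame.column_ne_zero {G S : Matrix (Fin 3) (Fin 3) ℝ} (hE : IsSortedFrame G S E ρ) :
    (fun a => E a 0) ≠ 0 := fun h => by
  have := congrFun (congrFun (isRicciFrame_iff.1 hE.1).1 0) 0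
  simp [Matrix.mul_apply, fun a => congrFun h a] at this

lemma quad_slabG (hg : SmoothMetricFamily g (Icc 0 T)) (ht : t ∈ Icc 0 T) (x v : Fin 3 → ℝ) :
    quad (slabG hg) (x, t) v = qf (g x t) v := by
  simp only [quad, qf, slabG_apply hg _ _ ht]
  exact Finset.sum_congr rfl fun i _ => Finset.sum_congr rfl fun j _ => by ring

lemma quad_slabRic (hT : 0 < T) (hg : SmoothMetricFamily g (Icc 0 T)) (ht : t ∈ Icc 0 T)
    (x v : Fin 3 → ℝ) :
    quad (slabRic hT hg) (x, t) v = qf (Matrix.of (ricci (fun y => g y t) x)) v := by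
  simp only [quad, qf, slabRic_apply hT hg _ _ ht, Matrix.of_apply]
  exact Finset.sum_congr rfl fun i _ => Finset.sum_congr rfl fun j _ => by ring

lemma pinch_apply (hT : 0 < T) (hg : SmoothMetricFamily g (Icc 0 T)) (ht : t ∈ Icc 0 T) (k : ℝ)
    (x v : Fin 3 → ℝ) :
    pinch hT hg k (x, t) v = -k * scalarCurv (fun y => g y t) x
      + 2 * (k - 1) * (qf (Matrix.of (ricci (fun y => g y t) x)) v * (qf (g x t) v)⁻¹) := by
  rw [pinch, slabScal_apply hT hg ht, quad_slabG hg ht, quad_slabRic hT hg ht]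

lemma pinch_smul (hT : 0 < T) (hg : SmoothMetricFamily g (Icc 0 T)) (ht : t ∈ Icc 0 T) (k : ℝ)
    (x v : Fin 3 → ℝ) {a : ℝ} (ha : a ≠ 0) :
    pinch hT hg k (x, t) (a • v) = pinch hT hg k (x, t) v := by
  rw [pinch_apply hT hg ht, pinch_apply hT hg ht, qf_smul, qf_smul, mul_inv,
    mul_mul_mul_comm (a ^ 2), mul_inv_cancel₀ (pow_ne_zero 2 ha), one_mul]

lemma qf_mulVec (M E : Matrix (Fin n) (Fin n) ℝ) (w : Fin n → ℝ) :
    qf M (E *ᵥ w) = qf (Eᵀ * M * E) w := by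
  simp only [qf_eq_dotProduct, star_trivial, ← Matrix.mulVec_mulVec, Matrix.dotProduct_mulVec,
    Matrix.vecMul_transpose]

lemma IsSortedFrame.pinch_eq (hT : 0 < T) (hg : SmoothMetricFamily g (Icc 0 T)) (ht : t ∈ Icc 0 T)
    (hE : IsSortedFrame (g x t) (Matrix.of (ricci (fun y => g y t) x)) E ρ) (k : ℝ) :
    pinch hT hg k (x, t) (fun a => E a 0) = maxPinch k ρ := by
  have h1 : qf (g x t) (fun a => E a 0) = 1 := by
    rw [← quad_slabG hg ht, quad]
    simpa [slabG_apply hg _ _ ht] using hE.1.metric 0 0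
  have h2 : qf (Matrix.of (ricci (fun y => g y t) x)) (fun a => E a 0) = ρ 0 := by
    rw [← quad_slabRic hT hg ht, quad]
    simpa [slabRic_apply hT hg _ _ ht] using hE.1.ric 0 0
  rw [pinch_apply hT hg ht, h1, h2, IsRicciFrame.scalarCurv (G := fun y => g y t) hE.1, maxPinch,
    Fin.sum_univ_three]
  ring

lemma IsSortedFrame.pinch_le (hT : 0 < T) (hg : SmoothMetricFamily g (Icc 0 T)) (ht : t ∈ Icc 0 T)
    (hE : IsSortedFrame (g x t) (Matrix.of (ricci (fun y => g y t) x)) E ρ) {k : ℝ} (hk : 1 ≤ k)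
    {v : Fin 3 → ℝ} (hv : v ≠ 0) : pinch hT hg k (x, t) v ≤ maxPinch k ρ := by
  obtain ⟨h1, h2⟩ := isRicciFrame_iff.1 hE.1
  have hEE : E * (Eᵀ * g x t) = 1 := mul_eq_one_comm.mp h1
  obtain ⟨w, rfl⟩ : ∃ w, v = E *ᵥ w := ⟨(Eᵀ * g x t) *ᵥ v, by
    rw [Matrix.mulVec_mulVec, hEE, Matrix.one_mulVec]⟩
  have hpos := qf_pos (hg.2 x t ht).2 hv
  rw [pinch_apply hT hg ht, IsRicciFrame.scalarCurv (G := fun y => g y t) hE.1, maxPinch,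
    Fin.sum_univ_three]
  have : qf (Matrix.of (ricci (fun y => g y t) x)) (E *ᵥ w) * (qf (g x t) (E *ᵥ w))⁻¹ ≤ ρ 0 := by
    rw [← div_eq_mul_inv, div_le_iff₀ hpos, qf_mulVec, qf_mulVec, h1, h2]
    simp only [qf, Fin.sum_univ_three, Matrix.diagonal_apply, Matrix.one_apply]
    simp
    nlinarith [sq_nonneg (w 1), sq_nonneg (w 2), hE.2.1, hE.2.2,
      mul_nonneg (sub_nonneg.2 hE.2.1) (sq_nonneg (w 1)),
      mul_nonneg (sub_nonneg.2 (hE.2.2.trans hE.2.1)) (sq_nonneg (w 2))]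
  have := mul_le_mul_of_nonneg_left this (show 0 ≤ 2 * (k - 1) by linarith)
  linarith

lemma continuousOn_slab_comp {X : Type*} [TopologicalSpace X] (f : slabAlg T)
    {u : X → (Fin 3 → ℝ) × ℝ} {S : Set X} (hu : ContinuousOn u S) (hS : ∀ p ∈ S, (u p).2 ∈ Icc 0 T) :
    ContinuousOn (fun p => (f : (Fin 3 → ℝ) × ℝ → ℝ) (u p)) S :=
  (slabAlg_contDiffOn f).continuousOn.comp hu fun p hp => mem_slab.2 (hS p hp)

lemma continuousOn_pinch {X : Type*} [TopologicalSpace X] (hT : 0 < T)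
    (hg : SmoothMetricFamily g (Icc 0 T)) (k : ℝ) {u : X → (Fin 3 → ℝ) × ℝ} {w : X → Fin 3 → ℝ}
    {S : Set X} (hu : ContinuousOn u S) (hw : ContinuousOn w S) (hS : ∀ p ∈ S, (u p).2 ∈ Icc 0 T)
    (hne : ∀ p ∈ S, w p ≠ 0) : ContinuousOn (fun p => pinch hT hg k (u p) (w p)) S := by
  have hw' := fun i => (continuous_apply (A := fun _ : Fin 3 => ℝ) i).comp_continuousOn hw
  have hq : ∀ Q : Fin 3 → Fin 3 → slabAlg T, ContinuousOn (fun p => quad Q (u p) (w p)) S := fun Q =>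
    continuousOn_finsetSum _ fun i _ => continuousOn_finsetSum _ fun j _ =>
      ((hw' i).mul (hw' j)).mul (continuousOn_slab_comp (Q i j) hu hS)
  refine (continuousOn_const.mul (continuousOn_slab_comp _ hu hS)).add
    (continuousOn_const.mul ((hq _).mul ((hq _).inv₀ fun p hp => ?_)))
  rw [show u p = ((u p).1, (u p).2) from rfl, quad_slabG hg (hS p hp)]
  exact (qf_pos (hg.2 _ _ (hS p hp)).2 (hne p hp)).ne'

/-- The localised pinching function attains its maximum over a parabolic ball. -/
lemma exists_max_localised_pinch (hT : 0 < T) (hg : SmoothMetricFamily g (Icc 0 T)) (k : ℝ)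
    {x₀ : Fin 3 → ℝ} {r R : ℝ} (hR : R < r)
    (hK : ∀ t ∈ Icc 0 T, IsCompact (closure (rBall (fun y => g y t) x₀ r)))
    {m : ℝ → ℝ} (hm : ContinuousOn m (Icc 0 T)) (hm0 : ∀ t ∈ Icc 0 T, 0 < m t)
    {t : ℝ} (ht : t ∈ Icc 0 T) {x v : Fin 3 → ℝ} (hx : riemDist (fun y => g y t) x₀ x ≤ R) (hv : v ≠ 0) :
    ∃ t₁ ∈ Icc 0 T, ∃ x₁ v₁ r₁, v₁ ≠ 0 ∧ riemDist (fun y => g y t₁) x₀ x₁ ≤ r₁ ∧ r₁ ≤ R ∧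
      ∀ t ∈ Icc 0 T, ∀ x, riemDist (fun y => g y t) x₀ x ≤ R → ∀ v, v ≠ 0 →
        (1 - riemDist (fun y => g y t) x₀ x ^ 2 / R ^ 2) ^ 2 * pinch hT hg k (x, t) v / m t
          ≤ (1 - r₁ ^ 2 / R ^ 2) ^ 2 * pinch hT hg k (x₁, t₁) v₁ / m t₁ := by
  let M : (Fin 3 → ℝ) × ℝ → Matrix (Fin 3) (Fin 3) ℝ := fun p => g p.1 (projIcc 0 T hT.le p.2)
  have hMe : ∀ t ∈ Icc 0 T, ∀ x, M (x, t) = g x t := fun t ht x => by simp only [M, projIcc_of_mem hT.le ht]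
  have hM : ∀ i j, Continuous fun p => M p i j := fun i j => by
    refine (hg.1 i j).continuousOn.comp_continuous (f := fun p : (Fin 3 → ℝ) × ℝ =>
      (p.1, (projIcc 0 T hT.le p.2 : ℝ))) (continuous_fst.prodMk (continuous_subtype_val.comp
        (continuous_projIcc.comp continuous_snd))) fun p => ⟨mem_univ _, (projIcc 0 T hT.le p.2).2⟩
  have hpos : ∀ p, (M p).PosDef := fun p => (hg.2 _ _ (projIcc 0 T hT.le p.2).2).2
  have hMf : ∀ t ∈ Icc 0 T, (fun y => M (y, t)) = fun y => g y t := fun t ht => funext (hMe t ht)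
  have hcomp := isCompact_epigraph (x₀ := x₀) hM hpos hR fun t ht => by rw [hMf t ht]; exact hK t ht
  set S := {p : (Fin 3 → ℝ) × ℝ × ℝ | p.2.1 ∈ Icc 0 T ∧
      riemDist (fun y => M (y, p.2.1)) x₀ p.1 ≤ p.2.2 ∧ p.2.2 ≤ R} with hS
  have hM' : ∀ i j, Continuous fun p : (Fin 3 → ℝ) × ℝ × ℝ => M (p.1, p.2.1) i j := fun i j =>
    (hM i j).comp (by fun_prop)
  set 𝒦 := {q : ((Fin 3 → ℝ) × ℝ × ℝ) × (Fin 3 → ℝ) | q.1 ∈ S ∧ qf (M (q.1.1, q.1.2.1)) q.2 ≤ 1}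
    ∩ {q | qf (M (q.1.1, q.1.2.1)) q.2 = 1} with h𝒦
  have h𝒦c : IsCompact 𝒦 :=
    (isCompact_qf_le (M := fun p : (Fin 3 → ℝ) × ℝ × ℝ => M (p.1, p.2.1)) hcomp hM'
      (fun _ _ => hpos _) 1).inter_right (isClosed_eq (continuous_qf (M := fun p :
        (Fin 3 → ℝ) × ℝ × ℝ => M (p.1, p.2.1)) hM') continuous_const)
  have hne : ∀ q ∈ 𝒦, q.2 ≠ 0 := fun q hq h0 => by
    have h1 : qf (M (q.1.1, q.1.2.1)) q.2 = 1 := hq.2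
    simp [h0, qf] at h1
  have hmem : ∀ t ∈ Icc 0 T, ∀ x, riemDist (fun y => g y t) x₀ x ≤ R → ∀ v, v ≠ 0 →
      ((x, t, riemDist (fun y => g y t) x₀ x), (√(qf (g x t) v))⁻¹ • v) ∈ 𝒦 := by
    intro t ht x hx v hv
    have h0 := qf_pos (hg.2 x t ht).2 hv
    have h1 : qf (M (x, t)) ((√(qf (g x t) v))⁻¹ • v) = 1 := by
      rw [hMe t ht, qf_smul, inv_pow, Real.sq_sqrt h0.le, inv_mul_cancel₀ h0.ne']
    exact ⟨⟨⟨ht, by simp only [hMf t ht, le_refl], hx⟩, h1.le⟩, h1⟩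
  have hcont : ContinuousOn (fun q : ((Fin 3 → ℝ) × ℝ × ℝ) × (Fin 3 → ℝ) =>
      (1 - q.1.2.2 ^ 2 / R ^ 2) ^ 2 * pinch hT hg k (q.1.1, q.1.2.1) q.2 / m q.1.2.1) 𝒦 := by
    refine ((by fun_prop : Continuous fun q : ((Fin 3 → ℝ) × ℝ × ℝ) × (Fin 3 → ℝ) =>
      (1 - q.1.2.2 ^ 2 / R ^ 2) ^ 2).continuousOn.mul (continuousOn_pinch hT hg k
        (by fun_prop) (by fun_prop) (fun q hq => hq.1.1.1) hne)).div
      (hm.comp (f := fun q : ((Fin 3 → ℝ) × ℝ × ℝ) × (Fin 3 → ℝ) => q.1.2.1) (by fun_prop)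
        fun q hq => hq.1.1.1) fun q hq => (hm0 _ hq.1.1.1).ne'
  obtain ⟨⟨⟨x₁, t₁, r₁⟩, v₁⟩, hq, hmax⟩ := h𝒦c.exists_isMaxOn ⟨_, hmem t ht x hx v hv⟩ hcont
  have ht₁ : t₁ ∈ Icc 0 T := hq.1.1.1
  refine ⟨t₁, ht₁, x₁, v₁, r₁, hne _ hq, ?_, hq.1.1.2.2, fun t ht x hx v hv => ?_⟩
  · have := hq.1.1.2.1
    simpa only [hMf t₁ ht₁] using this
  · have := hmax (hmem t ht x hx v hv)
    simp only [mem_ofPred_eq] at this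
    rwa [pinch_smul hT hg ht] at this
    exact inv_ne_zero (Real.sqrt_pos.2 (qf_pos (hg.2 x t ht).2 hv)).ne'

/-- The contradiction at a maximum point of the localised pinching function. -/
lemma touching_contradiction {A R W₀ N₀ d τ m m' F : ℝ} {b e : Fin 3 → ℝ} (hR : 0 < R) (hA : 0 ≤ A)
    (hW₀ : 0 < W₀) (hW₁ : W₀ ≤ 1) (hN₀ : 0 < N₀) (hm0 : 0 < m) (hd : d ≤ R)
    (hF : τ - ∑ i, e i = -F) (hF' : N₀ ^ 2 / 2 ≤ F) (hm' : -m ^ 2 / 4 ≤ m')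
    (hmA : 8 * (16 * A + 36) / R ^ 2 ≤ m) (hκ : m < W₀ ^ 2 * N₀)
    (h1 : R ^ 2 / 2 * (W₀ / (2 * N₀) * (∑ i, e i - τ) + W₀ * m' / (2 * m)
      - 3 * W₀ / (4 * N₀ ^ 2) * ∑ i, b i ^ 2) ≤ 8 * A)
    (h2 : ∀ i, R ^ 2 / 2 * W₀ * |b i| ≤ 2 * N₀ * d) : False := by
  have hF2 : ∑ i, e i - τ = F := by linarith
  rw [hF2] at h1
  have hb : ∀ i, R ^ 2 * (W₀ ^ 2 * b i ^ 2 / N₀ ^ 2) ≤ 16 := by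
    intro i
    have h3 : R * (W₀ * |b i|) ≤ 4 * N₀ := by
      refine le_of_mul_le_mul_left ?_ hR
      nlinarith [h2 i]
    have h4 := pow_le_pow_left₀ (by positivity) h3 2
    rw [mul_pow, mul_pow, sq_abs] at h4
    rw [mul_div_assoc', div_le_iff₀ (by positivity)]
    linarith
  have hW2 : W₀ ^ 2 ≤ 1 := pow_le_one₀ hW₀.le hW₁
  have hG : W₀ * (W₀ / (2 * N₀) * F) > m / 4 := by
    calc m / 4 < W₀ ^ 2 * N₀ / 4 := by linarith
      _ = W₀ ^ 2 / (2 * N₀) * (N₀ ^ 2 / 2) := by field_simp; ring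
      _ ≤ W₀ ^ 2 / (2 * N₀) * F := by gcongr
      _ = _ := by ring
  have hM : -(m / 8) ≤ W₀ * (W₀ * m' / (2 * m)) := by
    calc -(m / 8) ≤ W₀ ^ 2 * (-(m / 8)) := by nlinarith
      _ = W₀ ^ 2 * ((-m ^ 2 / 4) / (2 * m)) := by field_simp; ring
      _ ≤ W₀ ^ 2 * (m' / (2 * m)) := by gcongr
      _ = _ := by ring
  have hB : R ^ 2 / 2 * (W₀ * (3 * W₀ / (4 * N₀ ^ 2) * ∑ i, b i ^ 2)) ≤ 18 := by
    calc _ = 3 / 8 * ∑ i, R ^ 2 * (W₀ ^ 2 * b i ^ 2 / N₀ ^ 2) := by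
          rw [Fin.sum_univ_three, Fin.sum_univ_three]; field_simp; ring
      _ ≤ 3 / 8 * ∑ i : Fin 3, (16 : ℝ) := by gcongr; exact hb _
      _ = 18 := by rw [Fin.sum_univ_three]; norm_num
  have hA' : 4 * (16 * A + 36) ≤ R ^ 2 / 2 * m := by
    rw [div_le_iff₀ (by positivity)] at hmA; linarith
  have h5 := mul_le_mul_of_nonneg_left h1 hW₀.le
  have h6 : W₀ * (8 * A) ≤ 8 * A := by nlinarith
  have h7 : R ^ 2 / 2 * (m / 8) < R ^ 2 / 2 * (W₀ * (W₀ / (2 * N₀) * F) + W₀ * (W₀ * m' / (2 * m))) := by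
    gcongr; linarith
  nlinarith

theorem localised_pinch_le (hT : 0 < T) (hg : SmoothMetricFamily g (Icc 0 T))
    (hf : IsRicciFlow g (Icc 0 T)) {k : ℝ} (hk : 1 ≤ k) {x₀ : Fin 3 → ℝ} {r₀ A R : ℝ} (hr : 0 < r₀)
    (hA : 1 ≤ A) (hR0 : 0 < R) (hR : R < A * r₀)
    (hK : ∀ t ∈ Icc 0 T, IsCompact (closure (rBall (fun y => g y t) x₀ (A * r₀))))
    (hRic : ∀ t ∈ Icc 0 T, ∀ x ∈ rBall (fun y => g y t) x₀ r₀, Matrix.PosSemidef (Matrix.of fun i j =>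
      2 / r₀ ^ 2 * g x t i j - ricci (fun y => g y t) x i j))
    {m m' : ℝ → ℝ} (hm : ∀ t ∈ Icc 0 T, HasDerivWithinAt m (m' t) (Icc 0 T) t)
    (hm0 : ∀ t ∈ Icc 0 T, 0 < m t) (hm' : ∀ t ∈ Icc 0 T, -m t ^ 2 / 4 ≤ m' t)
    (hmA : ∀ t ∈ Icc 0 T, 8 * (16 * A + 36) / R ^ 2 ≤ m t)
    (h0 : ∀ x, riemDist (fun y => g y 0) x₀ x ≤ R → ∀ v, v ≠ 0 → pinch hT hg k (x, 0) v ≤ m 0)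
    (hF : ∀ t ∈ Icc 0 T, ∀ x, riemDist (fun y => g y t) x₀ x < R → ∀ E ρ,
      IsSortedFrame (g x t) (Matrix.of (ricci (fun y => g y t) x)) E ρ → m t < maxPinch k ρ →
      maxPinch k ρ ^ 2 / 2 ≤ reaction k ρ) :
    ∀ t ∈ Icc 0 T, ∀ x, riemDist (fun y => g y t) x₀ x ≤ R → ∀ v, v ≠ 0 →
      (1 - riemDist (fun y => g y t) x₀ x ^ 2 / R ^ 2) ^ 2 * pinch hT hg k (x, t) v ≤ m t := by
  intro t ht x hx v hv
  by_contra! hcon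
  obtain ⟨t₁, ht₁, x₁, v₁, r₁, hv₁, hr₁, hr₁R, hmax⟩ :=
    exists_max_localised_pinch hT hg k hR hK (fun t ht => (hm t ht).continuousWithinAt) hm0 ht hx hv
  set κ := (1 - r₁ ^ 2 / R ^ 2) ^ 2 * pinch hT hg k (x₁, t₁) v₁ / m t₁ with hκ
  have hκ1 : 1 < κ := ((one_lt_div (hm0 t ht)).2 hcon).trans_le (hmax t ht x hx v hv)
  set D := fun t x => riemDist (fun y => g y t) x₀ x with hD
  change D t₁ x₁ ≤ r₁ at hr₁
  have hD0 : ∀ t x, 0 ≤ D t x := fun t x => riemDist_nonneg _ _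
  have hmt := hm0 t₁ ht₁
  obtain ⟨E, ρ, hE⟩ := exists_isSortedFrame hT hg hf ht₁ x₁
  obtain ⟨hEg, -⟩ := isRicciFrame_iff.1 hE.1
  have hE0 := hE.column_ne_zero
  set N₀ := pinch hT hg k (x₁, t₁) (fun a => E a 0) with hN₀
  have hNρ : N₀ = maxPinch k ρ := hE.pinch_eq hT hg ht₁ k
  have hvN : pinch hT hg k (x₁, t₁) v₁ ≤ N₀ := hNρ ▸ hE.pinch_le hT hg ht₁ hk hv₁
  have hκm : κ * m t₁ = (1 - r₁ ^ 2 / R ^ 2) ^ 2 * pinch hT hg k (x₁, t₁) v₁ := by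
    rw [hκ]; field_simp
  have hκm' : m t₁ < κ * m t₁ := by nlinarith
  have hvpos : 0 < pinch hT hg k (x₁, t₁) v₁ := by
    by_contra! h
    nlinarith [mul_nonneg (sq_nonneg (1 - r₁ ^ 2 / R ^ 2)) (neg_nonneg.2 h)]
  have hr₁R' : r₁ < R := hr₁R.lt_of_ne fun h => by
    rw [h, div_self (by positivity), sub_self, zero_pow two_ne_zero, zero_mul] at hκm
    linarith
  have hW : ∀ s, 0 ≤ s → s < R → 0 < 1 - s ^ 2 / R ^ 2 ∧ 1 - s ^ 2 / R ^ 2 ≤ 1 := fun s hs hs' =>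
    ⟨sub_pos.2 ((div_lt_one (by positivity)).2 (by gcongr)), by
      have : 0 ≤ s ^ 2 / R ^ 2 := by positivity
      linarith⟩
  have hDR : D t₁ x₁ < R := hr₁.trans_lt hr₁R'
  set W₀ := 1 - D t₁ x₁ ^ 2 / R ^ 2 with hW₀
  obtain ⟨hW₀0, hW₀1⟩ := hW _ (hD0 t₁ x₁) hDR
  have hN₀0 : 0 < N₀ := hvpos.trans_le hvN
  have hle : κ * m t₁ ≤ W₀ ^ 2 * N₀ := by
    rw [hκm]
    have h1 := (hW r₁ ((hD0 _ _).trans hr₁) hr₁R').1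
    have h2 : 1 - r₁ ^ 2 / R ^ 2 ≤ W₀ := by
      rw [hW₀]; gcongr; exact hD0 _ _
    exact mul_le_mul (pow_le_pow_left₀ h1.le h2 2) hvN hvpos.le (sq_nonneg _)
  have heq : κ * m t₁ = W₀ ^ 2 * N₀ := by
    refine le_antisymm hle ?_
    rw [← div_le_iff₀ hmt]
    exact hmax t₁ ht₁ x₁ hDR.le _ hE0
  have hmN : m t₁ < W₀ ^ 2 * N₀ := hκm'.trans_le hle
  have hmN' : m t₁ < N₀ := hmN.trans_le (mul_le_of_le_one_left hN₀0.le (pow_le_one₀ hW₀0.le hW₀1))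
  have ht₁0 : 0 < t₁ := by
    refine ht₁.1.lt_of_ne' fun h => ?_
    have := h0 x₁ (by rw [← h]; exact hDR.le) _ hE0
    rw [← h] at this
    exact absurd this (not_le.2 hmN')
  obtain ⟨V, b, e, τ, hV, hV0, hjet, hτ, hsum⟩ := exists_pinch_jets hT hg hf k ht₁ x₁ hE.1
  have hc : (0 : ℝ) < R ^ 2 / 2 := by positivity
  have hhalf : ∀ s : ℝ, 1 / 2 * s ^ 2 / (R ^ 2 / 2) = s ^ 2 / R ^ 2 := fun s => by field_simp
  have hle_of : ∀ s : ℝ, 1 / 2 * s ^ 2 ≤ R ^ 2 / 2 → s ≤ R := fun s hs => by nlinarith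
  have hmaxS : ∀ i, ∀ᶠ h in 𝓝 (0 : ℝ),
      1 / 2 * D t₁ (geoCurve (fun y => g y t₁) x₁ (fun a => E a i) h) ^ 2 ≤ R ^ 2 / 2 →
      (1 - 1 / 2 * D t₁ (geoCurve (fun y => g y t₁) x₁ (fun a => E a i) h) ^ 2 / (R ^ 2 / 2)) ^ 2
        * pinch hT hg k (geoCurve (fun y => g y t₁) x₁ (fun a => E a i) h, t₁) (V i h) ≤ W₀ ^ 2 * N₀ := by
    intro i
    filter_upwards [(hV i).continuousAt.eventually_ne (by rw [hV0]; exact hE0)] with h hh hs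
    have := hmax t₁ ht₁ _ (hle_of _ hs) _ hh
    rw [div_le_iff₀ hmt, heq] at this
    rwa [hhalf]
  have hmaxT : ∀ s ∈ Icc 0 T, 1 / 2 * D s x₁ ^ 2 ≤ R ^ 2 / 2 →
      (1 - 1 / 2 * D s x₁ ^ 2 / (R ^ 2 / 2)) ^ 2 * pinch hT hg k (x₁, s) (fun a => E a 0) * m t₁
        ≤ W₀ ^ 2 * N₀ * m s := by
    intro s hs hs'
    have := hmax s hs x₁ (hle_of _ hs') _ hE0
    rw [div_le_iff₀ (hm0 s hs)] at this
    rw [hhalf, ← heq]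
    calc _ ≤ κ * m s * m t₁ := mul_le_mul_of_nonneg_right this hmt.le
      _ = _ := by ring
  obtain ⟨h1, h2⟩ := touching_inequalities ht₁0 ht₁.2 hc (Z₀ := 1 / 2 * D t₁ x₁ ^ 2) (by rw [hhalf])
    hW₀0 hN₀0 hjet hτ rfl (hm t₁ ht₁) hm0 hmaxS hmaxT (d := D t₁ x₁) (B := 8 * A) fun η hη => by
      obtain ⟨δ, hδ, H⟩ := distance_barrier hT hg hf ht₁ ht₁0 hr hA (hK t₁ ht₁) (hRic t₁ ht₁)
        (hDR.trans hR) hEg hη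
      refine ⟨δ, hδ, ?_⟩
      rw [show 2 * (1 / 2 * D t₁ x₁ ^ 2) = D t₁ x₁ ^ 2 by ring]
      exact H
  exact touching_contradiction hR0 (by linarith) hW₀0 hW₀1 hN₀0 hmt hDR.le hsum
    (hNρ ▸ hF t₁ ht₁ x₁ hDR E ρ hE (hNρ ▸ hmN')) (hm' t₁ ht₁) (hmA t₁ ht₁) hmN h1 h2

end Maximum

/-! ### Induction on the pinching parameter -/

section Induction

open Filter Topology

/-- A Ricci flow for positive time with the compactness and curvature hypotheses of the local
pinching estimate. -/
structure IsLocalFlow (T : ℝ) (g : (Fin 3 → ℝ) → ℝ → Matrix (Fin 3) (Fin 3) ℝ) (x₀ : Fin 3 → ℝ)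
    (r₀ A : ℝ) : Prop where
  time_pos : 0 < T
  radius_pos : 0 < r₀
  two_le : 2 ≤ A
  smooth : SmoothMetricFamily g (Icc 0 T)
  flow : IsRicciFlow g (Icc 0 T)
  compact : ∀ t ∈ Icc (0 : ℝ) T, IsCompact (closure (rBall (fun y => g y t) x₀ (A * r₀)))
  ricci_le : ∀ t ∈ Icc (0 : ℝ) T, ∀ x ∈ rBall (fun y => g y t) x₀ r₀,
    Matrix.PosSemidef (Matrix.of fun i j => 2 / r₀ ^ 2 * g x t i j - ricci (fun y => g y t) x i j)

variable {T : ℝ} {g : (Fin 3 → ℝ) → ℝ → Matrix (Fin 3) (Fin 3) ℝ} {t : ℝ} {x x₀ : Fin 3 → ℝ}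
  {E : Matrix (Fin 3) (Fin 3) ℝ} {ρ : Fin 3 → ℝ} {r₀ A K C D θ θ' : ℝ}

/-- The curvature bound at time `t` on the ball of radius `r`. -/
def MaxPinchLE (g : (Fin 3 → ℝ) → ℝ → Matrix (Fin 3) (Fin 3) ℝ) (x₀ : Fin 3 → ℝ) (k t r B : ℝ) :
    Prop :=
  ∀ x ∈ rBall (fun y => g y t) x₀ r, ∀ E ρ,
    IsSortedFrame (g x t) (Matrix.of (ricci (fun y => g y t) x)) E ρ → maxPinch k ρ ≤ B

/-- The local pinching estimate, given a lower bound of the reaction term where the pinching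
function is large. -/
lemma IsLocalFlow.maxPinchLE_of_reaction (h : IsLocalFlow T g x₀ r₀ A) {k : ℝ} (hk : 1 ≤ k)
    (hθ : 0 < θ) (hθθ' : θ < θ') (hθ' : θ' < 1) (hC : 4 ≤ C) (hD : 416 / θ' ^ 2 ≤ D) (hK : 0 < K)
    (h0 : MaxPinchLE g x₀ k 0 (A * r₀) K)
    (hF : ∀ t ∈ Icc (0 : ℝ) T, ∀ x ∈ rBall (fun y => g y t) x₀ (θ' * (A * r₀)), ∀ E ρ,
      IsSortedFrame (g x t) (Matrix.of (ricci (fun y => g y t) x)) E ρ →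
      C / (t + 1 / K) + D / (A * r₀ ^ 2) < maxPinch k ρ → maxPinch k ρ ^ 2 / 2 ≤ reaction k ρ)
    (ht : t ∈ Icc 0 T) :
    MaxPinchLE g x₀ k t (θ * (A * r₀))
      ((C / (t + 1 / K) + D / (A * r₀ ^ 2)) / (1 - (θ / θ') ^ 2) ^ 2) := by
  intro x hx E ρ hE
  have hr := h.radius_pos
  have hA2 := h.two_le
  have hA : 0 < A := by linarith
  have hθ'0 : 0 < θ' := hθ.trans hθθ'
  have hD0 : 0 < D := lt_of_lt_of_le (by positivity) hD
  have hR0 : 0 < θ' * (A * r₀) := by positivity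
  have hK' : ∀ s ∈ Icc (0 : ℝ) T, 0 < s + 1 / K := fun s hs => by
    have := hs.1; positivity
  have hRA : θ' * (A * r₀) < A * r₀ := mul_lt_of_lt_one_left (by positivity) hθ'
  have main := localised_pinch_le h.time_pos h.smooth h.flow hk hr (by linarith) hR0 hRA h.compact
    h.ricci_le (m := fun s => C / (s + 1 / K) + D / (A * r₀ ^ 2))
    (m' := fun s => -C / (s + 1 / K) ^ 2)
    (fun s hs => by
      have h1 := ((hasDerivAt_id s).add_const (1 / K)).inv (hK' s hs).ne'
      have h2 := ((h1.const_mul C).add_const (D / (A * r₀ ^ 2))).hasDerivWithinAt (s := Icc 0 T)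
      exact h2.congr_deriv (by rw [id]; ring))
    (fun s hs => by have := hK' s hs; positivity)
    (fun s hs => by
      have h1 := hK' s hs
      have h2 : (C / (s + 1 / K)) ^ 2 ≤ (C / (s + 1 / K) + D / (A * r₀ ^ 2)) ^ 2 := by
        have : 0 < C / (s + 1 / K) := by positivity
        gcongr
        have : 0 < D / (A * r₀ ^ 2) := by positivity
        linarith
      have h3 : C / (s + 1 / K) ^ 2 ≤ (C / (s + 1 / K)) ^ 2 / 4 := by
        rw [div_pow, div_div, mul_comm, ← div_div]
        gcongr
        nlinarith
      rw [neg_div, neg_div]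
      linarith)
    (fun s hs => by
      have h1 : 0 < C / (s + 1 / K) := by have := hK' s hs; positivity
      have h2 : 8 * (16 * A + 36) / (θ' * (A * r₀)) ^ 2 ≤ 416 / θ' ^ 2 / (A * r₀ ^ 2) := by
        rw [div_div, div_le_div_iff₀ (by positivity) (by positivity)]
        have : 8 * (16 * A + 36) ≤ 416 * A := by linarith
        calc _ ≤ 416 * A * (θ' ^ 2 * (A * r₀ ^ 2)) := by gcongr
          _ = _ := by ring
      have h3 : 416 / θ' ^ 2 / (A * r₀ ^ 2) ≤ D / (A * r₀ ^ 2) := by gcongr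
      linarith)
    (fun y hy v hv => by
      have h0T : (0 : ℝ) ∈ Icc 0 T := left_mem_Icc.2 h.time_pos.le
      obtain ⟨E', ρ', hE'⟩ := exists_isSortedFrame h.time_pos h.smooth h.flow h0T y
      have h1 := hE'.pinch_le h.time_pos h.smooth h0T hk hv
      have h2 := h0 y (hy.trans_lt hRA) E' ρ' hE'
      have h3 : C / (0 + 1 / K) = C * K := by rw [zero_add, div_div_eq_mul_div, div_one]
      have h4 : 0 < D / (A * r₀ ^ 2) := by positivity
      nlinarith)
    hF t ht x (hx.le.trans (by gcongr)) _ hE.column_ne_zero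
  rw [hE.pinch_eq h.time_pos h.smooth ht] at main
  have hω : 0 < 1 - (θ / θ') ^ 2 :=
    sub_pos.2 (pow_lt_one₀ (by positivity) ((div_lt_one hθ'0).2 hθθ') two_ne_zero)
  rw [le_div_iff₀ (by positivity)]
  rcases le_or_gt (maxPinch k ρ) 0 with hN | hN
  · refine (mul_nonpos_of_nonpos_of_nonneg hN (by positivity)).trans ?_
    have := hK' t ht
    positivity
  · refine le_trans ?_ main
    rw [mul_comm]
    gcongr
    rw [← div_pow]
    refine pow_le_pow_left₀ (div_nonneg (riemDist_nonneg _ _) hR0.le) ?_ 2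
    rw [div_le_div_iff₀ hR0 hθ'0]
    have : riemDist (fun y => g y t) x₀ x < θ * (A * r₀) := hx
    nlinarith

/-- The frame form of the local pinching estimate with parameter `k`. -/
def HasLocalPinching (k : ℝ) : Prop :=
  ∀ θ : ℝ, 0 < θ → θ < 1 → ∃ C > (0 : ℝ), ∀ T g x₀ r₀ A K, IsLocalFlow T g x₀ r₀ A → 0 < K →
    MaxPinchLE g x₀ k 0 (A * r₀) K → ∀ t ∈ Icc (0 : ℝ) T,
    MaxPinchLE g x₀ k t (θ * (A * r₀)) (C / (t + 1 / K) + C / (A * r₀ ^ 2))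

lemma hasLocalPinching_of_reaction {k : ℝ} (hk : 1 ≤ k)
    (hF : ∀ θ : ℝ, 0 < θ → θ < 1 → ∃ C > (0 : ℝ), ∀ T g x₀ r₀ A K, IsLocalFlow T g x₀ r₀ A → 0 < K →
      MaxPinchLE g x₀ k 0 (A * r₀) K → ∀ t ∈ Icc (0 : ℝ) T,
      ∀ x ∈ rBall (fun y => g y t) x₀ (θ * (A * r₀)), ∀ E ρ,
      IsSortedFrame (g x t) (Matrix.of (ricci (fun y => g y t) x)) E ρ →
      C / (t + 1 / K) + C / (A * r₀ ^ 2) < maxPinch k ρ →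
      maxPinch k ρ ^ 2 / 2 ≤ reaction k ρ) : HasLocalPinching k := by
  intro θ hθ hθ1
  obtain ⟨C₀, hC₀, H⟩ := hF ((1 + θ) / 2) (by linarith) (by linarith)
  have hθθ' : θ < (1 + θ) / 2 := by linarith
  set θ' := (1 + θ) / 2 with hθ'
  have hω : 0 < 1 - (θ / θ') ^ 2 :=
    sub_pos.2 (pow_lt_one₀ (by positivity) ((div_lt_one (by linarith)).2 hθθ') two_ne_zero)
  set C := max C₀ (max 4 (416 / θ' ^ 2)) with hC
  have hC0 : 0 < C := lt_max_of_lt_left hC₀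
  refine ⟨C / (1 - (θ / θ') ^ 2) ^ 2, by positivity, fun T g x₀ r₀ A K hL hK h0 t ht x hx E ρ hE => ?_⟩
  refine (hL.maxPinchLE_of_reaction hk hθ hθθ' (by linarith) ((le_max_left _ _).trans (le_max_right _ _))
    ((le_max_right _ _).trans (le_max_right _ _)) hK h0 (fun s hs y hy E' ρ' hE' hlt => ?_) ht
    x hx E ρ hE).trans_eq (by ring)
  refine H T g x₀ r₀ A K hL hK h0 s hs y hy E' ρ' hE' (lt_of_le_of_lt ?_ hlt)
  have := hs.1
  have := hL.radius_pos
  have := hL.two_le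
  have : 0 < A := by linarith
  gcongr <;> exact le_max_left _ _

lemma hasLocalPinching_one : HasLocalPinching 1 :=
  hasLocalPinching_of_reaction le_rfl fun _ _ _ => ⟨1, one_pos, fun _ _ _ _ _ _ _ _ _ _ _ _ _ _ _ _ _ =>
    half_sq_le_reaction_one (by rw [maxPinch]; ring)⟩

lemma HasLocalPinching.add_one {k : ℝ} (hk : 1 ≤ k) (h : HasLocalPinching k) :
    HasLocalPinching (k + 1) := by
  refine hasLocalPinching_of_reaction (by linarith) fun θ hθ hθ1 => ?_
  obtain ⟨C, hC, H⟩ := h θ hθ hθ1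
  refine ⟨4 * (k + 1) * C, by positivity, fun T g x₀ r₀ A K hL hK h0 t ht x hx E ρ hE hlt => ?_⟩
  have h1 := H T g x₀ r₀ A K hL hK (fun y hy E' ρ' hE' => ?_) t ht x hx E ρ hE
  · have := ht.1
    have := hL.radius_pos
    have := hL.two_le
    have : 0 < A := by linarith
    have h2 : 4 * (k + 1) * (C / (t + 1 / K) + C / (A * r₀ ^ 2)) < maxPinch (k + 1) ρ := by
      refine lt_of_eq_of_lt ?_ hlt
      ring
    refine half_sq_le_reaction hE.2.1 hE.2.2 (by linarith) rfl (lt_trans (by positivity) h2)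
      (le_trans (le_of_eq ?_) h1) h2.le
    rw [maxPinch]; ring
  · have := h0 y hy E' ρ' hE'
    obtain ⟨-, h10, h21⟩ := hE'
    rw [maxPinch] at this ⊢
    rcases le_or_gt (ρ' 1 + ρ' 2) (ρ' 0) with hν | hν <;> nlinarith

lemma hasLocalPinching_natCast {k : ℕ} (hk : 1 ≤ k) : HasLocalPinching k := by
  induction k, hk using Nat.le_induction with
  | base => exact_mod_cast hasLocalPinching_one
  | succ k hk ih => exact_mod_cast ih.add_one (by exact_mod_cast hk)

end Induction

/-- Local Hamilton–Ivey-type pinching estimate in dimension 3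
(Proposition 2.2 (i)). -/
theorem stmt_3 (k : ℕ) (hk : 0 < k) :
    ∃ C > (0:ℝ), ∀ (T : ℝ) (g : (Fin 3 → ℝ) → ℝ → Matrix (Fin 3) (Fin 3) ℝ)
      (x₀ : Fin 3 → ℝ) (r₀ A Kk : ℝ), 0 < r₀ → 2 ≤ A → 0 < Kk →
      SmoothMetricFamily g (Icc 0 T) → IsRicciFlow g (Icc 0 T) →
      (∀ t ∈ Icc (0:ℝ) T, IsCompact (closure (rBall (fun y => g y t) x₀ (A*r₀)))) →
      (∀ t ∈ Icc (0:ℝ) T, ∀ x ∈ rBall (fun y => g y t) x₀ r₀,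
        Matrix.PosSemidef (Matrix.of fun i j =>
          2/r₀^2 * g x t i j - ricci (fun y => g y t) x i j)) →
      (∀ x ∈ rBall (fun y => g y 0) x₀ (A*r₀), ∀ lam mu nu : ℝ,
        IsEigTriple (curvOp (fun y => g y 0) x) lam mu nu → -Kk ≤ lam + mu + k*nu) →
      ∀ t ∈ Icc (0:ℝ) T, ∀ x ∈ rBall (fun y => g y t) x₀ (A/2*r₀),
        ∀ lam mu nu : ℝ, IsEigTriple (curvOp (fun y => g y t) x) lam mu nu →
          min (-(C/(t + 1/Kk))) (-(C/(A*r₀^2))) ≤ lam + mu + k*nu := by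
  obtain ⟨C, hC, H⟩ := hasLocalPinching_natCast hk (1 / 2) (by norm_num) (by norm_num)
  refine ⟨max 1 (2 * C), by positivity, fun T g x₀ r₀ A K hr hA hK hg hf hcpt hRic h0 t ht x hx
    lam mu nu hev => ?_⟩
  have hA0 : 0 < A := by linarith
  have hx' : riemDist (fun y => g y t) x₀ x < A / 2 * r₀ := hx
  rcases ht.1.eq_or_lt with rfl | ht0
  · refine (min_le_left _ _).trans (le_trans ?_ (h0 x (hx'.trans_le ?_) lam mu nu hev))
    · rw [zero_add, div_div_eq_mul_div, div_one, neg_le_neg_iff]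
      exact le_mul_of_one_le_left hK.le (le_max_left _ _)
    · gcongr; linarith
  have hL : IsLocalFlow T g x₀ r₀ A := ⟨ht0.trans_le ht.2, hr, hA, hg, hf, hcpt, hRic⟩
  obtain ⟨E, ρ, hE⟩ := exists_isSortedFrame hL.time_pos hg hf ht x
  obtain ⟨rfl, rfl, rfl⟩ :=
    (IsRicciFrame.isEigTriple_iff (G := fun y => g y t) hE.1 hE.2.1 hE.2.2).1 hev
  have h1 := H T g x₀ r₀ A K hL hK (fun y hy E' ρ' hE' => by
    have := h0 y hy _ _ _ ((IsRicciFrame.isEigTriple_iff (G := fun y => g y 0) hE'.1 hE'.2.1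
      hE'.2.2).2 ⟨rfl, rfl, rfl⟩)
    rw [maxPinch]
    linarith) t ht x (hx'.trans_eq (by ring)) E ρ hE
  have h2 : ∀ a : ℝ, 0 < a → 2 * (C / a) ≤ max 1 (2 * C) / a := fun a ha => by
    rw [mul_div_assoc']; gcongr; exact le_max_right _ _
  have h3 := h2 (t + 1 / K) (by positivity)
  have h4 := h2 (A * r₀ ^ 2) (by positivity)
  rw [maxPinch] at h1
  rcases le_total (C / (t + 1 / K)) (C / (A * r₀ ^ 2)) with h5 | h5
  · exact (min_le_right _ _).trans (by linarith)
  · exact (min_le_left _ _).trans (by linarith)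

end
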